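/- For all integers α ≥ 1 and all integers n ≥ 0, d_3(7^α·n + λ_α) ≡ 0 (mod 7^⌊α/2⌋), where λ_α = (5·7^α + 1)/6. -/

import Mathlib

noncomputable section

/-- `J b = ∏_{k=1}^∞ (1 - q^{b·k})` as a formal power series with integer coefficients,
defined coefficientwise via the finite partial products (factors with `k > n` do not
affect the coefficient of `q^n`). -/
def J (b : ℕ) : PowerSeries ℤ :=
  PowerSeries.mk fun n =>
    PowerSeries.coeff n
      (∏ k ∈ Finset.range (n + 1), (1 - (PowerSeries.X : PowerSeries ℤ) ^ (b * (k + 1))))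

section
open PowerSeries Filter Topology
open scoped PowerSeries.WithPiTopology

/-- complex version of `J` -/
def JC (b : ℕ) : PowerSeries ℂ := PowerSeries.map (Int.castRingHom ℂ) (J b)

lemma coeff_prod_stable {R : Type*} [CommRing R] (b n N : ℕ) (hb : 1 ≤ b) (hN : n + 1 ≤ N) :
    PowerSeries.coeff n (∏ k ∈ Finset.range N, (1 - (X : PowerSeries R) ^ (b * (k + 1)))) =
    PowerSeries.coeff n (∏ k ∈ Finset.range (n + 1), (1 - (X : PowerSeries R) ^ (b * (k + 1)))) := by
  induction N, hN using Nat.le_induction with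
  | base => rfl
  | succ N hN ih =>
    rw [Finset.prod_range_succ, mul_sub, map_sub, mul_one, ih, coeff_mul_X_pow', if_neg, sub_zero]
    nlinarith

lemma coeff_JC (b n N : ℕ) (hb : 1 ≤ b) (hN : n + 1 ≤ N) :
    PowerSeries.coeff n (JC b) =
    PowerSeries.coeff n (∏ k ∈ Finset.range N, (1 - (X : PowerSeries ℂ) ^ (b * (k + 1)))) := by
  rw [coeff_prod_stable b n N hb hN, JC, J, coeff_map, coeff_mk, ← coeff_map, map_prod]
  simp

lemma tendsto_JC (b : ℕ) (hb : 1 ≤ b) :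
    Tendsto (fun N => ∏ k ∈ Finset.range N, (1 - (X : PowerSeries ℂ) ^ (b * (k + 1)))) atTop
      (𝓝 (JC b)) := by
  rw [PowerSeries.WithPiTopology.tendsto_iff_coeff_tendsto]
  intro d
  refine tendsto_const_nhds.congr' ?_
  filter_upwards [eventually_ge_atTop (d+1)] with N hN
  exact coeff_JC b d N hb hN

lemma expand_JC (c b : ℕ) (hc : c ≠ 0) (hb : 1 ≤ b) : expand c hc (JC b) = JC (c * b) := by
  ext n
  rw [coeff_JC (c*b) n (n+1) (Nat.mul_pos (Nat.pos_of_ne_zero hc) hb) le_rfl]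
  have h1 : ∀ N, (∏ k ∈ Finset.range N, (1 - (X : PowerSeries ℂ) ^ (c * b * (k + 1)))) =
      expand c hc (∏ k ∈ Finset.range N, (1 - (X : PowerSeries ℂ) ^ (b * (k + 1)))) := by
    intro N
    rw [map_prod]
    simp [← pow_mul, mul_assoc]
  rw [h1]
  by_cases h : c ∣ n
  · obtain ⟨m, rfl⟩ := h
    rw [coeff_expand_mul, coeff_expand_mul]
    apply coeff_JC _ _ _ hb
    nlinarith [Nat.pos_of_ne_zero hc]
  · rw [coeff_expand_of_not_dvd _ _ _ h, coeff_expand_of_not_dvd _ _ _ h]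

lemma constCoeff_JC (b : ℕ) (hb : 1 ≤ b) : constantCoeff (JC b) = 1 := by
  rw [← coeff_zero_eq_constantCoeff_apply, coeff_JC b 0 1 hb le_rfl]
  have : b ≠ 0 := by omega
  simp [this]

lemma tendsto_rescale (a : ℂ) {f : ℕ → PowerSeries ℂ} {g : PowerSeries ℂ}
    (h : Tendsto f atTop (𝓝 g)) : Tendsto (fun n => rescale a (f n)) atTop (𝓝 (rescale a g)) := by
  rw [PowerSeries.WithPiTopology.tendsto_iff_coeff_tendsto] at *
  intro d
  simp only [coeff_rescale]
  exact (h d).const_mul _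

lemma neg_JC : rescale (-1) (JC 1) * JC 1 * JC 4 = JC 2 ^ 3 := by
  have h : ∀ N : ℕ, rescale (-1:ℂ) (∏ k ∈ Finset.range (2*N), (1 - (X : PowerSeries ℂ) ^ (1 * (k + 1))))
      * (∏ k ∈ Finset.range (2*N), (1 - (X : PowerSeries ℂ) ^ (1 * (k + 1)))) *
      (∏ k ∈ Finset.range N, (1 - (X : PowerSeries ℂ) ^ (4 * (k + 1)))) =
      (∏ k ∈ Finset.range N, (1 - (X : PowerSeries ℂ) ^ (2 * (k + 1)))) ^ 2 *
      (∏ k ∈ Finset.range (2*N), (1 - (X : PowerSeries ℂ) ^ (2 * (k + 1)))) := by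
    intro N
    induction N with
    | zero => simp
    | succ N ih =>
      rw [show 2 * (N+1) = 2 * N + 1 + 1 by ring]
      simp only [Finset.prod_range_succ, map_mul, map_sub, map_one, map_pow, rescale_X] at ih ⊢
      rw [show ((C (-1:ℂ)) : PowerSeries ℂ) = -1 by simp]
      have e1 : (-1 * X : PowerSeries ℂ)^(1 * (2*N+1)) = - X ^ (2*N+1) := by
        rw [one_mul, neg_one_mul, Odd.neg_pow ⟨N, rfl⟩]
      have e2 : (-1 * X : PowerSeries ℂ)^(1 * (2*N+1+1)) = X ^ (2*N+2) := by
        rw [one_mul, neg_one_mul, Even.neg_pow ⟨N+1, by ring⟩]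
      rw [e1, e2]
      have e3 : (X : PowerSeries ℂ) ^ (4 * (N+1)) = (X^(2*N+2))^2 := by rw [← pow_mul]; ring_nf
      have e4 : (X : PowerSeries ℂ) ^ (2 * (2*N+1)) = (X^(2*N+1))^2 := by rw [← pow_mul]; ring_nf
      have e5 : (X : PowerSeries ℂ) ^ (2 * (2*N+1+1)) = (X^(2*N+2))^2 := by rw [← pow_mul]; ring_nf
      have e6 : (X : PowerSeries ℂ) ^ (2 * (N+1)) = (X^(2*N+2)) := by ring_nf
      have e7 : (X : PowerSeries ℂ) ^ (1 * (2*N+1+1)) = (X^(2*N+2)) := by ring_nf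
      rw [e3, e4, e5, e6, e7, one_mul]
      generalize (X : PowerSeries ℂ) ^ (2*N+1) = u at *
      generalize (X : PowerSeries ℂ) ^ (2*N+2) = v at *
      linear_combination (1+u)*(1-v)*(1-u)*(1-v)*(1-v^2) * ih
  have t2 : Tendsto (fun N : ℕ => 2 * N) atTop atTop := tendsto_id.const_mul_atTop' (by norm_num)
  have a1 := (tendsto_JC 1 le_rfl).comp t2
  have a2 := (tendsto_JC 2 (by norm_num))
  have a3 := a2.comp t2
  have a4 := (tendsto_JC 4 (by norm_num))
  have b1 := ((tendsto_rescale (-1) a1).mul a1).mul a4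
  have b2 := (a2.pow 2).mul a3
  have := tendsto_nhds_unique (b1.congr h) b2
  rw [this]; ring

lemma prod_rescale_JC (ζ : ℂ) (hζ : IsPrimitiveRoot ζ 7) :
    (∏ j ∈ Finset.range 7, rescale (ζ^j) (JC 1)) * JC 49 = JC 7 ^ 8 := by
  have key : ∀ y : PowerSeries ℂ, ∀ k : ℕ, ¬ 7 ∣ k →
      ∏ j ∈ Finset.range 7, (1 - C ((ζ^j)^k) * y) = 1 - y ^ 7 := by
    intro y k hk
    have hp : IsPrimitiveRoot (ζ^k) 7 :=
      hζ.pow_of_coprime k ((Nat.Prime.coprime_iff_not_dvd (by norm_num)).2 hk).symm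
    have hp' : IsPrimitiveRoot (C (ζ^k) : PowerSeries ℂ) 7 :=
      hp.map_of_injective (f := (C : ℂ →+* PowerSeries ℂ)) (C_injective)
    have := hp'.pow_sub_pow_eq_prod_sub_mul 1 y (by norm_num)
    rw [one_pow] at this
    classical
    have him : Polynomial.nthRootsFinset 7 (1 : PowerSeries ℂ) =
        (Finset.range 7).image (fun j => (C (ζ^k) : PowerSeries ℂ) ^ j) := by
      symm
      apply Finset.eq_of_subset_of_card_le
      · intro x hx
        obtain ⟨j, -, rfl⟩ := Finset.mem_image.1 hx
        rw [Polynomial.mem_nthRootsFinset (by norm_num), ← pow_mul, mul_comm, pow_mul, hp'.pow_eq_one,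
          one_pow]
      · rw [hp'.card_nthRootsFinset, Finset.card_image_of_injOn, Finset.card_range]
        intro a ha b hb h
        exact hp'.pow_inj (by simpa using ha) (by simpa using hb) h
    rw [this, him, Finset.prod_image]
    · refine Finset.prod_congr rfl fun j _ => ?_
      rw [← map_pow, ← pow_mul, ← pow_mul, mul_comm j k]
    · intro a ha b hb h
      exact hp'.pow_inj (by simpa using ha) (by simpa using hb) h
  have key2 : ∀ y : PowerSeries ℂ, ∀ k : ℕ, 7 ∣ k →
      ∏ j ∈ Finset.range 7, (1 - C ((ζ^j)^k) * y) = (1 - y) ^ 7 := by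
    rintro y k ⟨l, rfl⟩
    have : ∀ j, (ζ^j)^(7*l) = 1 := by
      intro j
      rw [← pow_mul, mul_left_comm, pow_mul, hζ.pow_eq_one, one_pow]
    simp [this]
  have h : ∀ N : ℕ, (∏ j ∈ Finset.range 7,
      rescale (ζ^j) (∏ k ∈ Finset.range (7*N), (1 - (X : PowerSeries ℂ) ^ (1 * (k + 1)))))
      * (∏ k ∈ Finset.range N, (1 - (X : PowerSeries ℂ) ^ (49 * (k + 1)))) =
      (∏ k ∈ Finset.range N, (1 - (X : PowerSeries ℂ) ^ (7 * (k + 1)))) ^ 7 *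
      (∏ k ∈ Finset.range (7*N), (1 - (X : PowerSeries ℂ) ^ (7 * (k + 1)))) := by
    intro N
    induction N with
    | zero => simp
    | succ N ih =>
      have e : ∀ j k : ℕ, rescale (ζ^j) (1 - (X : PowerSeries ℂ) ^ (1 * (k+1))) =
          1 - C ((ζ^j)^(k+1)) * X^(k+1) := by
        intro j k
        rw [map_sub, map_one, one_mul, map_pow, rescale_X, mul_pow]; simp only [map_pow]
      rw [show 7 * (N+1) = 7 * N + 1 + 1 + 1 + 1 + 1 + 1 + 1 by ring]
      simp only [Finset.prod_range_succ (n := 7*N+1+1+1+1+1+1), Finset.prod_range_succ (n := 7*N+1+1+1+1+1),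
        Finset.prod_range_succ (n := 7*N+1+1+1+1), Finset.prod_range_succ (n := 7*N+1+1+1),
        Finset.prod_range_succ (n := 7*N+1+1), Finset.prod_range_succ (n := 7*N+1),
        Finset.prod_range_succ (n := 7*N), Finset.prod_range_succ (n := N), map_mul, Finset.prod_mul_distrib, e]
      rw [key _ (7*N+1) (by omega), key _ (7*N+1+1) (by omega), key _ (7*N+1+1+1) (by omega),
        key _ (7*N+1+1+1+1) (by omega), key _ (7*N+1+1+1+1+1) (by omega),
        key _ (7*N+1+1+1+1+1+1) (by omega), key2 _ (7*N+1+1+1+1+1+1+1) (by omega)]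
      simp only [← pow_mul, mul_comm _ 7]
      rw [show 49 * (N+1) = 7 * (7*N+1+1+1+1+1+1+1) by ring,
        show 7 * (N+1) = (7*N+1+1+1+1+1+1+1) by ring]
      simp only [mul_pow]
      generalize (X : PowerSeries ℂ) ^ (7*(7*N+1)) = u1
      generalize (X : PowerSeries ℂ) ^ (7*(7*N+1+1)) = u2
      generalize (X : PowerSeries ℂ) ^ (7*(7*N+1+1+1)) = u3
      generalize (X : PowerSeries ℂ) ^ (7*(7*N+1+1+1+1)) = u4
      generalize (X : PowerSeries ℂ) ^ (7*(7*N+1+1+1+1+1)) = u5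
      generalize (X : PowerSeries ℂ) ^ (7*(7*N+1+1+1+1+1+1)) = u6
      generalize (X : PowerSeries ℂ) ^ (7*(7*N+1+1+1+1+1+1+1)) = u7
      generalize (1 - (X : PowerSeries ℂ) ^ ((7*N+1+1+1+1+1+1+1)))^7 = u8
      generalize (1 - u1) = u1 at *
      generalize (1 - u2) = u2 at *
      generalize (1 - u3) = u3 at *
      generalize (1 - u4) = u4 at *
      generalize (1 - u5) = u5 at *
      generalize (1 - u6) = u6 at *
      generalize (1 - u7) = u7 at *
      simp only [map_prod] at ih ⊢
      linear_combination u1*u2*u3*u4*u5*u6*u7*u8 * ih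
  have t7 : Tendsto (fun N : ℕ => 7 * N) atTop atTop := tendsto_id.const_mul_atTop' (by norm_num)
  have a1 := (tendsto_JC 1 le_rfl).comp t7
  have a2 := (tendsto_JC 7 (by norm_num))
  have a3 := a2.comp t7
  have a4 := (tendsto_JC 49 (by norm_num))
  have b1 := (tendsto_finsetProd (Finset.range 7) (fun j _ => tendsto_rescale (ζ^j) a1)).mul a4
  have b2 := (a2.pow 7).mul a3
  have := tendsto_nhds_unique (b1.congr h) b2
  rw [this]; ring
end

section
open PowerSeries Filter Topology
open scoped PowerSeries.WithPiTopology

/-- Gaussian binomials -/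
def gb {R : Type*} [CommRing R] (q : R) : ℕ → ℕ → R
  | _, 0 => 1
  | 0, _ + 1 => 0
  | M + 1, k + 1 => gb q M (k + 1) + q ^ (M - k) * gb q M k

lemma gb_gt {R : Type*} [CommRing R] (q : R) : ∀ M k : ℕ, M < k → gb q M k = 0 := by
  intro M
  induction M with
  | zero => intro k hk; cases k with
    | zero => omega
    | succ k => simp [gb]
  | succ M ih => intro k hk; cases k with
    | zero => omega
    | succ k => simp [gb, ih (k+1) (by omega), ih k (by omega)]

def PP {R : Type*} [CommRing R] (q : R) (N : ℕ) : R := ∏ k ∈ Finset.range N, (1 - q ^ (k + 1))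

lemma gb_PP {R : Type*} [CommRing R] (q : R) : ∀ M k : ℕ, k ≤ M →
    gb q M k * PP q k * PP q (M - k) = PP q M := by
  intro M
  induction M with
  | zero => intro k hk; obtain rfl : k = 0 := by omega
            simp [gb, PP]
  | succ M ih => intro k hk; cases k with
    | zero => simp [gb, PP]
    | succ k =>
      have h2 := ih k (by omega)
      have e1 : PP q (k+1) = PP q k * (1 - q^(k+1)) := Finset.prod_range_succ _ _
      have e2 : PP q (M+1) = PP q M * (1 - q^(M+1)) := Finset.prod_range_succ _ _
      have e4 : q^(M+1) = q^(M-k) * q^(k+1) := by rw [← pow_add]; congr 1; omega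
      rw [show M + 1 - (k+1) = M - k by omega]
      simp only [gb]
      rcases Nat.lt_or_ge k M with h | h
      · have h1 := ih (k+1) (by omega)
        have e3 : PP q (M-k) = PP q (M-(k+1)) * (1 - q^(M-k)) := by
          rw [show M - k = (M-(k+1)) + 1 by omega]; exact Finset.prod_range_succ _ _
        rw [e2, e4]
        rw [e1] at h1 ⊢
        rw [e3] at h2 ⊢
        linear_combination (1 - q^(M-k)) * h1 + q^(M-k) * (1-q^(k+1)) * h2
      · obtain rfl : k = M := by omega
        rw [gb_gt q k (k+1) (by omega), e2]
        simp at h2 ⊢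
        linear_combination (1 - q^(k+1)) * h2

lemma qbinom {R : Type*} [CommRing R] (q x y : R) (M : ℕ) :
    ∏ i ∈ Finset.range M, (x + y * q ^ i) =
    ∑ k ∈ Finset.range (M+1), q ^ (k.choose 2) * gb q M k * x ^ (M - k) * y ^ k := by
  induction M with
  | zero => simp [gb]
  | succ M ih =>
    rw [Finset.prod_range_succ, ih, Finset.sum_range_succ' _ (M+1), mul_add, Finset.sum_mul, Finset.sum_mul]
    have h1 : ∑ k ∈ Finset.range (M+1), q ^ (k.choose 2) * gb q M k * x ^ (M - k) * y ^ k * x =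
        ∑ k ∈ Finset.range (M+1), q ^ ((k+1).choose 2) * gb q M (k+1) * x ^ (M - k) * y ^ (k+1) + x^(M+1) := by
      rw [Finset.sum_range_succ']
      conv_rhs => rw [Finset.sum_range_succ]
      simp only [gb_gt q M (M+1) (by omega)]
      simp only [gb, Nat.choose_zero_succ, pow_zero, Nat.sub_zero, one_mul, mul_one, mul_zero, zero_mul,
        add_zero, ← pow_succ]
      congr 1
      refine Finset.sum_congr rfl fun k hk => ?_
      have hk := Finset.mem_range.1 hk
      rw [show M - k = (M - (k+1)) + 1 by omega]
      ring
    rw [h1]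
    simp only [gb, Nat.choose_zero_succ, pow_zero, Nat.sub_zero, one_mul, mul_one]
    rw [add_right_comm, ← Finset.sum_add_distrib]
    congr 1
    refine Finset.sum_congr rfl fun k hk => ?_
    have hk := Finset.mem_range.1 hk
    rw [show M + 1 - (k+1) = M - k by omega, show (k+1).choose 2 = k + k.choose 2 by
      rw [Nat.choose_succ_succ' k 1, Nat.choose_one_right]]
    have e4 : q^M = q^(M-k) * q^k := by rw [← pow_add]; congr 1; omega
    rw [e4]; ring

/-- theta series -/
def th (a : ℕ → ℂ) (e : ℕ → ℕ) : PowerSeries ℂ :=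
  mk fun d => ∑ n ∈ Finset.range (d+1), if e n = d then a n else 0

lemma coeff_th (a : ℕ → ℂ) (e : ℕ → ℕ) (he : ∀ n, n ≤ e n) (d N : ℕ) (hN : d < N) :
    coeff d (th a e) = coeff d (∑ n ∈ Finset.range N, C (a n) * X ^ (e n)) := by
  rw [th, coeff_mk, map_sum]
  have : ∀ n, coeff d (C (a n) * X ^ (e n)) = if e n = d then a n else 0 := by
    intro n; rw [coeff_C_mul, coeff_X_pow]; simp [eq_comm]
  simp only [this]
  apply Finset.sum_subset
  · intro n; simp; omega
  · intro n hn hn'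
    rw [if_neg]
    have := he n
    simp at hn'
    omega

lemma tendsto_of_dvd (f : ℕ → PowerSeries ℂ) (g : PowerSeries ℂ) (u : ℕ → ℕ) (hu : Tendsto u atTop atTop)
    (h : ∀ᶠ N in atTop, X ^ (u N) ∣ f N - g) : Tendsto f atTop (𝓝 g) := by
  rw [PowerSeries.WithPiTopology.tendsto_iff_coeff_tendsto]
  intro d
  refine tendsto_const_nhds.congr' ?_
  filter_upwards [h, hu.eventually_gt_atTop d] with N hN hd
  have := (X_pow_dvd_iff.1 hN) d hd
  rw [map_sub, sub_eq_zero] at this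
  exact this.symm

lemma tendsto_th (a : ℕ → ℂ) (e : ℕ → ℕ) (he : ∀ n, n ≤ e n) (g : ℕ → ℕ → PowerSeries ℂ)
    (G : PowerSeries ℂ) (hg : ∀ n, Tendsto (fun N => g N n) atTop (𝓝 G)) :
    Tendsto (fun N => ∑ n ∈ Finset.range (N+1), C (a n) * X ^ (e n) * g N n) atTop (𝓝 (th a e * G)) := by
  rw [PowerSeries.WithPiTopology.tendsto_iff_coeff_tendsto]
  intro d
  have h1 : coeff d (th a e * G) = coeff d (∑ n ∈ Finset.range (d+1), C (a n) * X ^ (e n) * G) := by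
    rw [← Finset.sum_mul, coeff_mul, coeff_mul]
    refine Finset.sum_congr rfl fun p hp => ?_
    rw [coeff_th a e he p.1 (d+1)]
    have : p.1 + p.2 = d := by simpa using hp
    omega
  rw [h1]
  have h2 : Tendsto (fun N => ∑ n ∈ Finset.range (d+1), C (a n) * X ^ (e n) * g N n) atTop
      (𝓝 (∑ n ∈ Finset.range (d+1), C (a n) * X ^ (e n) * G)) :=
    tendsto_finsetSum _ fun n _ => (hg n).const_mul _
  rw [PowerSeries.WithPiTopology.tendsto_iff_coeff_tendsto] at h2
  refine (h2 d).congr' ?_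
  filter_upwards [eventually_ge_atTop d] with N hN
  rw [map_sum, map_sum]
  apply Finset.sum_subset
  · intro n; simp; omega
  · intro n hn hn'
    rw [mul_assoc, coeff_C_mul, coeff_X_pow_mul', if_neg, mul_zero]
    have := he n
    simp at hn'
    omega

lemma PP_eq (d N : ℕ) : PP ((X : PowerSeries ℂ)^d) N =
    ∏ k ∈ Finset.range N, (1 - (X : PowerSeries ℂ) ^ (d * (k + 1))) := by
  simp [PP, pow_mul]

lemma PP_dvd (d N : ℕ) (hd : 1 ≤ d) : (X : PowerSeries ℂ)^N ∣ PP ((X : PowerSeries ℂ)^d) N - JC d := by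
  rw [X_pow_dvd_iff]
  intro m hm
  rw [map_sub, coeff_JC d m N hd hm, PP_eq, sub_self]

lemma JC_ne (d : ℕ) (hd : 1 ≤ d) : JC d ≠ 0 := by
  intro h
  have := constCoeff_JC d hd
  rw [h] at this; simp at this

lemma PP_const (d N : ℕ) (hd : 1 ≤ d) : constantCoeff (PP ((X : PowerSeries ℂ)^d) N) = 1 := by
  have : d ≠ 0 := by omega
  simp [PP, this]

lemma tendsto_gb (d : ℕ) (hd : 1 ≤ d) (M k : ℕ → ℕ) (hk : ∀ᶠ N in atTop, k N ≤ M N)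
    (h1 : Tendsto k atTop atTop) (h2 : Tendsto (fun N => M N - k N) atTop atTop) :
    Tendsto (fun N => gb ((X : PowerSeries ℂ)^d) (M N) (k N)) atTop (𝓝 (JC d)⁻¹) := by
  have hM : Tendsto M atTop atTop :=
    tendsto_atTop_mono' _ hk h1
  have hP : Tendsto (fun N => PP ((X : PowerSeries ℂ)^d) N) atTop (𝓝 (JC d)) := by
    simp only [PP_eq]; exact tendsto_JC d hd
  have hJ : constantCoeff (JC d) ≠ 0 := by rw [constCoeff_JC d hd]; exact one_ne_zero
  have hPc : ∀ N, constantCoeff (PP ((X : PowerSeries ℂ)^d) N) ≠ 0 := fun N => by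
    rw [PP_const d N hd]; exact one_ne_zero
  have hI : Tendsto (fun N => (PP ((X : PowerSeries ℂ)^d) N)⁻¹) atTop (𝓝 (JC d)⁻¹) := by
    apply tendsto_of_dvd _ _ id tendsto_id
    refine Eventually.of_forall fun N => ?_
    have e : (PP ((X : PowerSeries ℂ)^d) N)⁻¹ - (JC d)⁻¹ =
        (PP ((X : PowerSeries ℂ)^d) N - JC d) * (-(PP ((X : PowerSeries ℂ)^d) N)⁻¹ * (JC d)⁻¹) := by
      have a1 := PowerSeries.mul_inv_cancel _ hJ
      have a2 := PowerSeries.mul_inv_cancel _ (hPc N)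
      linear_combination (JC d)⁻¹ * a2 - (PP ((X : PowerSeries ℂ)^d) N)⁻¹ * a1
    rw [e]
    exact (PP_dvd d N hd).mul_right _
  have h3 := ((hP.comp hM).mul (hI.comp h1)).mul (hI.comp h2)
  rw [PowerSeries.mul_inv_cancel _ hJ, one_mul] at h3
  refine h3.congr' ?_
  filter_upwards [hk] with N hN
  have := gb_PP ((X : PowerSeries ℂ)^d) (M N) (k N) hN
  have a1 := PowerSeries.mul_inv_cancel _ (hPc (k N))
  have a2 := PowerSeries.mul_inv_cancel _ (hPc (M N - k N))
  simp only [Function.comp]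
  rw [← this]
  linear_combination gb ((X : PowerSeries ℂ)^d) (M N) (k N) * a1 * (PP ((X : PowerSeries ℂ)^d) (M N - k N)) * (PP ((X : PowerSeries ℂ)^d) (M N - k N))⁻¹ + gb ((X : PowerSeries ℂ)^d) (M N) (k N) * a2

lemma gb_symm (d : ℕ) (hd : 1 ≤ d) (M k l : ℕ) (h : k + l = M) :
    gb ((X : PowerSeries ℂ)^d) M k = gb ((X : PowerSeries ℂ)^d) M l := by
  have hPc : ∀ N, PP ((X : PowerSeries ℂ)^d) N ≠ 0 := fun N h => by
    have := PP_const d N hd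
    rw [h] at this; simp at this
  have a1 := gb_PP ((X : PowerSeries ℂ)^d) M k (by omega)
  have a2 := gb_PP ((X : PowerSeries ℂ)^d) M l (by omega)
  rw [show M - k = l by omega] at a1
  rw [show M - l = k by omega] at a2
  apply mul_right_cancel₀ (mul_ne_zero (hPc k) (hPc l))
  linear_combination a1 - a2
end

section
open PowerSeries Filter Topology
open scoped PowerSeries.WithPiTopology

lemma two_ch (n : ℕ) : 2 * n.choose 2 + n = n * n := by
  induction n with
  | zero => rfl
  | succ n ih => rw [Nat.choose_succ_succ' n 1, Nat.choose_one_right]; nlinarith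

lemma prod_X_pow {R : Type*} [CommRing R] (q : R) (N : ℕ) :
    ∏ i ∈ Finset.range N, q ^ i = q ^ (N.choose 2) := by
  induction N with
  | zero => simp
  | succ N ih => rw [Finset.prod_range_succ, ih, ← pow_add, Nat.choose_succ_succ' N 1,
      Nat.choose_one_right, add_comm]

lemma sum_split {R : Type*} [AddCommMonoid R] (t : ℕ → R) (N : ℕ) :
    ∑ k ∈ Finset.range (2*N+1+1), t k = ∑ n ∈ Finset.range (N+1), (t (N-n) + t (N+1+n)) := by
  rw [show 2*N+1+1 = (N+1) + (N+1) by ring, Finset.sum_range_add, Finset.sum_add_distrib]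
  congr 1
  rw [← Finset.sum_range_reflect]
  exact Finset.sum_congr rfl fun k _ => by congr 1

lemma prod_mid {R : Type*} [CommRing R] (q x y : R) (N : ℕ) :
    ∏ i ∈ Finset.range (2*N+1), (x + y * q^i) =
    (x + y * q^N) * ((∏ i ∈ Finset.range N, (x + y * q^(N-1-i))) *
      ∏ i ∈ Finset.range N, (x + y * q^(N+(1+i)))) := by
  rw [show 2*N+1 = N + (1 + N) by ring, Finset.prod_range_add, Finset.prod_range_add,
    ← Finset.prod_range_reflect]
  simp
  ring

lemma gb_map {R S : Type*} [CommRing R] [CommRing S] (f : R →+* S) (q : R) :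
    ∀ M k : ℕ, gb (f q) M k = f (gb q M k) := by
  intro M
  induction M with
  | zero => intro k; cases k <;> simp [gb]
  | succ M ih => intro k; cases k <;> simp [gb, ih]

lemma jac_half1 {R : Type*} [CommRing R] (q y : R) (N : ℕ) :
    ∏ i ∈ Finset.range N, (q^N + y * q^(N-1-i)) =
      q^(N.choose 2) * ∏ i ∈ Finset.range N, (y + q^(i+1)) := by
  rw [← prod_X_pow, ← Finset.prod_range_reflect (fun i => q^i), ← Finset.prod_mul_distrib]
  refine Finset.prod_congr rfl fun i hi => ?_
  have hi := Finset.mem_range.1 hi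
  have : q^N = q^(N-1-i) * q^(i+1) := by rw [← pow_add]; congr 1; omega
  rw [this]; ring

lemma jac_half2 {R : Type*} [CommRing R] (q y : R) (N : ℕ) :
    ∏ i ∈ Finset.range N, (q^N + y * q^(N+(1+i))) =
      q^(N*N) * ∏ i ∈ Finset.range N, (1 + y * q^(i+1)) := by
  have : q^(N*N) = ∏ i ∈ Finset.range N, q^N := by simp [pow_mul]
  rw [this, ← Finset.prod_mul_distrib]
  refine Finset.prod_congr rfl fun i hi => ?_
  rw [pow_add, add_comm 1 i]; ring

lemma half_neg {R : Type*} [CommRing R] (q : R) (N : ℕ) :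
    ∏ i ∈ Finset.range N, (-1 + q^(i+1)) = (-1)^N * PP q N := by
  conv_rhs => rw [show (-1:R)^N = ∏ i ∈ Finset.range N, (-1:R) by simp]
  rw [PP, ← Finset.prod_mul_distrib]
  exact Finset.prod_congr rfl fun i hi => by ring

lemma jac_exp1 (N n : ℕ) (h : n ≤ N) :
    (N-n).choose 2 + N * (2*N+1-(N-n) - 1) = N.choose 2 + N*N + (n+1).choose 2 := by
  obtain ⟨k, rfl⟩ := Nat.exists_eq_add_of_le h
  have h1 := two_ch k
  have h2 := two_ch (n+k)
  have h3 := two_ch (n+1)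
  rw [show n + k - n = k by omega, show 2*(n+k)+1-k-1 = 2 * n + k by omega]
  nlinarith

lemma jac_exp2 (N n : ℕ) (h : n ≤ N) :
    n < N → (N+1+n).choose 2 + N * (2*N+1-(N+1+n) - 1) = N.choose 2 + N*N + (n+1).choose 2 := by
  intro h
  obtain ⟨k, rfl⟩ := Nat.exists_eq_add_of_lt h
  have h1 := two_ch (n+k+1+1+n)
  have h2 := two_ch (n+k+1)
  have h3 := two_ch (n+1)
  rw [show 2*(n+k+1)+1-(n+k+1+1+n)-1 = k by omega]
  nlinarith

lemma jac_fin (N : ℕ) : PP (X : PowerSeries ℂ) N ^ 2 =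
    ∑ n ∈ Finset.range (N+1), C ((-1:ℂ)^n * (2*n+1)) * X ^ ((n+1).choose 2) * gb X (2*N+1) (N-n) := by
  let q : PowerSeries ℂ := X
  have h := qbinom (Polynomial.C q) (Polynomial.X) (-1) (2*N+1)
  rw [prod_mid, sum_split] at h
  have h0 : (-1 : Polynomial (PowerSeries ℂ)) = Polynomial.C (-1) := by simp
  rw [h0] at h
  have h' := congrArg (fun f => Polynomial.eval (q^N) (Polynomial.derivative f)) h
  simp only [← Polynomial.C_pow, ← Polynomial.C_mul] at h'
  rw [Polynomial.derivative_mul, Polynomial.eval_add, Polynomial.eval_mul, Polynomial.eval_mul] at h'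
  simp only [Polynomial.derivative_add, Polynomial.derivative_X, Polynomial.derivative_C, add_zero,
    Polynomial.eval_add, Polynomial.eval_mul, Polynomial.eval_X, neg_one_mul (q^N), add_neg_cancel, zero_mul,
    Polynomial.eval_C, Polynomial.eval_one,
    one_mul, Polynomial.eval_prod, Polynomial.derivative_sum, Polynomial.eval_finsetSum] at h'
  rw [jac_half1, jac_half2, half_neg] at h'
  have hPP : ∏ i ∈ Finset.range N, (1 + -1 * q ^ (i+1)) = PP q N := by
    simp only [neg_one_mul, ← sub_eq_add_neg]; rfl
  rw [hPP] at h'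
  have hq : (-1)^N * q^(N.choose 2) * q^(N*N) ≠ 0 :=
    mul_ne_zero (mul_ne_zero (by simp) (pow_ne_zero _ X_ne_zero)) (pow_ne_zero _ X_ne_zero)
  apply mul_left_cancel₀ hq
  have e0 : (-1)^N * q^(N.choose 2) * q^(N*N) * PP X N ^2 = q^(N.choose 2) * ((-1)^N * PP q N) * (q^(N*N) * PP q N) := by
    ring
  rw [e0, h', Finset.mul_sum]
  refine Finset.sum_congr rfl fun n hn => ?_
  have hn : n ≤ N := by have := Finset.mem_range.1 hn; omega
  have e1 : ∀ k, Polynomial.eval (q^N) (Polynomial.derivative ((Polynomial.C (q ^ k.choose 2) * gb (Polynomial.C q) (2 * N + 1) k *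
      Polynomial.X ^ (2*N+1-k) * Polynomial.C ((-1)^k) : Polynomial (PowerSeries ℂ)))) =
      q ^ (k.choose 2) * gb q (2*N+1) k * ((2*N+1-k : ℕ) : PowerSeries ℂ) * q^(N * (2*N+1-k-1)) * (-1)^k := by
    intro k
    rw [gb_map]
    simp only [← Polynomial.C_mul, Polynomial.derivative_mul, Polynomial.derivative_C, Polynomial.derivative_X_pow,
      Polynomial.eval_add, Polynomial.eval_mul, Polynomial.eval_C, Polynomial.eval_pow, Polynomial.eval_X,
      zero_mul, mul_zero, zero_add, add_zero, Polynomial.eval_zero, pow_mul]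
    ring
  rw [e1, e1]
  have hs := gb_symm 1 le_rfl (2*N+1) (N+1+n) (N-n) (by omega)
  rw [pow_one] at hs
  change gb q _ _ = gb q _ _ at hs
  rw [hs]
  have c1 : ((2*N+1-(N-n) : ℕ) : PowerSeries ℂ) = N + n + 1 := by
    rw [show 2*N+1-(N-n) = N+n+1 by omega]; push_cast; ring
  have c2 : ((2*N+1-(N+1+n) : ℕ) : PowerSeries ℂ) = N - n := by
    rw [show 2*N+1-(N+1+n) = N-n by omega, Nat.cast_sub hn]
  have s1 : (-1 : PowerSeries ℂ)^(N-n) = (-1)^N * (-1)^n := by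
    rw [← pow_add, show N + n = (N - n) + 2 * n by omega, pow_add, pow_mul]; simp
  have s2 : (-1 : PowerSeries ℂ)^(N+1+n) = - ((-1)^N * (-1)^n) := by
    ring
  have x1 : q ^ (N-n).choose 2 * q ^ (N * (2*N+1-(N-n)-1)) = q^(N.choose 2) * q^(N*N) * q^((n+1).choose 2) := by
    rw [← pow_add, ← pow_add, ← pow_add, jac_exp1 N n hn]
  have hC : C ((-1:ℂ)^n * (2*n+1)) = ((-1)^n * (2*n+1) : PowerSeries ℂ) := by
    simp [show (C (2:ℂ)) = (2 : PowerSeries ℂ) from map_ofNat C 2]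
  rw [hC, c1, c2, s1, s2]
  change _ = (-1) ^ N * q ^ N.choose 2 * q ^ (N * N) * ((-1) ^ n * (2 * ↑n + 1) * q ^ (n + 1).choose 2 * gb q (2 * N + 1) (N - n))
  rcases Nat.lt_or_ge n N with h | h
  · have x2 : q ^ (N+1+n).choose 2 * q ^ (N * (2*N+1-(N+1+n)-1)) = q^(N.choose 2) * q^(N*N) * q^((n+1).choose 2) := by
      rw [← pow_add, ← pow_add, ← pow_add, jac_exp2 N n hn h]
    linear_combination (gb q (2*N+1) (N-n) * (N+n+1) * (-1)^N * (-1)^n) * x1 - (gb q (2*N+1) (N-n) * (N-n) * (-1)^N * (-1)^n) * x2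
  · obtain rfl : n = N := by omega
    linear_combination (gb q (2*n+1) (n-n) * (n+n+1) * (-1)^n * (-1)^n) * x1

lemma le_ch (n : ℕ) : n ≤ (n+1).choose 2 := by
  have := two_ch (n+1)
  rcases Nat.eq_zero_or_pos n with h | h
  · omega
  · nlinarith

lemma tendsto_gb_mid (n : ℕ) :
    Tendsto (fun N => gb (X : PowerSeries ℂ) (2*N+1) (N-n)) atTop (𝓝 (JC 1)⁻¹) := by
  have := tendsto_gb 1 le_rfl (fun N => 2*N+1) (fun N => N - n) (Eventually.of_forall fun N => by omega)
    (tendsto_sub_atTop_nat n)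
    (tendsto_atTop_mono (fun N => by omega : ∀ N, N ≤ 2*N+1-(N-n)) tendsto_id)
  simpa using this

lemma tendsto_PP (d : ℕ) (hd : 1 ≤ d) :
    Tendsto (fun N => PP ((X : PowerSeries ℂ)^d) N) atTop (𝓝 (JC d)) := by
  simp only [PP_eq]; exact tendsto_JC d hd

lemma JC_inv (d : ℕ) (hd : 1 ≤ d) : JC d * (JC d)⁻¹ = 1 :=
  PowerSeries.mul_inv_cancel _ (by rw [constCoeff_JC d hd]; exact one_ne_zero)

theorem jacobi : JC 1 ^ 3 = th (fun n => (-1)^n * (2*n+1)) (fun n => (n+1).choose 2) := by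
  have h1 := tendsto_th (fun n => (-1)^n * (2*n+1)) (fun n => (n+1).choose 2) le_ch
    (fun N n => gb X (2*N+1) (N-n)) _ tendsto_gb_mid
  have h2 := (tendsto_PP 1 le_rfl).pow 2
  simp only [pow_one] at h2
  have := tendsto_nhds_unique (h2.congr jac_fin) h1
  linear_combination JC 1 * this + th (fun n => (-1)^n * (2*n+1)) (fun n => (n+1).choose 2) * JC_inv 1 le_rfl

lemma psi_fin (N : ℕ) : PP ((X : PowerSeries ℂ)^2) N ^ 2 = PP X N ^ 2 *
    ∑ n ∈ Finset.range (N+1), C 1 * X ^ ((n+1).choose 2) * gb X (2*N+1) (N-n) := by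
  let q : PowerSeries ℂ := X
  have h := qbinom q (q^N) 1 (2*N+1)
  rw [prod_mid, sum_split, jac_half1, jac_half2] at h
  simp only [one_mul, one_pow, mul_one] at h
  have hPP : PP (q^2) N = PP q N * ∏ i ∈ Finset.range N, (1 + q ^ (i+1)) := by
    rw [PP, PP, ← Finset.prod_mul_distrib]
    exact Finset.prod_congr rfl fun i hi => by rw [pow_right_comm]; ring
  change PP (q^2) N ^ 2 = PP q N ^ 2 * ∑ n ∈ Finset.range (N+1), C 1 * q ^ ((n+1).choose 2) * gb q (2*N+1) (N-n)
  have hq2 : (2 : PowerSeries ℂ) ≠ 0 := by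
    rw [← map_ofNat C 2, Ne, map_eq_zero_iff _ C_injective]; norm_num
  have hq : 2 * q^N * q^(N.choose 2) * q^(N*N) ≠ 0 :=
    mul_ne_zero (mul_ne_zero (mul_ne_zero hq2 (pow_ne_zero _ X_ne_zero)) (pow_ne_zero _ X_ne_zero)) (pow_ne_zero _ X_ne_zero)
  apply mul_left_cancel₀ hq
  have e0 : (2 * q^N * q^(N.choose 2) * q^(N*N)) * ∑ n ∈ Finset.range (N+1), C 1 * q ^ ((n+1).choose 2) * gb q (2*N+1) (N-n) =
     (q ^ N + q ^ N) * ((q ^ N.choose 2 * ∏ i ∈ Finset.range N, (1 + q ^ (i + 1))) *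
      (q ^ (N * N) * ∏ i ∈ Finset.range N, (1 + q ^ (i + 1)))) := by
    rw [h, Finset.mul_sum]
    refine Finset.sum_congr rfl fun n hn => ?_
    have hn : n ≤ N := by have := Finset.mem_range.1 hn; omega
    have hs := gb_symm 1 le_rfl (2*N+1) (N+1+n) (N-n) (by omega)
    rw [pow_one] at hs
    change gb q _ _ = gb q _ _ at hs
    rw [hs]
    have x1 : q ^ (N-n).choose 2 * (q^N) ^ ((2*N+1-(N-n))) = q^N * q^(N.choose 2) * q^(N*N) * q^((n+1).choose 2) := by
      rw [← pow_mul, ← pow_add, ← pow_add, ← pow_add, ← pow_add]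
      congr 1
      have := jac_exp1 N n hn
      rw [show 2*N+1-(N-n) = (2*N+1-(N-n)-1) + 1 by omega, mul_add]
      omega
    have x2 : q ^ (N+1+n).choose 2 * (q^N) ^ ((2*N+1-(N+1+n))) = q^N * q^(N.choose 2) * q^(N*N) * q^((n+1).choose 2) := by
      rw [← pow_mul, ← pow_add, ← pow_add, ← pow_add, ← pow_add]
      congr 1
      rcases Nat.lt_or_ge n N with h | h
      · have := jac_exp2 N n hn h
        rw [show 2*N+1-(N+1+n) = (2*N+1-(N+1+n)-1) + 1 by omega, mul_add]
        omega
      · obtain rfl : n = N := by omega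
        have h1 := two_ch (n+1+n)
        have h2 := two_ch n
        have h3 := two_ch (n+1)
        rw [show 2*n+1-(n+1+n) = 0 by omega]
        nlinarith
    rw [map_one]
    linear_combination -gb q (2*N+1) (N-n) * (x1 + x2)
  rw [hPP]
  linear_combination -PP q N ^ 2 * e0

theorem gauss_psi : JC 2 ^ 2 = JC 1 * th (fun _ => 1) (fun n => (n+1).choose 2) := by
  have h1 := tendsto_th (fun n => 1) (fun n => (n+1).choose 2) le_ch
    (fun N n => gb X (2*N+1) (N-n)) _ tendsto_gb_mid
  have h2 := (tendsto_PP 2 (by norm_num)).pow 2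
  have h3 := (tendsto_PP 1 (by norm_num)).pow 2
  simp only [pow_one] at h3
  have := tendsto_nhds_unique (h2.congr psi_fin) (h3.mul h1)
  rw [this]
  linear_combination JC 1 * th (fun _ => 1) (fun n => (n+1).choose 2) * JC_inv 1 le_rfl

/-- coefficients of `φ(-q)` -/
def phia (n : ℕ) : ℂ := if n = 0 then 1 else 2 * (-1)^n

set_option maxHeartbeats 1000000 in
lemma phi_fin (N : ℕ) : PP (X : PowerSeries ℂ) (2*(N+1)) ^ 2 = PP (X^2) (N+1) ^ 2 *
    ∑ n ∈ Finset.range (N+1+1), C (phia n) * X ^ (n^2) * gb (X^2) (2*(N+1)) (N+1-n) := by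
  obtain ⟨q, hqX⟩ : ∃ q : PowerSeries ℂ, q = X := ⟨_, rfl⟩
  rw [← hqX]
  have hq0 : q ≠ 0 := by rw [hqX]; exact X_ne_zero
  obtain ⟨O, hOd⟩ : ∃ O, O = ∏ i ∈ Finset.range (N+1), (1 - q^(2*i+1)) := ⟨_, rfl⟩
  have hO : ∀ M, PP q (2*M) = (∏ i ∈ Finset.range M, (1 - q^(2*i+1))) * PP (q^2) M := by
    intro M
    induction M with
    | zero => simp [PP]
    | succ M ih =>
      rw [show 2*(M+1) = 2*M+1+1 by ring]
      simp only [PP, Finset.prod_range_succ] at ih ⊢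
      rw [ih, ← pow_mul]; ring_nf
  have h := qbinom (q^2) (q^(2*N+1)) (-1) (2*(N+1))
  have hl : ∏ i ∈ Finset.range (2*(N+1)), (q^(2*N+1) + -1 * (q^2)^i) =
      (-1)^(N+1) * q^(2*(N+1).choose 2) * q^((2*N+1)*(N+1)) * O^2 := by
    rw [show 2*(N+1) = (N+1)+(N+1) by ring, Finset.prod_range_add, ← Finset.prod_range_reflect]
    have a1 : ∏ j ∈ Finset.range (N+1), (q^(2*N+1) + -1 * (q^2)^(N+1-1-j)) = (-1)^(N+1) * q^(2*(N+1).choose 2) * O := by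
      rw [hOd, pow_mul, ← prod_X_pow, ← Finset.prod_range_reflect (fun i => (q^2)^i),
        show (-1:PowerSeries ℂ)^(N+1) = ∏ i ∈ Finset.range (N+1), (-1:PowerSeries ℂ) by simp,
        ← Finset.prod_mul_distrib, ← Finset.prod_mul_distrib]
      refine Finset.prod_congr rfl fun i hi => ?_
      have hi := Finset.mem_range.1 hi
      have : q^(2*N+1) = (q^2)^(N+1-1-i) * q^(2*i+1) := by rw [← pow_mul, ← pow_add]; congr 1; omega
      rw [this]; ring
    have a2 : ∏ j ∈ Finset.range (N+1), (q^(2*N+1) + -1 * (q^2)^(N+1+j)) = q^((2*N+1)*(N+1)) * O := by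
      rw [hOd, pow_mul, show (q^(2*N+1))^(N+1) = ∏ i ∈ Finset.range (N+1), (q^(2*N+1)) by simp,
        ← Finset.prod_mul_distrib]
      refine Finset.prod_congr rfl fun i hi => ?_
      have : (q^2)^(N+1+i) = q^(2*N+1) * q^(2*i+1) := by rw [← pow_mul, ← pow_add]; congr 1; omega
      rw [this]; ring
    rw [a1, a2]; ring
  rw [hl] at h
  have hq : (-1)^(N+1) * q^(2*(N+1).choose 2) * q^((2*N+1)*(N+1)) ≠ 0 :=
    mul_ne_zero (mul_ne_zero (by simp) (pow_ne_zero _ hq0)) (pow_ne_zero _ hq0)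
  have key : O^2 = ∑ n ∈ Finset.range (N+1+1), C (phia n) * q ^ (n^2) * gb (q^2) (2*(N+1)) (N+1-n) := by
    apply mul_left_cancel₀ hq
    have hsp : ∀ t : ℕ → PowerSeries ℂ, ∑ k ∈ Finset.range (2*(N+1)+1), t k =
        ∑ n ∈ Finset.range (N+1), (t (N+1-(n+1)) + t (N+1+(1+n))) + t (N+1) := by
      intro t
      rw [show 2*(N+1)+1 = (N+1) + (1 + (N+1)) by ring, Finset.sum_range_add t (N+1) (1+(N+1)), Finset.sum_range_add (fun x => t (N+1+x)) 1 (N+1),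
        ← Finset.sum_range_reflect t (N+1), Finset.sum_range_one, Finset.sum_add_distrib]
      have : ∀ n, N + 1 - 1 - n = N+1-(n+1) := by intro n; omega
      simp only [this, add_zero]
      ring
    rw [h, hsp, Finset.sum_range_succ' _ (N+1), mul_add ((-1)^(N+1) * q^(2*(N+1).choose 2) * q^((2*N+1)*(N+1))), Finset.mul_sum]
    have ex : ∀ n k l, k + l = 2*(N+1) → (k = N+1+n ∨ l = N+1+n) → (q^2)^(k.choose 2) * (q^(2*N+1))^l * (-1)^k =
        (-1)^(N+1) * q^(2*(N+1).choose 2) * q^((2*N+1)*(N+1)) * (q^(n^2) * (-1)^n) := by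
      intro n k l hkl hor
      have p1 : (-1 : PowerSeries ℂ)^k = (-1)^(N+1) * (-1)^n := by
        rw [← pow_add]
        rcases hor with rfl | rfl
        · rfl
        · rw [show N+1+n = k + 2 * n by omega, pow_add, pow_mul]; simp
      rw [p1, ← pow_mul, ← pow_mul]
      have p2 : 2 * k.choose 2 + (2*N+1)*l = 2*(N+1).choose 2 + (2*N+1)*(N+1) + n^2 := by
        have h1 := two_ch k
        have h2 := two_ch (N+1)
        rcases hor with rfl | rfl
        · have e1 : N + 1 = l + n := by omega
          zify at *
          have e2 : (N:ℤ) = l + n - 1 := by linarith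
          rw [e2] at h1 h2 ⊢
          push_cast at h1 h2 ⊢
          nlinarith
        · have : N + 1 = k + n := by omega
          rw [this] at h2 ⊢
          have : N = k + n - 1 := by omega
          zify at *
          rw [Nat.cast_sub (by omega)] at this
          push_cast at this
          rw [this]
          nlinarith
      have : q^(2 * k.choose 2) * q^((2*N+1)*l) = q^(2*(N+1).choose 2) * q^((2*N+1)*(N+1)) * q^(n^2) := by
        rw [← pow_add, p2, pow_add, pow_add]
      linear_combination (-1)^(N+1) * (-1)^n * this
    refine congrArg₂ (· + ·) ?_ ?_
    · refine Finset.sum_congr rfl fun n hn => ?_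
      have hn := Finset.mem_range.1 hn
      have hs := gb_symm 2 (by norm_num) (2*(N+1)) (N+1+(1+n)) (N+1-(n+1)) (by omega)
      rw [← hqX] at hs
      have x1 := ex (n+1) (N+1-(n+1)) (N+1+(1+n)) (by omega) (Or.inr (by omega))
      have x2 := ex (n+1) (N+1+(1+n)) (N+1-(n+1)) (by omega) (Or.inl (by omega))
      rw [show 2*(N+1) - (N+1-(n+1)) = N+1+(1+n) by omega,
        show 2*(N+1) - (N+1+(1+n)) = N+1-(n+1) by omega, hs]
      have hC : C (phia (n+1)) = (2 * (-1)^(n+1) : PowerSeries ℂ) := by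
        simp [phia, show (C (2:ℂ)) = (2 : PowerSeries ℂ) from map_ofNat C 2]
      rw [hC]
      linear_combination gb (q^2) (2*(N+1)) (N+1-(n+1)) * (x1 + x2)
    · have x1 := ex 0 (N+1) (N+1) (by omega) (Or.inl (by omega))
      simp only [Nat.sub_zero, phia, if_true, map_one, one_mul, show 2*(N+1) - (N+1) = N+1 by omega]
      linear_combination gb (q^2) (2*(N+1)) (N+1) * x1
  change PP q (2*(N+1)) ^ 2 = PP (q^2) (N+1) ^ 2 *
    ∑ n ∈ Finset.range (N+1+1), C (phia n) * q ^ (n^2) * gb (q^2) (2*(N+1)) (N+1-n)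
  rw [← key, hO, ← hOd]; ring

theorem gauss_phi : JC 1 ^ 2 = JC 2 * th phia (fun n => n^2) := by
  have hg : ∀ n, Tendsto (fun N => gb ((X : PowerSeries ℂ)^2) (2*N) (N-n)) atTop (𝓝 (JC 2)⁻¹) := by
    intro n
    exact tendsto_gb 2 (by norm_num) (fun N => 2*N) (fun N => N - n) (Eventually.of_forall fun N => by omega)
      (tendsto_sub_atTop_nat n)
      (tendsto_atTop_mono (fun N => by omega : ∀ N, N ≤ 2*N-(N-n)) tendsto_id)
  have h1 := tendsto_th phia (fun n => n^2) (fun n => by nlinarith [sq_nonneg n, Nat.le_self_pow (n := 2) (by norm_num) n])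
    (fun N n => gb (X^2) (2*N) (N-n)) _ hg
  have t2 : Tendsto (fun N : ℕ => 2 * N) atTop atTop := tendsto_id.const_mul_atTop' (by norm_num)
  have h2 := ((tendsto_PP 1 (by norm_num)).comp t2).pow 2
  have h3 := (tendsto_PP 2 (by norm_num)).pow 2
  have h4 := h3.mul h1
  simp only [pow_one] at h2
  have h2' := h2.comp (tendsto_add_atTop_nat 1)
  have h4' := h4.comp (tendsto_add_atTop_nat 1)
  have := tendsto_nhds_unique (h2'.congr phi_fin) h4'
  rw [this]
  linear_combination JC 2 * th phia (fun n => n^2) * JC_inv 2 (by norm_num)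
end

section
open PowerSeries Filter Topology
open scoped PowerSeries.WithPiTopology

lemma coeff_th_eq (a : ℕ → ℂ) (e : ℕ → ℕ) (he : ∀ n, n ≤ e n) (hi : Function.Injective e) (n : ℕ) :
    coeff (e n) (th a e) = a n := by
  rw [th, coeff_mk, Finset.sum_eq_single n]
  · simp
  · intro b _ hb; rw [if_neg]; exact fun h => hb (hi h)
  · intro h; exact absurd (Finset.mem_range.2 (Nat.lt_succ_of_le (he n))) h

lemma coeff_th_zero (a : ℕ → ℂ) (e : ℕ → ℕ) (d : ℕ) (h : ∀ n, e n ≠ d) :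
    coeff d (th a e) = 0 := by
  rw [th, coeff_mk]; exact Finset.sum_eq_zero fun n _ => by rw [if_neg (h n)]

def phm : PowerSeries ℂ := th phia (fun n => n^2)
def php : PowerSeries ℂ := rescale (-1) phm
def psi : PowerSeries ℂ := th (fun _ => 1) (fun n => (n+1).choose 2)

lemma tri_inj : Function.Injective (fun n : ℕ => (n+1).choose 2) := by
  apply StrictMono.injective
  apply strictMono_nat_of_lt_succ
  intro n
  have := Nat.choose_succ_succ (n+1) 1
  simp only [Nat.choose_one_right] at this
  show _ < (n+1+1).choose (1+1)
  rw [this]; show _ < n + 1 + (n+1).choose 2; omega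
lemma sq_inj : Function.Injective (fun n : ℕ => n^2) := fun a b h => by
  have : a^2 = b^2 := h
  nlinarith [Nat.pow_left_injective (n := 2) (by norm_num) h]
lemma sq_ge (n : ℕ) : n ≤ n^2 := by nlinarith
lemma coeff_phm_sq (n : ℕ) : coeff (n^2) phm = phia n := coeff_th_eq phia _ sq_ge sq_inj n
lemma coeff_phm_zero (d : ℕ) (h : ∀ n, n^2 ≠ d) : coeff d phm = 0 := coeff_th_zero _ _ _ h
lemma coeff_psi_tri (n : ℕ) : coeff ((n+1).choose 2) psi = 1 := coeff_th_eq _ _ le_ch tri_inj n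
lemma coeff_psi_zero (d : ℕ) (h : ∀ n, (n+1).choose 2 ≠ d) : coeff d psi = 0 := coeff_th_zero _ _ _ h

lemma coeff_php (d : ℕ) : coeff d php = (-1)^d * coeff d phm := by
  rw [php, coeff_rescale]

lemma phia_even (k : ℕ) : phia (2*k) = (-1)^k * phia k := by
  by_cases h : k = 0
  · simp [h]
  · have h' : 2*k ≠ 0 := by omega
    simp only [phia, if_neg h, if_neg h', pow_mul]
    rcases neg_one_pow_eq_or ℂ k with h | h <;> rw [h] <;> norm_num

lemma phi_add : php + phm = 2 * expand 4 (by norm_num) php := by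
  ext d
  rw [map_add, coeff_php, show (2 : PowerSeries ℂ) = C 2 from (map_ofNat C 2).symm, coeff_C_mul,
    coeff_expand]
  by_cases hd : ∃ m, m^2 = d
  · obtain ⟨m, rfl⟩ := hd
    rcases Nat.even_or_odd' m with ⟨k, rfl | rfl⟩
    · have h4 : 4 ∣ (2*k)^2 := ⟨k^2, by ring⟩
      rw [if_pos h4, show (2*k)^2/4 = k^2 by rw [show (2*k)^2 = k^2*4 by ring]; simp, coeff_php,
        coeff_phm_sq, coeff_phm_sq, phia_even]
      have e1 : (-1:ℂ)^((2*k)^2) = 1 := by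
        rw [show (2*k)^2 = 2*(2*k^2) by ring, pow_mul]; simp
      have e2 : (-1:ℂ)^(k^2) = (-1)^k := by
        rw [sq, pow_mul]; rcases neg_one_pow_eq_or ℂ k with h | h <;> rw [h] <;> simp [h]
      rw [e1, e2]; ring
    · have h4 : ¬ 4 ∣ (2*k+1)^2 := by
        rintro ⟨c, hc⟩; ring_nf at hc; omega
      rw [if_neg h4]
      have e1 : (-1:ℂ)^((2*k+1)^2) = -1 := Odd.neg_one_pow ⟨2*k^2+2*k, by ring⟩
      rw [e1]; ring
  · push Not at hd
    rw [coeff_phm_zero d hd]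
    split_ifs with h
    · obtain ⟨c, rfl⟩ := h
      rw [Nat.mul_div_cancel_left _ (by norm_num), coeff_php, coeff_phm_zero]
      · simp
      · intro n hn; exact hd (2*n) (by rw [← hn]; ring)
    · simp

lemma two_tri (k : ℕ) : 2 * (k+1).choose 2 = k*(k+1) := by
  have := two_ch (k+1); nlinarith

lemma phi_sub : php - phm = 4 * X * expand 8 (by norm_num) psi := by
  ext d
  rw [map_sub, coeff_php, show (4 : PowerSeries ℂ) = C 4 from (map_ofNat C 4).symm, mul_assoc, coeff_C_mul]
  cases d with
  | zero => simp
  | succ d =>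
  rw [coeff_succ_X_mul, coeff_expand]
  by_cases hd : ∃ m, m^2 = d + 1
  · obtain ⟨m, hm⟩ := hd
    rw [← hm, coeff_phm_sq]
    rcases Nat.even_or_odd' m with ⟨k, rfl | rfl⟩
    · have h4 : ¬ 8 ∣ d := by
        rintro ⟨c, hc⟩; ring_nf at hm; omega
      rw [if_neg h4]
      have e1 : (-1:ℂ)^((2*k)^2) = 1 := by
        rw [show (2*k)^2 = 2*(2*k^2) by ring, pow_mul]; simp
      rw [e1]; ring
    · have := two_tri k
      have hd : d = 8 * (k+1).choose 2 := by nlinarith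
      rw [if_pos ⟨_, hd⟩, hd, Nat.mul_div_cancel_left _ (by norm_num), coeff_psi_tri]
      have e1 : (-1:ℂ)^((2*k+1)^2) = -1 := Odd.neg_one_pow ⟨2*k^2+2*k, by ring⟩
      have e2 : phia (2*k+1) = -2 := by
        simp [phia, pow_succ, pow_mul]
      rw [e1, e2]; ring
  · push Not at hd
    rw [coeff_phm_zero _ hd]
    split_ifs with h
    · obtain ⟨c, rfl⟩ := h
      rw [Nat.mul_div_cancel_left _ (by norm_num), coeff_psi_zero]
      · simp
      · intro n hn; exact hd (2*n+1) (by have := two_tri n; rw [← hn]; nlinarith)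
    · simp

lemma rescale_neg_expand (f : PowerSeries ℂ) : rescale (-1) (expand 2 (by norm_num) f) = expand 2 (by norm_num) f := by
  ext d
  rw [coeff_rescale, coeff_expand]
  split_ifs with h
  · obtain ⟨c, rfl⟩ := h; rw [pow_mul]; simp
  · simp
lemma rescale_neg_JC (b : ℕ) (hb : 1 ≤ b) : rescale (-1) (JC (2*b)) = JC (2*b) := by
  rw [← expand_JC 2 b (by norm_num) hb, rescale_neg_expand]

lemma hphm : JC 1 ^ 2 = JC 2 * phm := gauss_phi
lemma hpsi : JC 2 ^ 2 = JC 1 * psi := gauss_psi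
lemma hphp : php * JC 1 ^ 2 * JC 4 ^ 2 = JC 2 ^ 5 := by
  apply mul_left_cancel₀ (JC_ne 2 (by norm_num))
  have h := congrArg (rescale (-1)) hphm
  rw [map_pow, map_mul, rescale_neg_JC 1 le_rfl] at h
  change _ = JC 2 * php at h
  linear_combination (-JC 1^2*JC 4^2) * h + (rescale (-1) (JC 1) * JC 1 * JC 4 + JC 2 ^ 3) * neg_JC

lemma exp_exp (a b : ℕ) (ha : a ≠ 0) (hb : b ≠ 0) (f : PowerSeries ℂ) :
    expand a ha (expand b hb f) = expand (a*b) (mul_ne_zero ha hb) f := by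
  rw [PowerSeries.expand_mul]

lemma EE0 : php^2 + phm^2 = 2 * (expand 2 (by norm_num) php)^2 := by
  let E := php^2 + phm^2 - 2 * (expand 2 (by norm_num) php)^2
  have h1 : php * phm = (expand 2 (by norm_num) phm)^2 := by
    have e := congrArg (expand 2 (by norm_num)) hphm
    rw [map_pow, map_mul, expand_JC 2 1 (by norm_num) (by norm_num), expand_JC 2 2 (by norm_num) (by norm_num)] at e
    norm_num at e
    apply mul_left_cancel₀ (mul_ne_zero (mul_ne_zero (pow_ne_zero 2 (JC_ne 1 (by norm_num))) (pow_ne_zero 2 (JC_ne 4 (by norm_num)))) (JC_ne 2 (by norm_num)))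
    linear_combination JC 2 * phm * hphp - JC 2^5 * hphm + JC 1^2*JC 2 * (JC 2^2 + JC 4 * expand 2 (by norm_num) phm) * e
  have h2 : E = -2 * expand 2 (by norm_num) E := by
    have e := phi_add
    have ee := exp_exp 2 2 (by norm_num) (by norm_num) php
    norm_num at ee
    simp only [E, map_sub, map_add, map_mul, map_pow, map_ofNat]
    rw [ee]
    linear_combination (php + phm + 2 * expand 4 (by norm_num) php) * e - 2 * h1
  have h3 : ∀ d, coeff d E = 0 := by
    intro d
    induction d using Nat.strong_induction_on with
    | _ d ih =>
    have := congrArg (coeff d) h2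
    rw [show (-2 : PowerSeries ℂ) = C (-2) by rw [map_neg, map_ofNat], coeff_C_mul, coeff_expand] at this
    split_ifs at this with h
    · rcases Nat.eq_zero_or_pos d with rfl | hd
      · simp only [Nat.zero_div] at this
        linear_combination this / 3
      · rw [ih (d/2) (by omega)] at this; simpa using this
    · simpa using this
  have : E = 0 := by ext d; simpa using h3 d
  exact sub_eq_zero.1 this

theorem P2 : JC 2 ^ 24 = JC 1 ^ 16 * JC 4 ^ 8 + 16 * X * JC 4 ^ 16 * JC 1 ^ 8 := by
  have a1 := EE0
  have a2 := phi_add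
  have a3 := phi_sub
  -- psi^2 = php * psi(q^2)
  have e2 := congrArg (expand 2 (by norm_num)) hpsi
  rw [map_pow, map_mul, expand_JC 2 1 (by norm_num) (by norm_num), expand_JC 2 2 (by norm_num) (by norm_num)] at e2
  norm_num at e2
  have hp : psi^2 = php * expand 2 (by norm_num) psi := by
    apply mul_left_cancel₀ (mul_ne_zero (mul_ne_zero (pow_ne_zero 2 (JC_ne 1 (by norm_num))) (pow_ne_zero 2 (JC_ne 4 (by norm_num)))) (JC_ne 2 (by norm_num)))
    linear_combination (-JC 4^2*JC 2) * (JC 2^2 + JC 1 * psi) * hpsi - JC 2 * expand 2 (by norm_num) psi * hphp + JC 2^5 * e2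
  have hp2 := congrArg (expand 2 (by norm_num)) hp
  have hp4 := congrArg (expand 4 (by norm_num)) hp
  rw [map_pow, map_mul, exp_exp] at hp2 hp4
  norm_num at hp2 hp4
  set P4 := expand 4 (by norm_num) psi
  set P2 := expand 2 (by norm_num) psi
  set p2 := expand 2 (by norm_num) php
  have b1 : php^4 - phm^4 = 16 * X * P2^4 := by
    linear_combination (2*p2^2) * (php - phm) * a2 + 4 * p2^2 * expand 4 (by norm_num) php * a3 + (php^2-phm^2) * a1 - 16 * X * p2^2 * hp4 - 16*X*(P2^2 + p2*P4) * hp2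
  have c1 : php^4 * (JC 1 ^ 8 * JC 4 ^ 8) = JC 2^20 := by
    have := congrArg (·^4) hphp
    linear_combination this
  have c2 : phm^4 * JC 2^4 = JC 1^8 := by
    have := congrArg (·^4) hphm
    linear_combination -this
  have c3 : P2^4 * JC 2^4 = JC 4^8 := by
    have := congrArg (·^4) e2
    linear_combination -this
  linear_combination (-JC 2^4)*c1 + JC 1^8*JC 4^8*c2 + 16*X*JC 1^8*JC 4^8*c3 + JC 2^4*JC 1^8*JC 4^8 * b1
end

section
open PowerSeries Filter Topology
open scoped PowerSeries.WithPiTopology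

lemma JC_pent : JC 1 = pentagonalSeries ℂ := by
  ext d
  have h := coeff_prod_one_sub_X_pow_eventually_eq ℂ d
  have h2 := Filter.tendsto_finset_range.eventually h
  obtain ⟨N, hN, hN2⟩ := (h2.and (eventually_ge_atTop (d+1))).exists
  rw [coeff_JC 1 d N le_rfl hN2, ← hN]
  simp

def sg (m : ℤ) : ℂ := ((Int.negOnePow m : ℤˣ) : ℤ)
lemma sg_add (m n : ℤ) : sg (m+n) = sg m * sg n := by simp [sg, Int.negOnePow_add]
lemma sg_even (k : ℤ) : sg (2*k) = 1 := by simp [sg, Int.negOnePow_even]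
lemma sg_odd (k : ℤ) : sg (2*k+1) = -1 := by rw [sg_add, sg_even]; simp [sg]

lemma abs_le_pent (m : ℤ) : |m| ≤ pentagonal m := by
  have := two_mul_natCast_pentagonal m
  rcases abs_cases m with ⟨h, h'⟩ | ⟨h, h'⟩ <;> rw [h]
  · rcases eq_or_lt_of_le h' with h0 | h0
    · rw [← h0] at this ⊢; simp
    · nlinarith
  · nlinarith

lemma JC_trunc (a N : ℕ) (ha : 1 ≤ a) : X^(N+1) ∣ JC a - ∑ m ∈ Finset.Icc (-N:ℤ) N, C (sg m) * X^(a * pentagonal m) := by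
  rw [X_pow_dvd_iff]
  intro d hd
  rw [map_sub, map_sum, sub_eq_zero]
  have e : ∀ m, coeff d (C (sg m) * X^(a * pentagonal m)) = if a * pentagonal m = d then sg m else 0 := by
    intro m; rw [coeff_C_mul, coeff_X_pow]; simp [eq_comm]
  simp only [e]
  have := expand_JC a 1 (by omega) le_rfl
  rw [mul_one] at this
  rw [← this, coeff_expand, JC_pent]
  split_ifs with h
  · obtain ⟨c, rfl⟩ := h
    rw [Nat.mul_div_cancel_left _ ha]
    by_cases hc : c ∈ Set.range pentagonal
    · obtain ⟨k, rfl⟩ := hc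
      rw [Finset.sum_eq_single k]
      · simp [sg]
      · intro b _ hb
        rw [if_neg]; intro h
        exact hb (pentagonal_injective (Nat.eq_of_mul_eq_mul_left ha h))
      · intro hk
        exfalso; apply hk
        have := abs_le_pent k
        have h3 : pentagonal k ≤ a * pentagonal k := Nat.le_mul_of_pos_left _ ha
        rw [Finset.mem_Icc, ← abs_le]; omega
    · rw [coeff_pentagonalSeries_eq_zero _ hc, Finset.sum_eq_zero]
      intro m _; rw [if_neg]; intro h
      exact hc ⟨m, Nat.eq_of_mul_eq_mul_left ha h⟩
  · rw [Finset.sum_eq_zero]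
    intro m _; rw [if_neg]; intro h'
    exact h ⟨_, h'.symm⟩

def bx (a b N d : ℕ) : Finset (ℤ × ℤ) := (Finset.Icc (-N:ℤ) N ×ˢ Finset.Icc (-N:ℤ) N).filter
  (fun x => a * pentagonal x.1 + b * pentagonal x.2 = d)

lemma mem_bx (a b N d : ℕ) (ha : 1 ≤ a) (hb : 1 ≤ b) (hd : d ≤ N) (x : ℤ × ℤ) :
    x ∈ bx a b N d ↔ a * pentagonal x.1 + b * pentagonal x.2 = d := by
  rw [bx, Finset.mem_filter, and_iff_right_iff_imp]
  intro h
  have h1 := abs_le_pent x.1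
  have h2 := abs_le_pent x.2
  have h3 : pentagonal x.1 ≤ a * pentagonal x.1 := Nat.le_mul_of_pos_left _ ha
  have h4 : pentagonal x.2 ≤ b * pentagonal x.2 := Nat.le_mul_of_pos_left _ hb
  rw [Finset.mem_product, Finset.mem_Icc, Finset.mem_Icc, ← abs_le, ← abs_le]
  omega

lemma coeff_JJ (a b N d : ℕ) (ha : 1 ≤ a) (hb : 1 ≤ b) (hd : d ≤ N) :
    coeff d (JC a * JC b) = ∑ x ∈ bx a b N d, sg (x.1 + x.2) := by
  obtain ⟨A, hA⟩ := JC_trunc a N ha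
  obtain ⟨B, hB⟩ := JC_trunc b N hb
  set S := ∑ m ∈ Finset.Icc (-N:ℤ) N, C (sg m) * X^(a * pentagonal m)
  set T := ∑ m ∈ Finset.Icc (-N:ℤ) N, C (sg m) * X^(b * pentagonal m)
  have h1 : JC a * JC b = S * T + X^(N+1) * (A * JC b + S * B) := by
    linear_combination JC b * hA + S * hB
  rw [h1, map_add, (X_pow_dvd_iff.1 (Dvd.intro _ rfl)) d (by omega), add_zero, Finset.sum_mul_sum,
    ← Finset.sum_product', map_sum, bx, Finset.sum_filter]
  refine Finset.sum_congr rfl fun x _ => ?_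
  rw [show C (sg x.1) * X^(a * pentagonal x.1) * (C (sg x.2) * X^(b * pentagonal x.2)) =
    C (sg (x.1+x.2)) * X^(a * pentagonal x.1 + b * pentagonal x.2) by
      rw [sg_add, map_mul, pow_add]; ring, coeff_C_mul, coeff_X_pow]
  simp [eq_comm]

lemma zm8 (m : ℤ) : (m : ZMod 8) = 0 ↔ 8 ∣ m := ZMod.intCast_zmod_eq_zero_iff_dvd m 8

lemma z1 (m n : ℤ) (h : 8 ∣ 3*m^2-m+21*n^2-7*n-6) : 8 ∣ 21*n-m-2 ∨ 8 ∣ -m-21*n+5 := by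
  have := (by decide : ∀ m n : ZMod 8, 3*m^2-m+21*n^2-7*n-6 = 0 → 21*n-m-2 = 0 ∨ -m-21*n+5 = 0) m n
  simp only [← zm8] at h ⊢
  push_cast at h ⊢
  exact this h
lemma z2 (m n : ℤ) (h : 8 ∣ 3*m^2-m+21*n^2-7*n-2) : 8 ∣ 1-m+3*n ∨ 8 ∣ 2-m-3*n := by
  have := (by decide : ∀ m n : ZMod 8, 3*m^2-m+21*n^2-7*n-2 = 0 → 1-m+3*n = 0 ∨ 2-m-3*n = 0) m n
  simp only [← zm8] at h ⊢
  push_cast at h ⊢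
  exact this h

lemma pent_eq (a b d : ℕ) (m n : ℤ) : a * pentagonal m + b * pentagonal n = d ↔
    a * (3*m^2-m) + b*(3*n^2-n) = 2 * (d:ℤ) := by
  have h1 := two_mul_natCast_pentagonal m
  have h2 := two_mul_natCast_pentagonal n
  zify
  constructor
  · intro h; linear_combination 2 * h - a * h1 - b * h2
  · intro h; refine mul_left_cancel₀ (two_ne_zero : (2:ℤ) ≠ 0) ?_; linear_combination h + a * h1 + b * h2

lemma coeff3 (e : ℕ) : coeff (4*e+3) (JC 1 * JC 7) = 0 := by
  rw [coeff_JJ 1 7 _ _ (by norm_num) (by norm_num) le_rfl]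
  have mem := mem_bx 1 7 _ (4*e+3) (by norm_num) (by norm_num) le_rfl
  refine Finset.sum_involution (fun x _ => if 8 ∣ 21*x.2-x.1-2 then ((21*x.2-x.1-2)/8, (2-3*x.1-x.2)/8)
    else ((-x.1-21*x.2+5)/8, (3*x.1-x.2+1)/8)) ?_ ?_ ?_ ?_
  all_goals
    rintro ⟨m, n⟩ hx
    rw [mem, pent_eq] at hx
    push_cast at hx
    have hz := z1 m n ⟨e, by linear_combination hx⟩
    dsimp only
  all_goals
    by_cases h : 8 ∣ 21*n-m-2
    · obtain ⟨k, hk⟩ := h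
      obtain rfl : m = 21*n-2-8*k := by linear_combination -hk
      simp only [if_pos (show (8:ℤ) ∣ 21*n-(21*n-2-8*k)-2 from ⟨k, by ring⟩)]
      simp only [show 21*n-(21*n-2-8*k)-2 = 8 * k by ring, show 2-3*(21*n-2-8*k)-n = 8*(1-8*n+3*k) by ring,
        Int.mul_ediv_cancel_left _ (by norm_num : (8:ℤ) ≠ 0)]
      first
      | rw [mem, pent_eq]; push_cast; linear_combination hx
      | rw [show 21*n-2-8*k+n = 2*(11*n-1-4*k) by ring, show k+(1-8*n+3*k) = 2*(2*k-4*n)+1 by ring, sg_even, sg_odd]; ring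
      | (intro _ h3
         rw [Prod.mk.injEq] at h3
         omega)
      | (rw [if_neg (by omega)]
         rw [Prod.mk.injEq]
         omega)
    · obtain ⟨k, hk⟩ := hz.resolve_left h
      obtain rfl : m = -21*n+5-8*k := by linear_combination -hk
      simp only [if_neg h]
      simp only [show -(-21*n+5-8*k)-21*n+5 = 8 * k by ring, show 3*(-21*n+5-8*k)-n+1 = 8*(2-8*n-3*k) by ring,
        Int.mul_ediv_cancel_left _ (by norm_num : (8:ℤ) ≠ 0)]
      first
      | rw [mem, pent_eq]; push_cast; linear_combination hx
      | rw [show -21*n+5-8*k+n = 2*(-10*n+2-4*k)+1 by ring, show k+(2-8*n-3*k) = 2*(1-4*n-k) by ring, sg_even, sg_odd]; ring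
      | (intro _ h3
         rw [Prod.mk.injEq] at h3
         omega)
      | (rw [if_pos (by omega)]
         rw [Prod.mk.injEq]
         omega)

lemma coeff1 (e : ℕ) : coeff (4*e+1) (JC 1 * JC 7) = - coeff (4*e) (JC 4 * JC 28) := by
  rw [coeff_JJ 1 7 _ _ (by norm_num) (by norm_num) le_rfl, coeff_JJ 4 28 _ _ (by norm_num) (by norm_num) le_rfl,
    ← Finset.sum_neg_distrib]
  have mem := mem_bx 1 7 _ (4*e+1) (by norm_num) (by norm_num) le_rfl
  have mem' := mem_bx 4 28 _ (4*e) (by norm_num) (by norm_num) le_rfl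
  refine Finset.sum_nbij' (fun x => if 8 ∣ 1-x.1+3*x.2 then (3*((1-x.1+3*x.2)/8)-2*x.2, (1-x.1+3*x.2)/8)
    else (1-2*x.2-3*((2-x.1-3*x.2)/8), (2-x.1-3*x.2)/8))
    (fun x => if 2 ∣ x.1 - x.2 then (1-5*x.2-3*((x.1-x.2)/2), x.2-(x.1-x.2)/2) else
      (2-2*x.2+3*((x.1-x.2-1)/2), -2*x.2-(x.1-x.2-1)/2)) ?_ ?_ ?_ ?_ ?_
  · rintro ⟨m, n⟩ hx
    rw [mem, pent_eq] at hx
    push_cast at hx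
    have hz := z2 m n ⟨e, by linear_combination hx⟩
    dsimp only
    split_ifs with h
    · obtain ⟨k, hk⟩ := h
      obtain rfl : m = 1+3*n-8*k := by linear_combination -hk
      simp only [hk, Int.mul_ediv_cancel_left _ (by norm_num : (8:ℤ) ≠ 0)]
      rw [mem', pent_eq]; push_cast; linear_combination hx
    · obtain ⟨k, hk⟩ := hz.resolve_left h
      obtain rfl : m = 2-3*n-8*k := by linear_combination -hk
      simp only [hk, Int.mul_ediv_cancel_left _ (by norm_num : (8:ℤ) ≠ 0)]
      rw [mem', pent_eq]; push_cast; linear_combination hx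
  · rintro ⟨m, n⟩ hx
    rw [mem', pent_eq] at hx
    push_cast at hx
    dsimp only
    split_ifs with h
    · obtain ⟨k, hk⟩ := h
      obtain rfl : m = n + 2*k := by linear_combination hk
      simp only [hk, Int.mul_ediv_cancel_left _ (by norm_num : (2:ℤ) ≠ 0)]
      rw [mem, pent_eq]; push_cast; linear_combination hx
    · obtain ⟨k, hk⟩ : ∃ k, m - n - 1 = 2 * k := ⟨(m-n-1)/2, by omega⟩
      obtain rfl : m = n + 2*k+1 := by linear_combination hk
      simp only [hk, Int.mul_ediv_cancel_left _ (by norm_num : (2:ℤ) ≠ 0)]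
      rw [mem, pent_eq]; push_cast; linear_combination hx
  · rintro ⟨m, n⟩ hx
    rw [mem, pent_eq] at hx
    push_cast at hx
    have hz := z2 m n ⟨e, by linear_combination hx⟩
    dsimp only
    by_cases h : 8 ∣ 1-m+3*n
    · simp only [if_pos h]; rw [if_pos (by omega), Prod.mk.injEq]; omega
    · simp only [if_neg h]; rw [if_neg (by omega), Prod.mk.injEq]; omega
  · rintro ⟨m, n⟩ hx
    dsimp only
    by_cases h : 2 ∣ m - n
    · simp only [if_pos h]; rw [if_pos (by omega), Prod.mk.injEq]; omega
    · simp only [if_neg h]; rw [if_neg (by omega), Prod.mk.injEq]; omega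
  · rintro ⟨m, n⟩ hx
    rw [mem, pent_eq] at hx
    push_cast at hx
    have hz := z2 m n ⟨e, by linear_combination hx⟩
    dsimp only
    split_ifs with h
    · obtain ⟨k, hk⟩ := h
      obtain rfl : m = 1+3*n-8*k := by linear_combination -hk
      simp only [hk, Int.mul_ediv_cancel_left _ (by norm_num : (8:ℤ) ≠ 0)]
      rw [show 1+3*n-8*k+n = 2*(2*n-4*k)+1 by ring, show 3*k-2*n+k = 2*(2*k-n) by ring, sg_even, sg_odd]
    · obtain ⟨k, hk⟩ := hz.resolve_left h
      obtain rfl : m = 2-3*n-8*k := by linear_combination -hk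
      simp only [hk, Int.mul_ediv_cancel_left _ (by norm_num : (8:ℤ) ≠ 0)]
      rw [show 2-3*n-8*k+n = 2*(1-n-4*k) by ring, show 1-2*n-3*k+k = 2*(-n-k)+1 by ring, sg_even, sg_odd]; ring

lemma odd_part : JC 1 * JC 7 - rescale (-1) (JC 1 * JC 7) = -2 * X * (JC 4 * JC 28) := by
  have h4 : JC 4 * JC 28 = expand 4 (by norm_num) (JC 1 * JC 7) := by
    rw [map_mul, expand_JC 4 1 _ le_rfl, expand_JC 4 7 _ (by norm_num)]
  ext d
  rw [map_sub, coeff_rescale, show (-2 : PowerSeries ℂ) = C (-2) by rw [map_neg, map_ofNat], mul_assoc,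
    coeff_C_mul]
  cases d with
  | zero => simp
  | succ d =>
  rw [coeff_succ_X_mul]
  by_cases h : 4 ∣ d
  · obtain ⟨e, rfl⟩ := h
    rw [coeff1, pow_succ, show 4*e = 2*(2*e) by ring, pow_mul]; norm_num; ring
  · rw [h4, coeff_expand, if_neg h]
    by_cases h2 : 2 ∣ d + 1
    · obtain ⟨c, hc⟩ := h2
      rw [hc, pow_mul]; simp
    · obtain ⟨c, rfl⟩ : ∃ c, d = 4*c+2 := ⟨d/4, by omega⟩
      rw [show 4*c+2+1 = 4*c+3 by ring, coeff3]; simp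

theorem P3 : (JC 2 * JC 14)^3 = (JC 1 * JC 7)^2 * (JC 4 * JC 28) + 2 * X * (JC 4 * JC 28)^2 * (JC 1 * JC 7) := by
  have h1 := neg_JC
  have h7 : rescale (-1) (JC 7) * JC 7 * JC 28 = JC 14^3 := by
    have := congrArg (expand 7 (by norm_num)) neg_JC
    have e : expand 7 (by norm_num) (rescale (-1) (JC 1)) = rescale (-1) (JC 7) := by
      have e7 : JC 7 = expand 7 (by norm_num) (JC 1) := (expand_JC 7 1 (by norm_num) le_rfl).symm
      rw [e7]
      ext d
      simp only [coeff_expand, coeff_rescale]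
      split_ifs with h
      · obtain ⟨c, rfl⟩ := h
        rw [Nat.mul_div_cancel_left _ (by norm_num), pow_mul]; norm_num
      · simp
    rwa [map_mul, map_mul, map_pow, e, expand_JC 7 1 _ le_rfl, expand_JC 7 4 _ (by norm_num), expand_JC 7 2 _ (by norm_num)] at this
  have h := odd_part
  rw [map_mul] at h
  rw [mul_pow, ← h1, ← h7]
  linear_combination (-(JC 1 * JC 7 * JC 4 * JC 28)) * h
end

section
open PowerSeries Filter Topology
open scoped PowerSeries.WithPiTopology

def LL : Type := FractionRing (PowerSeries ℂ)
instance : Field LL := inferInstanceAs (Field (FractionRing (PowerSeries ℂ)))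
instance : Algebra (PowerSeries ℂ) LL := inferInstanceAs (Algebra (PowerSeries ℂ) (FractionRing (PowerSeries ℂ)))
instance : IsFractionRing (PowerSeries ℂ) LL :=
  inferInstanceAs (IsFractionRing (PowerSeries ℂ) (FractionRing (PowerSeries ℂ)))
def ii : PowerSeries ℂ →+* LL := algebraMap _ _
lemma ii_inj : Function.Injective ii := IsFractionRing.injective _ _
lemma ii_ne {f : PowerSeries ℂ} (h : f ≠ 0) : ii f ≠ 0 := fun h' => h (ii_inj (by rw [h', map_zero]))
def cc : ℂ →+* LL := ii.comp C
instance : Algebra ℂ LL := cc.toAlgebra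
lemma algC (z : ℂ) : algebraMap ℂ LL z = ii (C z) := rfl
lemma ii_rep (x : LL) : ∃ f g : PowerSeries ℂ, g ≠ 0 ∧ x = ii f / ii g := by
  obtain ⟨f, g, hg, h⟩ := IsFractionRing.div_surjective (A := PowerSeries ℂ) x
  exact ⟨f, g, nonZeroDivisors.ne_zero hg, h.symm⟩

/-- extend an injective endomorphism of power series to the fraction field -/
def ext1 (j : PowerSeries ℂ →+* PowerSeries ℂ) (hj : Function.Injective j) : LL →+* LL :=
  IsFractionRing.lift (A := PowerSeries ℂ) (g := ii.comp j) (ii_inj.comp hj)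
lemma ext1_ii (j : PowerSeries ℂ →+* PowerSeries ℂ) (hj : Function.Injective j) (f : PowerSeries ℂ) :
    ext1 j hj (ii f) = ii (j f) :=
  IsFractionRing.lift_algebraMap (A := PowerSeries ℂ) (g := ii.comp j) (ii_inj.comp hj) f

lemma expand_inj (n : ℕ) (hn : n ≠ 0) : Function.Injective (expand n hn : PowerSeries ℂ →ₐ[ℂ] PowerSeries ℂ) := by
  intro f g h
  ext d
  have := congrArg (coeff (n*d)) h
  simpa [coeff_expand, Nat.mul_div_cancel_left _ (Nat.pos_of_ne_zero hn)] using this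
lemma rescale_inj (z : ℂ) (hz : z ≠ 0) : Function.Injective (rescale z) := by
  intro f g h
  ext d
  have := congrArg (coeff d) h
  rw [coeff_rescale, coeff_rescale] at this
  exact mul_left_cancel₀ (pow_ne_zero _ hz) this

def VV : LL →+* LL := ext1 (expand 7 (by norm_num) : PowerSeries ℂ →ₐ[ℂ] PowerSeries ℂ).toRingHom (expand_inj 7 _)
def V2 : LL →+* LL := ext1 (expand 2 (by norm_num) : PowerSeries ℂ →ₐ[ℂ] PowerSeries ℂ).toRingHom (expand_inj 2 _)
lemma VV_ii (f : PowerSeries ℂ) : VV (ii f) = ii (expand 7 (by norm_num) f) := ext1_ii _ _ _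
lemma V2_ii (f : PowerSeries ℂ) : V2 (ii f) = ii (expand 2 (by norm_num) f) := ext1_ii _ _ _

def ze : ℂ := Complex.exp (2 * Real.pi * Complex.I / 7)
lemma ze_prim : IsPrimitiveRoot ze 7 := by
  have := Complex.isPrimitiveRoot_exp 7 (by norm_num)
  simpa [ze] using this
lemma ze_ne : ze ≠ 0 := ze_prim.ne_zero (by norm_num)
def sgm (j : ℕ) : LL →+* LL := ext1 (rescale (ze^j)) (rescale_inj _ (pow_ne_zero _ ze_ne))
lemma sgm_ii (j : ℕ) (f : PowerSeries ℂ) : sgm j (ii f) = ii (rescale (ze^j) f) := ext1_ii _ _ _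
lemma VV_cc (z : ℂ) : VV (cc z) = cc z := by
  rw [cc, RingHom.comp_apply, VV_ii]; congr 1
  exact AlgHom.commutes _ z
lemma V2_cc (z : ℂ) : V2 (cc z) = cc z := by
  rw [cc, RingHom.comp_apply, V2_ii]; congr 1
  exact AlgHom.commutes _ z
lemma sgm_cc (j : ℕ) (z : ℂ) : sgm j (cc z) = cc z := by
  rw [cc, RingHom.comp_apply, sgm_ii]; congr 1
  ext d; rw [coeff_rescale, coeff_C]; split_ifs with h <;> simp [h]
lemma sgm_expand (j : ℕ) (f : PowerSeries ℂ) : rescale (ze^j) (expand 7 (by norm_num) f) = expand 7 (by norm_num) f := by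
  ext d
  rw [coeff_rescale, coeff_expand]
  split_ifs with h
  · obtain ⟨c, rfl⟩ := h
    rw [← pow_mul, show j*(7*c) = 7*(j*c) by ring, pow_mul, ze_prim.pow_eq_one]; simp
  · simp
lemma sgm_VV (j : ℕ) (x : LL) : sgm j (VV x) = VV x := by
  obtain ⟨f, g, hg, rfl⟩ := ii_rep x
  simp only [map_div₀, VV_ii, sgm_ii, sgm_expand]
lemma sgm_zero (x : LL) : sgm 0 x = x := by
  obtain ⟨f, g, hg, rfl⟩ := ii_rep x
  simp only [map_div₀, sgm_ii, pow_zero, rescale_one, RingHom.id_apply]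

instance : CharZero LL := charZero_of_injective_algebraMap (algebraMap ℂ LL).injective

def UU (f : PowerSeries ℂ) : PowerSeries ℂ := mk fun n => coeff (7*n) f
lemma sum_sgm (f : PowerSeries ℂ) : ∑ j ∈ Finset.range 7, sgm j (ii f) = 7 * VV (ii (UU f)) := by
  simp only [sgm_ii, VV_ii]
  rw [← map_sum, show (7 : LL) = ii (C 7) by rw [map_ofNat C 7, map_ofNat ii 7], ← map_mul]
  congr 1
  ext d
  rw [map_sum, coeff_C_mul, coeff_expand]
  simp only [coeff_rescale]
  rw [← Finset.sum_mul]
  have hs : ∑ j ∈ Finset.range 7, (ze^j)^d = ∑ j ∈ Finset.range 7, (ze^d)^j :=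
    Finset.sum_congr rfl fun j _ => by rw [← pow_mul, ← pow_mul, mul_comm]
  rw [hs]
  split_ifs with h
  · obtain ⟨c, rfl⟩ := h
    rw [pow_mul, ze_prim.pow_eq_one, UU, coeff_mk, Nat.mul_div_cancel_left _ (by norm_num)]; simp
  · have h1 : ze^d ≠ 1 := fun h' => h ((ze_prim.pow_eq_one_iff_dvd d).1 h')
    have h2 := geom_sum_mul (ze^d) 7
    rw [← pow_mul, mul_comm d 7, pow_mul, ze_prim.pow_eq_one, one_pow, sub_self] at h2
    rw [(mul_eq_zero.1 h2).resolve_right (sub_ne_zero.2 h1)]; simp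

def q : LL := ii X
def j (b : ℕ) : LL := ii (JC b)
lemma q_ne : q ≠ 0 := ii_ne X_ne_zero
lemma j_ne (b : ℕ) (hb : 1 ≤ b) : j b ≠ 0 := ii_ne (JC_ne b hb)
lemma VV_q : VV q = q^7 := by rw [q, VV_ii, expand_X, map_pow]
lemma V2_q : V2 q = q^2 := by rw [q, V2_ii, expand_X, map_pow]
lemma VV_j (b : ℕ) (hb : 1 ≤ b) : VV (j b) = j (7*b) := by rw [j, VV_ii, expand_JC 7 b _ hb]; rfl
lemma V2_j (b : ℕ) (hb : 1 ≤ b) : V2 (j b) = j (2*b) := by rw [j, V2_ii, expand_JC 2 b _ hb]; rfl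
lemma P2L : j 2 ^ 24 = j 1 ^ 16 * j 4 ^ 8 + 16 * q * j 4 ^ 16 * j 1 ^ 8 := by
  have := congrArg ii P2
  simp only [map_add, map_mul, map_pow, map_ofNat ii 16] at this
  exact this
lemma P3L : (j 2 * j 14)^3 = (j 1 * j 7)^2 * (j 4 * j 28) + 2 * q * (j 4 * j 28)^2 * (j 1 * j 7) := by
  have := congrArg ii P3
  simp only [map_add, map_mul, map_pow, map_ofNat ii 2] at this
  exact this
end

section
open PowerSeries Filter Topology
open scoped PowerSeries.WithPiTopology

def HG (r : ZMod 7) (f : PowerSeries ℂ) : Prop := ∀ d : ℕ, (d : ZMod 7) ≠ r → coeff d f = 0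
lemma HG.mul {r s : ZMod 7} {f g : PowerSeries ℂ} (hf : HG r f) (hg : HG s g) : HG (r+s) (f*g) := by
  intro d hd
  rw [coeff_mul]
  refine Finset.sum_eq_zero fun x hx => ?_
  rw [Finset.HasAntidiagonal.mem_antidiagonal] at hx
  by_cases h1 : (x.1 : ZMod 7) = r
  · have : (x.2 : ZMod 7) ≠ s := by
      rintro h2; apply hd; rw [← hx, Nat.cast_add, h1, h2]
    rw [hg _ this, mul_zero]
  · rw [hf _ h1, zero_mul]
lemma HG.cast {r s : ZMod 7} {f : PowerSeries ℂ} (hf : HG r f) (h : r = s) : HG s f := h ▸ hf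
def rs (r : ZMod 7) (f : PowerSeries ℂ) : PowerSeries ℂ := mk fun d => if (d : ZMod 7) = r then coeff d f else 0
lemma HG_rs (r : ZMod 7) (f : PowerSeries ℂ) : HG r (rs r f) := by
  intro d hd; rw [rs, coeff_mk, if_neg hd]
def w0 := rs 0 (JC 1)
def w1 := rs 1 (JC 1)
def w5 := rs 5 (JC 1)
def we : PowerSeries ℂ := - X^2 * JC 49

lemma HG_JC49 : HG 0 (JC 49) := by
  intro d hd
  rw [show JC 49 = expand 7 (by norm_num) (JC 7) from (expand_JC 7 7 _ (by norm_num)).symm, coeff_expand, if_neg]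
  rintro ⟨c, rfl⟩
  apply hd; push_cast; rw [show (7 : ZMod 7) = 0 from rfl]; simp
lemma HG_X (n : ℕ) : HG n (X^n) := by
  intro d hd; rw [coeff_X_pow, if_neg]; rintro rfl; exact hd rfl
lemma HG_we : HG 2 we := by
  intro d hd
  have := ((HG_X 2).mul HG_JC49).cast (s := 2) (by decide)
  rw [we, neg_mul, map_neg, this d hd, neg_zero]

lemma pent_cast (k : ℤ) : (pentagonal k : ZMod 7) = 4 * ((k:ZMod 7) * (3 * k - 1)) := by
  have := congrArg (Int.cast : ℤ → ZMod 7) (two_mul_natCast_pentagonal k)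
  push_cast at this
  rw [← this, ← mul_assoc, show (4*2 : ZMod 7) = 1 from rfl, one_mul]

lemma J_split : JC 1 = w0 + w1 + w5 + we := by
  ext d
  simp only [map_add, w0, w1, w5, rs, coeff_mk]
  by_cases h2 : (d : ZMod 7) = 2
  · rw [h2, if_neg (by decide), if_neg (by decide), if_neg (by decide)]
    simp only [zero_add, we, neg_mul, map_neg]
    have hcoef : ∀ c, coeff (c+2) (X^2 * JC 49) = coeff c (JC 49) := fun c => coeff_X_pow_mul _ _ _
    have h49 : JC 49 = expand 49 (by norm_num) (JC 1) := (expand_JC 49 1 _ (by norm_num)).symm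
    have hd2 : 2 ≤ d := by
      by_contra h
      have : d = 0 ∨ d = 1 := by omega
      rcases this with rfl | rfl <;> revert h2 <;> decide
    obtain ⟨c, rfl⟩ := Nat.exists_eq_add_of_le' hd2
    rw [hcoef, h49, coeff_expand, JC_pent]
    by_cases hp : ∃ k, pentagonal k = c + 2
    · obtain ⟨k, hk⟩ := hp
      have hk2 : 4 * ((k:ZMod 7) * (3 * k - 1)) = 2 := by rw [← pent_cast, hk, h2]
      have hk3 : (k:ZMod 7) = 6 := by
        have := (by decide : ∀ k : ZMod 7, 4 * (k * (3 * k - 1)) = 2 → k = 6)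
        exact this _ hk2
      have : ((k+1 : ℤ) : ZMod 7) = 0 := by push_cast; rw [hk3]; rfl
      rw [ZMod.intCast_zmod_eq_zero_iff_dvd] at this
      obtain ⟨l, hl⟩ := this
      obtain rfl : k = 7*l - 1 := by push_cast at hl; linarith
      have h3 := two_mul_natCast_pentagonal (7*l-1)
      have h4 := two_mul_natCast_pentagonal l
      have hc : c = 49 * pentagonal l := by
        zify
        have : (pentagonal (7*l-1) : ℤ) = c + 2 := by exact_mod_cast hk
        rw [this] at h3
        linarith
      rw [← hk, coeff_pentagonalSeries_pentagonal, if_pos ⟨_, hc⟩, hc, Nat.mul_div_cancel_left _ (by norm_num),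
        coeff_pentagonalSeries_pentagonal]
      have s1 : ∀ m, (((Int.negOnePow m : ℤˣ) : ℤ) : ℂ) = sg m := fun m => rfl
      rw [s1, s1]
      have e1 : sg (7*l-1) = - sg l := by
        rw [show 7*l-1 = l + (2*(3*l-1)+1) by ring, sg_add, sg_odd]; ring
      exact e1
    · rw [coeff_pentagonalSeries_eq_zero _ hp]
      split_ifs with h
      · obtain ⟨e, rfl⟩ := h
        rw [Nat.mul_div_cancel_left _ (by norm_num)]
        rw [coeff_pentagonalSeries_eq_zero]; · simp
        rintro ⟨l, rfl⟩
        apply hp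
        refine ⟨7*l-1, ?_⟩
        have h3 := two_mul_natCast_pentagonal (7*l-1)
        have h4 := two_mul_natCast_pentagonal l
        zify
        linarith
      · simp
  · rw [HG_we d h2]
    by_cases hp : ∃ k, pentagonal k = d
    · obtain ⟨k, hk⟩ := hp
      have hk2 : 4 * ((k:ZMod 7) * (3 * k - 1)) = d := by rw [← pent_cast, hk]
      have : (d:ZMod 7) = 0 ∨ (d:ZMod 7) = 1 ∨ (d:ZMod 7) = 5 ∨ (d:ZMod 7) = 2 := by
        have := (by decide : ∀ k d : ZMod 7, 4 * (k * (3 * k - 1)) = d → d = 0 ∨ d = 1 ∨ d = 5 ∨ d = 2)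
        exact this _ _ hk2
      rcases this with h | h | h | h
      · rw [h, if_pos rfl, if_neg (by decide), if_neg (by decide)]; simp
      · rw [h, if_pos rfl, if_neg (by decide), if_neg (by decide)]; simp
      · rw [h, if_pos rfl, if_neg (by decide), if_neg (by decide)]; simp
      · exact absurd h h2
    · have : coeff d (JC 1) = 0 := by rw [JC_pent, coeff_pentagonalSeries_eq_zero _ hp]
      rw [this]; simp

lemma tri_cast (n : ℕ) : (((n+1).choose 2 : ℕ) : ZMod 7) = 4 * ((n:ZMod 7) * (n+1)) := by
  have := congrArg (Nat.cast : ℕ → ZMod 7) (two_tri n)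
  push_cast at this
  rw [← this, ← mul_assoc, show (4*2 : ZMod 7) = 1 from rfl, one_mul]

lemma J3_zero (d : ℕ) (h : (d : ZMod 7) = 2) : coeff d (JC 1 ^ 3) = 0 := by
  rw [jacobi]
  apply coeff_th_zero
  intro n hn
  have h1 := tri_cast n
  rw [hn, h] at h1
  revert h1
  generalize (n : ZMod 7) = k
  revert k; decide

lemma J3_six (d : ℕ) (h : (d : ZMod 7) = 6) : coeff d (JC 1 ^ 3) = coeff d (-7 * X^6 * JC 49^3) := by
  have h49 : JC 49 = expand 49 (by norm_num) (JC 1) := (expand_JC 49 1 _ (by norm_num)).symm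
  have hd6 : 6 ≤ d := by
    by_contra hh
    have : d = 0 ∨ d = 1 ∨ d = 2 ∨ d = 3 ∨ d = 4 ∨ d = 5 := by omega
    rcases this with rfl | rfl | rfl | rfl | rfl | rfl <;> revert h <;> decide
  obtain ⟨c, rfl⟩ := Nat.exists_eq_add_of_le' hd6
  rw [h49, ← map_pow, jacobi, show (-7 : PowerSeries ℂ) = C (-7) by rw [map_neg, map_ofNat], mul_assoc,
    coeff_C_mul, coeff_X_pow_mul, coeff_expand]
  by_cases hp : ∃ n, (n+1).choose 2 = c + 6
  · obtain ⟨n, hn⟩ := hp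
    have h1 := tri_cast n
    rw [hn, h] at h1
    have hn3 : (n : ZMod 7) = 3 := by
      have := (by decide : ∀ k : ZMod 7, 6 = 4 * (k * (k + 1)) → k = 3)
      exact this _ h1
    have hn4 : n % 7 = 3 := by
      have : ((n:ℕ) : ZMod 7) = ((3:ℕ) : ZMod 7) := hn3
      rw [ZMod.natCast_eq_natCast_iff'] at this
      exact this
    obtain ⟨k, rfl⟩ : ∃ k, n = 7*k+3 := ⟨n/7, by omega⟩
    have t1 := two_tri (7*k+3)
    have t2 := two_tri k
    have hc : c = 49 * (k+1).choose 2 := by nlinarith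
    rw [if_pos ⟨_, hc⟩, ← hn, coeff_th_eq _ (fun n => (n+1).choose 2) le_ch tri_inj, hc, Nat.mul_div_cancel_left _ (by norm_num),
      coeff_th_eq _ (fun n => (n+1).choose 2) le_ch tri_inj]
    have : (-1:ℂ)^(7*k+3) = -(-1)^k := by
      rw [show 7*k+3 = k + (2*(3*k+1)+1) by ring, pow_add, pow_succ, pow_mul]; simp
    rw [this]; push_cast; ring
  · push Not at hp
    rw [coeff_th_zero _ _ _ hp]
    split_ifs with h'
    · obtain ⟨e, rfl⟩ := h'
      rw [Nat.mul_div_cancel_left _ (by norm_num), coeff_th_zero]; · simp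
      intro k hk
      apply hp (7*k+3)
      have t1 := two_tri (7*k+3)
      have t2 := two_tri k
      rw [← hk]; nlinarith
    · simp

lemma Z3 {a b c : ZMod 7} {f g h : PowerSeries ℂ} (hf : HG a f) (hg : HG b g) (hh : HG c h) (d : ℕ)
    (hd : (d : ZMod 7) ≠ a + b + c) : coeff d (f*g*h) = 0 := (hf.mul hg).mul hh d hd
lemma J3_exp : JC 1 ^ 3 = C 3 * (w0*w0*we + w0*w1*w1 + w5*we*we) + (C 6*(w0*w1*w5) + we*we*we)
   + (w0*w0*w0 + C 3*(w0*w0*w1) + C 3*(w0*w0*w5) + C 6*(w0*w1*we) + C 3*(w0*w5*w5) + C 6*(w0*w5*we) + C 3*(w0*we*we) + w1*w1*w1 + C 3*(w1*w1*w5)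
   + C 3*(w1*w1*we) + C 3*(w1*w5*w5) + C 6*(w1*w5*we) + C 3*(w1*we*we) + w5*w5*w5 + C 3*(w5*w5*we)) := by
  rw [J_split, map_ofNat, map_ofNat]; ring

lemma coefJ3 (d : ℕ) (hd : (d : ZMod 7) = 2 ∨ (d : ZMod 7) = 6) : coeff d (JC 1 ^ 3) = 3 * coeff d (w0*w0*we + w0*w1*w1 + w5*we*we) +
    (6 * coeff d (w0*w1*w5) + coeff d (we*we*we)) := by
  have h0 : HG 0 w0 := HG_rs _ _
  have h1 : HG 1 w1 := HG_rs _ _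
  have h5 : HG 5 w5 := HG_rs _ _
  have he := HG_we
  rw [J3_exp]
  simp only [map_add, coeff_C_mul]
  have D : ∀ r : ZMod 7, r ≠ 2 → r ≠ 6 → (d : ZMod 7) ≠ r := by
    intro r a b h; rcases hd with hd | hd <;> rw [h] at hd <;> contradiction
  rw [Z3 h0 h0 h0 d (D _ (by decide) (by decide)), Z3 h0 h0 h1 d (D _ (by decide) (by decide)),
    Z3 h0 h0 h5 d (D _ (by decide) (by decide)), Z3 h0 h1 he d (D _ (by decide) (by decide)),
    Z3 h0 h5 h5 d (D _ (by decide) (by decide)), Z3 h0 h5 he d (D _ (by decide) (by decide)),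
    Z3 h0 he he d (D _ (by decide) (by decide)), Z3 h1 h1 h1 d (D _ (by decide) (by decide)),
    Z3 h1 h1 h5 d (D _ (by decide) (by decide)), Z3 h1 h1 he d (D _ (by decide) (by decide)),
    Z3 h1 h5 h5 d (D _ (by decide) (by decide)), Z3 h1 h5 he d (D _ (by decide) (by decide)),
    Z3 h1 he he d (D _ (by decide) (by decide)), Z3 h5 h5 h5 d (D _ (by decide) (by decide)),
    Z3 h5 h5 he d (D _ (by decide) (by decide))]
  ring

lemma R1ps : w0*w0*we + w0*w1*w1 + w5*we*we = 0 := by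
  have h0 : HG 0 w0 := HG_rs _ _
  have h1 : HG 1 w1 := HG_rs _ _
  have h5 : HG 5 w5 := HG_rs _ _
  have he := HG_we
  ext d
  rw [map_zero]
  by_cases hd : (d : ZMod 7) = 2
  · have := coefJ3 d (Or.inl hd)
    rw [J3_zero d hd, Z3 h0 h1 h5 d (by rw [hd]; decide), Z3 he he he d (by rw [hd]; decide)] at this
    linear_combination -this/3
  · rw [map_add, map_add, Z3 h0 h0 he d hd, Z3 h0 h1 h1 d hd, Z3 h5 he he d (by rw [show (5+2+2 : ZMod 7) = 2 from rfl]; exact hd)]; simp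

lemma R4ps : w0*w1*w5 = we^3 := by
  have h0 : HG 0 w0 := HG_rs _ _
  have h1 : HG 1 w1 := HG_rs _ _
  have h5 : HG 5 w5 := HG_rs _ _
  have he := HG_we
  ext d
  rw [show we^3 = we*we*we by ring]
  by_cases hd : (d : ZMod 7) = 6
  · have := coefJ3 d (Or.inr hd)
    rw [J3_six d hd, map_add, map_add, Z3 h0 h0 he d (by rw [hd]; decide), Z3 h0 h1 h1 d (by rw [hd]; decide),
      Z3 h5 he he d (by rw [hd]; decide),
      show -7 * X^6 * JC 49^3 = C 7 * (we*we*we) by rw [map_ofNat, we]; ring, coeff_C_mul] at this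
    linear_combination -this/6
  · rw [Z3 h0 h1 h5 d (by rw [show (0+1+5 : ZMod 7) = 6 from rfl]; exact hd),
      Z3 he he he d (by rw [show (2+2+2 : ZMod 7) = 6 from rfl]; exact hd)]

lemma wat_alg {F : Type*} [Field F] (a b g x T : F) (hg : g = a^2 - a*b^2) (h : a*b*g = -1)
    (hx : x = a+b+g-1) (hT : T = -8-(a^3*b+b^3*g+g^3*a)) :
    T^2 = 7*(x^3+5*x^2+7*x)*T+x^7+7*x^6+21*x^5+49*x^4+147*x^3+343*x^2+343*x := by
  have hG : a^3*b-a^2*b^3+1 = 0 := by rw [hg] at h; linear_combination h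
  subst hx hT hg
  linear_combination ((1)*a^10*b + (-5)*a^9*b^3 + (-7)*a^9 + (10)*a^8*b^5 + (35)*a^8*b^2 + (-21)*a^8
     + (-10)*a^7*b^7 + (-70)*a^7*b^4 + (84)*a^7*b^2 + (-35)*a^7*b + (-62)*a^7 + (5)*a^6*b^9
     + (70)*a^6*b^6 + (-126)*a^6*b^4 + (126)*a^6*b^3 + (191)*a^6*b^2 + (-112)*a^6*b + (-84)*a^6
     + (-1)*a^5*b^11 + (-35)*a^5*b^8 + (84)*a^5*b^6 + (-168)*a^5*b^5 + (-199)*a^5*b^4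
     + (308)*a^5*b^3 + (112)*a^5*b^2 + (-224)*a^5*b + (-56)*a^5 + (7)*a^4*b^10 + (-21)*a^4*b^8
     + (98)*a^4*b^7 + (73)*a^4*b^6 + (-280)*a^4*b^5 + (56)*a^4*b^4 + (434)*a^4*b^3
     + (-84)*a^4*b^2 + (-196)*a^4*b + (28)*a^4 + (-21)*a^3*b^9 + (-3)*a^3*b^8 + (84)*a^3*b^7
     + (-112)*a^3*b^6 + (-217)*a^3*b^5 + (252)*a^3*b^4 + (168)*a^3*b^3 + (-280)*a^3*b^2
     + (-70)*a^3*b + (84)*a^3 + (28)*a^2*b^8 + (7)*a^2*b^7 + (-112)*a^2*b^6 + (35)*a^2*b^5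
     + (238)*a^2*b^4 + (-52)*a^2*b^3 + (-168)*a^2*b^2 + (84)*a^2*b + (70)*a^2 + (-14)*a*b^7
     + (-7)*a*b^6 + (61)*a*b^5 + (-140)*a*b^3 + (-28)*a*b^2 + (84)*a*b + (28)*a + (-1)*b^7
     + (-14)*b^4 + (42)*b^2 + (28)*b + (9)) * hG

def xi : LL := j 1 / (q^2 * j 49)
def tt : LL := j 1 ^ 4 / (q * j 7 ^ 4)
lemma VV_tt : VV tt = j 7 ^ 4 / (q^7 * j 49 ^ 4) := by
  rw [tt, map_div₀, map_mul, map_pow, map_pow, VV_q, VV_j 1 le_rfl, VV_j 7 (by norm_num)]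

lemma rescale_HG (r k : ℕ) (f : PowerSeries ℂ) (hf : HG r f) : rescale (ze^k) f = C ((ze^k)^r) * f := by
  ext d
  rw [coeff_rescale, coeff_C_mul]
  by_cases h : (d : ZMod 7) = r
  · congr 1
    rw [ZMod.natCast_eq_natCast_iff'] at h
    have := ze_prim.pow_eq_one
    rw [← pow_mul, ← pow_mul]
    have e : ∀ d, ze^(k*d) = ze^(k*(d%7)) := by
      intro d
      conv_lhs => rw [← Nat.div_add_mod d 7]
      rw [mul_add, pow_add, show k*(7*(d/7)) = 7*(k*(d/7)) by ring, pow_mul, this, one_pow, one_mul]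
    rw [e d, e r, h]
  · rw [hf d h]; simp
end

section
open Polynomial

lemma prod_roots {F : Type*} [Field F] (P : F[X]) (x : ℕ → F) (hP : P.Monic) (h7 : P.natDegree = 7)
    (hx : Set.InjOn x (Finset.range 7 : Set ℕ)) (hr : ∀ k ∈ Finset.range 7, P.eval (x k) = 0) :
    P = ∏ k ∈ Finset.range 7, (X - C (x k)) := by
  have hQ : (∏ k ∈ Finset.range 7, (X - C (x k))).Monic := monic_prod_of_monic _ _ fun k _ => monic_X_sub_C _
  have hQ7 : (∏ k ∈ Finset.range 7, (X - C (x k))).natDegree = 7 := by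
    rw [natDegree_prod_of_monic _ _ fun k _ => monic_X_sub_C _]; simp
  refine eq_of_degree_sub_lt_of_eval_index_eq (Finset.range 7) hx ?_ ?_
  · rw [Finset.card_range]
    have d1 : P.degree = 7 := by rw [degree_eq_natDegree hP.ne_zero, h7]; rfl
    have d2 : (∏ k ∈ Finset.range 7, (X - C (x k))).degree = 7 := by rw [degree_eq_natDegree hQ.ne_zero, hQ7]; rfl
    have := degree_sub_lt_left (d1.trans d2.symm) hP.ne_zero (by rw [hP.leadingCoeff, hQ.leadingCoeff])
    rw [d1] at this; exact this
  · intro k hk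
    rw [hr k hk, eval_prod, Finset.prod_eq_zero hk]; simp
end

section
open PowerSeries Filter Topology
open scoped PowerSeries.WithPiTopology

/-- `x = c q^n + higher order terms`. -/
def LD (x : LL) (n : ℤ) (c : ℂ) : Prop := ∃ f : PowerSeries ℂ, constantCoeff f = c ∧ x = q^n * ii f
lemma LD.mul {x y : LL} {n m : ℤ} {c d : ℂ} (hx : LD x n c) (hy : LD y m d) : LD (x*y) (n+m) (c*d) := by
  obtain ⟨f, hf, rfl⟩ := hx
  obtain ⟨g, hg, rfl⟩ := hy
  exact ⟨f*g, by rw [map_mul, hf, hg], by rw [zpow_add₀ q_ne, map_mul]; ring⟩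
lemma LD.add {x y : LL} {n : ℤ} {c d : ℂ} (hx : LD x n c) (hy : LD y n d) : LD (x+y) n (c+d) := by
  obtain ⟨f, hf, rfl⟩ := hx
  obtain ⟨g, hg, rfl⟩ := hy
  exact ⟨f+g, by rw [map_add, hf, hg], by rw [map_add]; ring⟩
lemma LD.neg {x : LL} {n : ℤ} {c : ℂ} (hx : LD x n c) : LD (-x) n (-c) := by
  obtain ⟨f, hf, rfl⟩ := hx
  exact ⟨-f, by rw [map_neg, hf], by rw [map_neg]; ring⟩
lemma LD.sub {x y : LL} {n : ℤ} {c d : ℂ} (hx : LD x n c) (hy : LD y n d) : LD (x-y) n (c-d) := by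
  rw [sub_eq_add_neg, sub_eq_add_neg]; exact hx.add hy.neg
lemma LD.ne {x : LL} {n : ℤ} {c : ℂ} (hx : LD x n c) (hc : c ≠ 0) : x ≠ 0 := by
  obtain ⟨f, hf, rfl⟩ := hx
  refine mul_ne_zero (zpow_ne_zero _ q_ne) (ii_ne ?_)
  rintro rfl; exact hc (by rw [← hf, map_zero])
lemma LD.uniq {x : LL} {n : ℤ} {c d : ℂ} (hx : LD x n c) (hy : LD x n d) : c = d := by
  by_contra h
  exact (hx.sub hy).ne (sub_ne_zero.2 h) (sub_self x)
lemma LD.low {x : LL} {n : ℤ} {c : ℂ} (hx : LD x n c) (m : ℤ) (h : m < n) : LD x m 0 := by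
  obtain ⟨f, hf, rfl⟩ := hx
  obtain ⟨k, hk⟩ := Int.eq_ofNat_of_zero_le (sub_nonneg.2 h.le)
  have hk0 : k ≠ 0 := by rintro rfl; simp at hk; omega
  refine ⟨X^k*f, by simp [hk0], ?_⟩
  rw [map_mul, map_pow, show n = m + k by omega, zpow_add₀ q_ne, zpow_natCast, q]; ring
lemma LD.inv {x : LL} {n : ℤ} {c : ℂ} (hx : LD x n c) (hc : c ≠ 0) : LD x⁻¹ (-n) c⁻¹ := by
  obtain ⟨f, hf, rfl⟩ := hx
  have hf0 : constantCoeff f ≠ 0 := by rw [hf]; exact hc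
  refine ⟨f⁻¹, by rw [constantCoeff_inv, hf], ?_⟩
  have h1 : ii f * ii f⁻¹ = 1 := by rw [← map_mul, PowerSeries.mul_inv_cancel _ hf0, map_one]
  rw [mul_inv, zpow_neg, inv_eq_of_mul_eq_one_right h1]
lemma LD.div {x y : LL} {n m : ℤ} {c d : ℂ} (hx : LD x n c) (hy : LD y m d) (hd : d ≠ 0) : LD (x/y) (n-m) (c/d) := by
  rw [div_eq_mul_inv, div_eq_mul_inv, sub_eq_add_neg]; exact hx.mul (hy.inv hd)
lemma LD.pow {x : LL} {n : ℤ} {c : ℂ} (hx : LD x n c) (k : ℕ) : LD (x^k) (n*k) (c^k) := by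
  obtain ⟨f, hf, rfl⟩ := hx
  exact ⟨f^k, by rw [map_pow, hf], by rw [mul_pow, map_pow, zpow_mul, zpow_natCast]⟩
lemma LD.cast {x : LL} {n m : ℤ} {c d : ℂ} (hx : LD x n c) (h : n = m) (h' : c = d) : LD x m d := h' ▸ h ▸ hx
lemma LD_ii (f : PowerSeries ℂ) : LD (ii f) 0 (constantCoeff f) := ⟨f, rfl, by simp⟩
lemma LD_q : LD q 1 1 := ⟨1, by simp, by simp⟩
lemma LD_cc (z : ℂ) : LD (cc z) 0 z := ⟨C z, by simp, by simp [cc]⟩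
lemma LD_nat (k : ℕ) [k.AtLeastTwo] : LD (OfNat.ofNat k) 0 (OfNat.ofNat k) := by
  have := LD_cc (OfNat.ofNat k); rwa [map_ofNat] at this
lemma LD_one : LD 1 0 1 := by have := LD_cc 1; rwa [map_one] at this
lemma LD_j (b : ℕ) (hb : 1 ≤ b) : LD (j b) 0 1 := by
  have := LD_ii (JC b); rwa [constCoeff_JC b hb] at this
lemma sgm_q (k : ℕ) : sgm k q = cc (ze^k) * q := by
  rw [q, sgm_ii, rescale_X, map_mul]; rfl
lemma LD.sg7 {x : LL} {n : ℤ} {c : ℂ} (hx : LD x n c) (k : ℕ) : LD (sgm k x) n ((ze^k)^n * c) := by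
  obtain ⟨f, hf, rfl⟩ := hx
  rw [map_mul, sgm_ii, map_zpow₀, sgm_q, mul_zpow, ← map_zpow₀ cc]
  have h1 : LD (ii (rescale (ze^k) f)) 0 c := by
    have := LD_ii (rescale (ze^k) f)
    rwa [← coeff_zero_eq_constantCoeff_apply, coeff_rescale, pow_zero, one_mul, coeff_zero_eq_constantCoeff_apply, hf] at this
  have h2 : LD (q^n) n 1 := ⟨1, by simp, by simp⟩
  exact (((LD_cc ((ze^k)^n)).mul h2).mul h1).cast (by ring) (by ring)
lemma LD.V7 {x : LL} {n : ℤ} {c : ℂ} (hx : LD x n c) : LD (VV x) (7*n) c := by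
  obtain ⟨f, hf, rfl⟩ := hx
  refine ⟨expand 7 (by norm_num) f, ?_, ?_⟩
  · rw [← hf, ← coeff_zero_eq_constantCoeff_apply, coeff_expand]; simp
  · rw [map_mul, VV_ii, map_zpow₀, VV_q, zpow_mul]; rfl
lemma LD.Vtwo {x : LL} {n : ℤ} {c : ℂ} (hx : LD x n c) : LD (V2 x) (2*n) c := by
  obtain ⟨f, hf, rfl⟩ := hx
  refine ⟨expand 2 (by norm_num) f, ?_, ?_⟩
  · rw [← hf, ← coeff_zero_eq_constantCoeff_apply, coeff_expand]; simp
  · rw [map_mul, V2_ii, map_zpow₀, V2_q, zpow_mul]; rfl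

lemma ze_inj {n : ℤ} (hn : IsCoprime n 7) {k l : ℕ} (hk : k < 7) (hl : l < 7) (h : (ze^k)^n = (ze^l)^n) : k = l := by
  obtain ⟨u, v, huv⟩ := hn
  apply ze_prim.pow_inj hk hl
  have key : ∀ k : ℕ, ze^k = ((ze^k)^n)^u := by
    intro k
    have h7 : (ze^k)^(7:ℤ) = 1 := by
      have := ze_prim.pow_eq_one
      rw [show (7:ℤ) = ((7:ℕ):ℤ) from rfl, zpow_natCast, ← pow_mul, mul_comm, pow_mul, this, one_pow]
    have hne : ze^k ≠ 0 := pow_ne_zero _ ze_ne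
    calc ze^k = (ze^k)^(u*n+v*7) := by rw [huv, zpow_one]
      _ = _ := by rw [zpow_add₀ hne, mul_comm v 7, zpow_mul _ 7 v, h7, one_zpow, mul_one, mul_comm u n, zpow_mul]
  rw [key k, h, ← key l]
lemma sgm_injOn {x : LL} {n : ℤ} {c : ℂ} (hx : LD x n c) (hc : c ≠ 0) (hn : IsCoprime n 7) :
    Set.InjOn (fun k => sgm k x) (Finset.range 7 : Set ℕ) := by
  intro k hk l hl h
  have hk' : k < 7 := by simpa using hk
  have hl' : l < 7 := by simpa using hl
  have h1 := hx.sg7 k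
  rw [show sgm k x = sgm l x from h] at h1
  exact ze_inj hn hk' hl' (mul_right_cancel₀ hc (h1.uniq (hx.sg7 l)))

lemma xi_LD : LD xi (-2) 1 := by
  have := ((LD_j 1 le_rfl).div ((LD_q.pow 2).mul (LD_j 49 (by norm_num))) (by norm_num))
  exact this.cast (by norm_num) (by norm_num)
lemma xi_ne : xi ≠ 0 := xi_LD.ne one_ne_zero
lemma tt_LD : LD tt (-1) 1 := by
  have := (((LD_j 1 le_rfl).pow 4).div (LD_q.mul ((LD_j 7 (by norm_num)).pow 4)) (by norm_num))
  exact this.cast (by norm_num) (by norm_num)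
lemma tt_ne : tt ≠ 0 := tt_LD.ne one_ne_zero
lemma sgm_VVj (k b : ℕ) (hb : 1 ≤ b) : sgm k (j (7*b)) = j (7*b) := by rw [← VV_j b hb, sgm_VV]
lemma prod_xi : ∏ k ∈ Finset.range 7, sgm k xi = (VV tt)^2 := by
  have h := congrArg ii (prod_rescale_JC ze ze_prim)
  rw [map_mul, map_prod, map_pow] at h
  change _ * j 49 = j 7 ^ 8 at h
  have e : ∀ k ∈ Finset.range 7, sgm k xi = ii (rescale (ze^k) (JC 1)) * (cc (ze^(5*k)) * (q^2 * j 49)⁻¹) := by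
    intro k _
    rw [xi, map_div₀, map_mul, map_pow, sgm_q, show (49:ℕ) = 7*7 by norm_num, sgm_VVj k 7 (by norm_num), j, sgm_ii]
    have : cc (ze^(5*k)) * cc (ze^k)^2 = 1 := by
      rw [← map_pow, ← map_mul, ← pow_mul, ← pow_add, show 5*k+k*2 = 7*k by ring, pow_mul, ze_prim.pow_eq_one, one_pow, map_one]
    have hz : cc (ze^k) ≠ 0 := by rw [map_ne_zero]; exact pow_ne_zero _ ze_ne
    have h1 := q_ne
    have h2 := j_ne (7*7) (by norm_num)
    field_simp
    linear_combination (-ii (rescale (ze^k) (JC 1))) * this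
  rw [Finset.prod_congr rfl e, Finset.prod_mul_distrib, Finset.prod_mul_distrib]
  have h3 : ∏ k ∈ Finset.range 7, cc (ze^(5*k)) = 1 := by
    rw [← map_prod, Finset.prod_pow_eq_pow_sum, ← map_one cc]
    congr 1
    rw [show ∑ k ∈ Finset.range 7, 5*k = 7*15 by decide, pow_mul, ze_prim.pow_eq_one, one_pow]
  rw [h3, VV_tt, Finset.prod_const, Finset.card_range]
  have h1 := q_ne
  have h2 := j_ne 49 (by norm_num)
  rw [eq_div_of_mul_eq h2 h]
  field_simp
end

section
open PowerSeries

lemma sgm_HG (r k : ℕ) (f : PowerSeries ℂ) (hf : HG r f) : sgm k (ii f) = cc (ze^k)^r * ii f := by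
  rw [sgm_ii, rescale_HG r k f hf, map_mul, ← map_pow]; rfl
lemma we_LD : LD (ii we) 2 (-1) := by
  have := ((LD_q.pow 2).mul (LD_j 49 (by norm_num))).neg
  have e : ii we = -(q^2 * j 49) := by rw [we, map_mul, map_neg, map_pow, j, q]; ring
  rw [e]; exact this.cast (by norm_num) (by norm_num)
lemma LD_one_of (f : PowerSeries ℂ) (h : coeff 0 f = 0) : LD (ii f) 1 (coeff 1 f) := by
  have : X ∣ f := by rw [X_dvd_iff, ← coeff_zero_eq_constantCoeff_apply]; exact h
  obtain ⟨g, rfl⟩ := this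
  refine ⟨g, ?_, by rw [map_mul, zpow_one, q]⟩
  rw [show (1:ℕ) = 0 + 1 from rfl, coeff_succ_X_mul]; simp
lemma w0_LD : LD (ii w0) 0 1 := by
  have := LD_ii w0
  rwa [show constantCoeff w0 = 1 by
    rw [← coeff_zero_eq_constantCoeff_apply, w0, rs, coeff_mk, if_pos (by simp), coeff_zero_eq_constantCoeff_apply, constCoeff_JC 1 le_rfl]] at this
lemma w1_LD : LD (ii w1) 1 (-1) := by
  have := LD_one_of w1 (by rw [w1, rs, coeff_mk, if_neg (by decide)])
  rwa [show coeff 1 w1 = -1 by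
    rw [w1, rs, coeff_mk, if_pos (by simp), JC_pent]
    have := coeff_pentagonalSeries_pentagonal (R := ℂ) 1
    rw [show pentagonal 1 = 1 from rfl] at this
    rw [this]; simp] at this
lemma w5_LD : LD (ii w5) 1 (coeff 1 w5) := LD_one_of w5 (by rw [w5, rs, coeff_mk, if_neg (by decide)])

def watP (T : LL) : Polynomial LL := Polynomial.X^7 + Polynomial.C 7 * Polynomial.X^6 + Polynomial.C 21 * Polynomial.X^5
  + Polynomial.C 49 * Polynomial.X^4 + Polynomial.C (147+7*T) * Polynomial.X^3 + Polynomial.C (343+35*T) * Polynomial.X^2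
  + Polynomial.C (343+49*T) * Polynomial.X + Polynomial.C (-T^2)
lemma watP_eval (T x : LL) : (watP T).eval x = x^7+7*x^6+21*x^5+49*x^4+(147+7*T)*x^3+(343+35*T)*x^2+(343+49*T)*x-T^2 := by
  simp only [watP, Polynomial.eval_add, Polynomial.eval_mul, Polynomial.eval_pow, Polynomial.eval_X, Polynomial.eval_C]; ring
lemma watP_deg (T : LL) : (watP T).natDegree = 7 := by
  rw [watP]; compute_degree!
lemma watP_monic (T : LL) : (watP T).Monic := by
  rw [watP]; monicity!

lemma watson : watP (VV tt) = ∏ k ∈ Finset.range 7, (Polynomial.X - Polynomial.C (sgm k xi)) := by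
  have h0 : HG (0:ℕ) w0 := by exact_mod_cast HG_rs 0 (JC 1)
  have h1 : HG (1:ℕ) w1 := by exact_mod_cast HG_rs 1 (JC 1)
  have h5 : HG (5:ℕ) w5 := by exact_mod_cast HG_rs 5 (JC 1)
  have he : HG (2:ℕ) we := by exact_mod_cast HG_we
  have hne := we_LD.ne (by norm_num)
  obtain ⟨a, ha⟩ : ∃ a, a = ii w0 := ⟨_, rfl⟩
  obtain ⟨b, hb⟩ : ∃ a, a = ii w1 := ⟨_, rfl⟩
  obtain ⟨c, hc⟩ : ∃ a, a = ii w5 := ⟨_, rfl⟩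
  obtain ⟨e, hE⟩ : ∃ a, a = ii we := ⟨_, rfl⟩
  rw [← hE] at hne
  have r1 := congrArg ii R1ps
  have r4 := congrArg ii R4ps
  have r0 := congrArg ii J_split
  simp only [map_add, map_mul, map_pow, map_zero, ← ha, ← hb, ← hc, ← hE] at r1 r4 r0
  have hxi : xi = (a+b+c+e)/(-e) := by
    rw [← r0, hE, we, map_mul, map_neg, map_pow, xi, q, j, j]; congr 1; ring
  obtain ⟨T, hT⟩ : ∃ T, T = -8-((-a/e)^3*(-b/e)+(-b/e)^3*(-c/e)+(-c/e)^3*(-a/e)) := ⟨_, rfl⟩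
  have W : T^2 = 7*(xi^3+5*xi^2+7*xi)*T+xi^7+7*xi^6+21*xi^5+49*xi^4+147*xi^3+343*xi^2+343*xi := by
    refine wat_alg (-a/e) (-b/e) (-c/e) xi T ?_ ?_ ?_ hT
    · field_simp; linear_combination -r1
    · field_simp; linear_combination -r4
    · rw [hxi]; field_simp; ring
  have sT : ∀ k, sgm k T = T := by
    intro k
    have hz7 : cc (ze^k)^7 = 1 := by
      rw [← map_pow, ← pow_mul, mul_comm, pow_mul, ze_prim.pow_eq_one, one_pow, map_one]
    have hz : cc (ze^k) ≠ 0 := by rw [map_ne_zero]; exact pow_ne_zero _ ze_ne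
    have sa : sgm k a = a := by rw [ha, sgm_HG 0 k w0 h0]; simp
    have sb : sgm k b = cc (ze^k) * b := by rw [hb, sgm_HG 1 k w1 h1]; simp
    have sc : sgm k c = cc (ze^k)^5 * c := by rw [hc, sgm_HG 5 k w5 h5]
    have se : sgm k e = cc (ze^k)^2 * e := by rw [hE, sgm_HG 2 k we he]
    generalize cc (ze^k) = z at *
    rw [hT]
    simp only [map_sub, map_neg, map_add, map_mul, map_pow, map_div₀, sa, sb, sc, se, map_ofNat (sgm k) 8]
    have e1 : (-a / (z^2*e))^3 * (-(z*b)/(z^2*e)) = (-a/e)^3*(-b/e) := by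
      field_simp; linear_combination (-(a^3*b))*hz7
    have e2 : (-(z*b) / (z^2*e))^3 * (-(z^5*c)/(z^2*e)) = (-b/e)^3*(-c/e) := by
      field_simp
    have e3 : (-(z^5*c) / (z^2*e))^3 * (-a/(z^2*e)) = (-c/e)^3*(-a/e) := by
      field_simp; linear_combination (c^3*a)*hz7
    rw [e1, e2, e3]
  have hP : watP T = ∏ k ∈ Finset.range 7, (Polynomial.X - Polynomial.C (sgm k xi)) := by
    refine prod_roots _ (fun k => sgm k xi) (watP_monic T) (watP_deg T) (sgm_injOn xi_LD one_ne_zero (by norm_num)) ?_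
    intro k _
    have := congrArg (sgm k) W
    simp only [map_add, map_mul, map_pow, sT, map_ofNat (sgm k) 7, map_ofNat (sgm k) 5, map_ofNat (sgm k) 21, map_ofNat (sgm k) 49,
      map_ofNat (sgm k) 147, map_ofNat (sgm k) 343] at this
    rw [watP_eval]; linear_combination -this
  have h2 : T^2 = (VV tt)^2 := by
    have := congrArg (Polynomial.eval 0) hP
    rw [watP_eval, Polynomial.eval_prod] at this
    simp only [Polynomial.eval_sub, Polynomial.eval_X, Polynomial.eval_C, zero_sub] at this
    rw [Finset.prod_neg, prod_xi] at this
    simp only [Finset.card_range] at this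
    linear_combination -this
  have TL : LD T (-7) 1 := by
    rw [hT, ha, hb, hc, hE]
    have d1 := (((w0_LD.neg.div we_LD (by norm_num)).pow 3).mul (w1_LD.neg.div we_LD (by norm_num)))
    have d2 := (((w1_LD.neg.div we_LD (by norm_num)).pow 3).mul (w5_LD.neg.div we_LD (by norm_num))).low (-7) (by norm_num)
    have d3 := (((w5_LD.neg.div we_LD (by norm_num)).pow 3).mul (w0_LD.neg.div we_LD (by norm_num))).low (-7) (by norm_num)
    exact ((LD_nat 8).neg.low (-7) (by norm_num)).sub (((d1.cast (m := -7) (by norm_num) rfl).add d2).add d3) |>.cast rfl (by norm_num)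
  have : T = VV tt := by
    rcases sq_eq_sq_iff_eq_or_eq_neg.1 h2 with h | h
    · exact h
    · exfalso
      have h3 := (tt_LD.V7.neg).cast (m := -7) (by norm_num) rfl
      rw [← h] at h3
      have := h3.uniq TL
      norm_num at this
  rw [← this]; exact hP
end

section
open PowerSeries

def aa : LL := q * (j 1 * j 14 / (j 2 * j 7))^4
def bb : LL := (j 1 * j 7 / (j 2 * j 14))^3 / q
def mm : LL := (j 2 * j 14)^3 / ((j 1 * j 7)^2 * (j 4 * j 28))
def rr : LL := j 2 ^ 24 / (j 1 ^ 16 * j 4 ^ 8)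
def rho : LL := j 14 ^ 24 / (j 7 ^ 16 * j 28 ^ 8)

lemma j1 : j 1 ≠ 0 := j_ne _ (by norm_num)
lemma j2 : j 2 ≠ 0 := j_ne _ (by norm_num)
lemma j4 : j 4 ≠ 0 := j_ne _ (by norm_num)
lemma j7 : j 7 ≠ 0 := j_ne _ (by norm_num)
lemma j14 : j 14 ≠ 0 := j_ne _ (by norm_num)
lemma j28 : j 28 ≠ 0 := j_ne _ (by norm_num)
lemma mm_eq : mm - 1 = 2 * q * (j 4 * j 28) / (j 1 * j 7) := by
  have := j1; have := j4; have := j7; have := j28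
  rw [mm, P3L]; field_simp; ring
lemma rr_eq : rr - 1 = 16 * q * j 4 ^ 8 / j 1 ^ 8 := by
  have := j1; have := j4
  rw [rr, P2L]; field_simp; ring
lemma P2V : j 14 ^ 24 = j 7 ^ 16 * j 28 ^ 8 + 16 * q^7 * j 28 ^ 16 * j 7 ^ 8 := by
  have := congrArg VV P2L
  simp only [map_add, map_mul, map_pow, map_ofNat VV 16, VV_q, VV_j 1 le_rfl, VV_j 2 (by norm_num), VV_j 4 (by norm_num)] at this
  exact this
lemma rho_eq : rho - 1 = 16 * q^7 * j 28 ^ 8 / j 7 ^ 8 := by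
  have := j7; have := j28
  rw [rho, P2V]; field_simp; ring
lemma aa_LD : LD aa 1 1 := by
  have := LD_q.mul ((((LD_j 1 (by norm_num)).mul (LD_j 14 (by norm_num))).div ((LD_j 2 (by norm_num)).mul (LD_j 7 (by norm_num))) (by norm_num)).pow 4)
  exact this.cast (by norm_num) (by norm_num)
lemma bb_LD : LD bb (-1) 1 := by
  have := ((((LD_j 1 (by norm_num)).mul (LD_j 7 (by norm_num))).div ((LD_j 2 (by norm_num)).mul (LD_j 14 (by norm_num))) (by norm_num)).pow 3).div LD_q (by norm_num)
  exact this.cast (by norm_num) (by norm_num)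
lemma aa_ne : aa ≠ 0 := aa_LD.ne one_ne_zero
lemma bb_ne : bb ≠ 0 := bb_LD.ne one_ne_zero
lemma two_ne : (2:LL) ≠ 0 := two_ne_zero

lemma S_alg {F : Type*} [Field F] [CharZero F] (a b m r p : F) (ha : a ≠ 0) (hb : b ≠ 0) (h1 : b*(m*(m-1)) = 2) (h2 : a^3*b^4*(r*(r-1)) = 16)
    (h3 : b^4*(p*(p-1)) = 16*a^3) (h4 : r*p = m^8) (h5 : (r-1)*(p-1) = (m-1)^8) :
    (a+1/a-(b+8/b+7))*((a+1/a)^2+(a+1/a)*(b+8/b+7)+(b+8/b+7)^2-3) = 0 := by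
  have hm : m ≠ 0 := by rintro rfl; simp at h1
  have hm1 : m-1 ≠ 0 := by intro h; rw [h] at h1; simp at h1
  have eb : b = 2/(m*(m-1)) := by field_simp; linear_combination h1
  have e1 : r*(r-1)*(p*(p-1)) = (m*(m-1))^8 := by rw [mul_pow, ← h4, ← h5]; ring
  have hs : r + p = 1 + m^8 - (m-1)^8 := by linear_combination h4 - h5
  have e2 : a^3 * (m*(m-1))^4 = p*(p-1) := by
    have : (16:F) ≠ 0 := by norm_num
    rw [eb] at h3; field_simp at h3
    apply mul_left_cancel₀ this
    linear_combination -h3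
  have e3 : (m*(m-1))^4 = a^3 * (r*(r-1)) := by
    have : (16:F) ≠ 0 := by norm_num
    rw [eb] at h2; field_simp at h2
    apply mul_left_cancel₀ this
    linear_combination -h2
  have e4 : a^3+(1/a)^3 = (p*(p-1)+r*(r-1))/(m*(m-1))^4 := by
    rw [eq_div_iff (pow_ne_zero _ (mul_ne_zero hm hm1)), add_mul, e2, e3, div_pow]; field_simp
  have e5 : p*(p-1)+r*(r-1) = (1 + m^8 - (m-1)^8)^2 - 2*m^8 - (1 + m^8 - (m-1)^8) := by
    rw [← hs, ← h4]; ring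
  have e6 : (a+1/a)^3 - 3*(a+1/a) = (b+8/b+7)^3-3*(b+8/b+7) := by
    have : (a+1/a)^3 - 3*(a+1/a) = a^3+(1/a)^3 := by field_simp; ring
    rw [this, e4, e5, eb]; field_simp; ring
  linear_combination e6

lemma S_eq : aa + 1/aa = bb + 8/bb + 7 := by
  have hq := q_ne
  have := j1; have := j2; have := j4; have := j7; have := j14; have := j28
  have key := S_alg aa bb mm rr rho aa_ne bb_ne (by rw [mm_eq, bb, mm]; field_simp) (by rw [rr_eq, aa, bb, rr]; field_simp)
    (by rw [rho_eq, bb, aa, rho]; field_simp) (by rw [rr, rho, mm]; field_simp) (by rw [rr_eq, rho_eq, mm_eq]; field_simp; norm_num)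
  have c1 : LD (aa + 1/aa) (-1) 1 := by
    have h1 := LD_one.div aa_LD one_ne_zero
    exact ((aa_LD.low (-1) (by norm_num)).add (h1.cast (m := -1) (by norm_num) rfl)).cast rfl (by norm_num)
  have c2 : LD (bb + 8/bb + 7) (-1) 1 := by
    have h1 := (LD_nat 8).div bb_LD one_ne_zero
    exact ((bb_LD.add (h1.low (-1) (by norm_num))).add ((LD_nat 7).low (-1) (by norm_num))).cast rfl (by norm_num)
  have c3 := ((((c1.pow 2).add (c1.mul c2)).add (c2.pow 2)).sub ((LD_nat 3).low ((-1) * (2:ℕ)) (by norm_num))).ne (by norm_num)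
  exact sub_eq_zero.1 ((mul_eq_zero.1 key).resolve_right c3)

lemma L_alg {F : Type*} [Field F] [CharZero F] (a b m B v Lq : F) (ha : a ≠ 0) (h1 : b*(m*(m-1)) = 2) (hS : a+1/a = b+8/b+7) (hv : v ≠ 0)
    (hB : B*(m-1)^2 = 4*m) (hSv : v+1/v=B+8/B+7) (hL : Lq = b-a-1+8*a/b) :
    ((8/B-1)*v - (Lq/a-B+1))*((Lq/a-B+1)*v-(8/B-1)) = 0 := by
  have hm : m ≠ 0 := by rintro rfl; simp at h1
  have hm1 : m-1 ≠ 0 := by intro h; rw [h] at h1; simp at h1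
  have eb : b = 2/(m*(m-1)) := by field_simp; linear_combination h1
  have eB : B = 4*m/(m-1)^2 := by field_simp; linear_combination hB
  obtain ⟨C, hC⟩ : ∃ C, C = b+8/b+7 := ⟨_, rfl⟩
  obtain ⟨K, hK⟩ : ∃ K, K = B+8/B+7 := ⟨_, rfl⟩
  obtain ⟨D, hD⟩ : ∃ D, D = 8/B-1 := ⟨_, rfl⟩
  obtain ⟨n1, hn1⟩ : ∃ n1, n1 = 8/b-B := ⟨_, rfl⟩
  have i1 : n1^2+D^2-K*n1*D = (b-1)^2 := by rw [hn1, hK, hD, eb, eB]; field_simp; ring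
  have i2 : 2*(b-1)*n1-K*(b-1)*D = -(b-1)^2*C := by rw [hn1, hK, hD, hC, eb, eB]; field_simp; ring
  have eL : Lq/a-B+1 = (b-1)/a + n1 := by
    have hb : b ≠ 0 := by rintro rfl; simp at h1
    rw [hL, hn1]; field_simp; ring
  rw [← hK] at hSv
  rw [← hC] at hS
  have v2 : v^2 + 1 = K*v := by field_simp at hSv; linear_combination hSv
  have a2 : a^2 + 1 = C*a := by field_simp at hS; linear_combination hS
  rw [← hD, eL]
  have : a*((b-1)/a+n1) = (b-1)+n1*a := by field_simp
  obtain ⟨N, hN⟩ : ∃ N, N = (b-1)/a+n1 := ⟨_, rfl⟩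
  rw [← hN] at this ⊢
  have key : N^2 + D^2 = K*N*D := by
    have ha2 : a^2 ≠ 0 := pow_ne_zero _ ha
    apply mul_left_cancel₀ ha2
    linear_combination (a*N+(b-1)+n1*a - K*D*a)*this + a^2*i1+a*i2+(b-1)^2*a2
  linear_combination N*D*v2 - v*key

lemma VV2_inv (f : PowerSeries ℂ) (h : expand 2 (by norm_num) f = f) (n : ℕ) (hn : n ≠ 0) : coeff n f = 0 := by
  induction n using Nat.strong_induction_on with
  | _ n ih =>
    rw [← h, coeff_expand]
    split_ifs with hd
    · exact ih _ (by omega) (by omega)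
    · rfl

lemma L_eq : tt = bb - aa - 1 + 8*aa/bb := by
  have hq := q_ne
  have := j1; have := j2; have := j4; have := j7; have := j14; have := j28
  obtain ⟨Lq, hL⟩ : ∃ x, x = bb - aa - 1 + 8*aa/bb := ⟨_, rfl⟩
  have hSv := congrArg V2 S_eq
  simp only [map_add, map_div₀, map_one, map_ofNat V2 8, map_ofNat V2 7] at hSv
  have vL := aa_LD.Vtwo
  have BL := bb_LD.Vtwo
  have vne := vL.ne one_ne_zero
  have key := L_alg aa bb mm (V2 bb) (V2 aa) Lq aa_ne (by rw [mm_eq, bb, mm]; field_simp) S_eq vne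
    (by
      rw [mm_eq, mm, bb]
      simp only [map_div₀, map_mul, map_pow, V2_q, V2_j 1 le_rfl, V2_j 7 (by norm_num), V2_j 2 (by norm_num), V2_j 14 (by norm_num)]
      norm_num; field_simp; norm_num) hSv hL
  have LqL : LD Lq (-1) 1 := by
    rw [hL]
    have h1 := ((LD_nat 8).mul aa_LD).div bb_LD one_ne_zero
    exact (((bb_LD.sub (aa_LD.low (-1) (by norm_num))).sub (LD_one.low (-1) (by norm_num))).add (h1.low (-1) (by norm_num))).cast rfl (by norm_num)
  have DL : LD (8/V2 bb - 1) 0 (-1) := by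
    have h1 := ((LD_nat 8).div BL one_ne_zero).low 0 (by norm_num)
    exact (h1.sub LD_one).cast rfl (by norm_num)
  have NL : LD (Lq/aa - V2 bb + 1) (-2) 0 := by
    have h1 := LqL.div aa_LD one_ne_zero
    exact (((h1.cast (m := -2) (by norm_num) rfl).sub (BL.cast (m := -2) (by norm_num) rfl)).add (LD_one.low (-2) (by norm_num))).cast rfl (by norm_num)
  have ne : (Lq/aa - V2 bb + 1) * V2 aa - (8/V2 bb - 1) ≠ 0 := by
    have h1 := (NL.mul vL).cast (m := 0) (by norm_num) rfl
    exact (h1.sub DL).ne (by norm_num)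
  have e := (mul_eq_zero.1 key).resolve_right ne
  have e1 : V2 Lq = Lq/aa := by
    rw [hL]
    simp only [map_add, map_sub, map_mul, map_div₀, map_one, map_ofNat V2 8]
    rw [← hL]; linear_combination e
  have e2 : V2 tt = tt/aa := by
    rw [tt, aa]
    simp only [map_div₀, map_mul, map_pow, V2_q, V2_j 1 le_rfl, V2_j 7 (by norm_num)]
    norm_num; field_simp
  have LqN := LqL.ne one_ne_zero
  have inv : V2 (tt/Lq) = tt/Lq := by
    rw [map_div₀, e1, e2]; have := aa_ne; field_simp
  obtain ⟨f, hf, hx⟩ := (tt_LD.div LqL one_ne_zero)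
  have hx : tt/Lq = ii f := by rw [hx]; simp
  rw [hx, V2_ii] at inv
  have hf1 : f = 1 := by
    ext n
    by_cases hn : n = 0
    · subst hn; rw [coeff_zero_eq_constantCoeff_apply, hf]; simp
    · rw [VV2_inv f (ii_inj inv) n hn, coeff_one, if_neg hn]
  rw [hf1, map_one, div_eq_one_iff_eq LqN] at hx
  rw [hx, hL]
end

section
def sL : LL := tt⁻¹
def uL : LL := sL * aa
def wL : LL := uL - sL * bb
lemma sL_LD : LD sL 1 1 := (tt_LD.inv one_ne_zero).cast (by norm_num) (by norm_num)
lemma sL_ne : sL ≠ 0 := sL_LD.ne one_ne_zero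
lemma uL_LD : LD uL 2 1 := (sL_LD.mul aa_LD).cast (by norm_num) (by norm_num)
lemma uL_ne : uL ≠ 0 := uL_LD.ne one_ne_zero
lemma wL_LD : LD wL 0 (-1) := (((uL_LD.low 0 (by norm_num)).sub ((sL_LD.mul bb_LD).cast (m := 0) (by norm_num) rfl))).cast rfl (by norm_num)
lemma wL_ne : wL ≠ 0 := wL_LD.ne (by norm_num)
lemma t_s : tt * sL = 1 := mul_inv_cancel₀ tt_ne
lemma S' : aa^2*bb+bb = aa*bb^2+8*aa+7*aa*bb := by
  have h := S_eq; have := aa_ne; have := bb_ne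
  field_simp at h; linear_combination h
lemma t_eq : tt = bb - 8*aa + aa^2 - aa*bb := by
  have := bb_ne
  rw [L_eq]; field_simp; linear_combination -S'
lemma sb : sL * bb = uL - wL := by rw [wL]; ring
lemma eight_b : (aa - 7 - 7*wL)*bb = 8 := by
  have h1 : wL = sL*(aa-bb) := by rw [wL, uL]; ring
  have h2 : tt*(aa*bb-1) = 7*aa*(aa-bb) := by
    rw [t_eq]; linear_combination aa*S' - S'
  have h3 : 7*aa*wL = aa*bb-1 := by
    rw [h1]; linear_combination (-sL)*h2 + (aa*bb-1)*t_s
  apply mul_left_cancel₀ aa_ne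
  linear_combination S' - bb*h3
lemma u_eq : uL = wL^2 + wL - sL := by
  have h1 : wL = sL*(aa-bb) := by rw [wL, uL]; ring
  have h2 : tt*(1+bb) = (aa-bb)^2 := by
    rw [t_eq]; linear_combination S'
  rw [h1, uL]
  linear_combination sL^2*h2 - sL*(1+bb)*t_s
lemma cubic : wL^3+(1-7*sL)*wL^2-9*sL*wL-sL*(1-7*sL) = 0 := by
  have h1 : (uL-7*sL-7*wL*sL)*(uL-wL) = 8*sL^2 := by
    rw [← sb, uL]; linear_combination sL^2*eight_b
  rw [u_eq] at h1
  apply mul_left_cancel₀ wL_ne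
  linear_combination h1
lemma u_sq : uL^2 = sL*((wL+1)^2+7*uL*(wL+1)-uL) := by
  rw [u_eq]; linear_combination (wL+1)*cubic
def eL : LL := 7*(sL-uL)-(2*wL+1)
lemma e_sq : eL^2 = 49*(wL^2+wL)^2+18*(wL^2+wL)+1 := by
  rw [eL, u_eq]; linear_combination 28*cubic
lemma s_b : 8*(sL/bb) = uL-7*sL-7*wL*sL := by
  have := bb_ne
  field_simp; rw [uL]; linear_combination -sL*eight_b
lemma u_b : 8*(uL/bb) = (wL+1)^2-uL := by
  have := bb_ne
  have h : 8*uL = uL*(aa-7-7*wL)*bb := by linear_combination -uL*eight_b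
  have h2 : sL*(uL*aa) = sL*((wL+1)^2+7*uL*(wL+1)-uL) := by rw [← u_sq]; rw [uL]; ring
  have h3 := mul_left_cancel₀ sL_ne h2
  field_simp
  linear_combination h + bb*h3
end

section
open Polynomial

def evS : ℂ[X] →+* LL := eval₂RingHom cc sL
def ev : ℂ[X][X] →+* LL := eval₂RingHom evS wL
lemma evS_C (z : ℂ) : evS (C z) = cc z := by simp [evS]
lemma evS_X : evS X = sL := by simp [evS]
lemma ev_C (p : ℂ[X]) : ev (C p) = evS p := by simp [ev]
lemma ev_X : ev X = wL := by simp [ev]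

/-- elements of positive order are transcendental -/
lemma alg_const (x : LL) (p : ℂ[X]) (h : eval₂ cc x p = 0) (hp : p ≠ 0) : ∃ z, x = cc z := by
  have h1 : IsIntegral ℂ x := by
    refine ⟨p * C p.leadingCoeff⁻¹, monic_mul_leadingCoeff_inv hp, ?_⟩
    change eval₂ cc x _ = 0
    rw [eval₂_mul, h, zero_mul]
  have h2 := (IsAlgClosed.algebraMap_bijective_of_isIntegral (k := ℂ) (K := integralClosure ℂ LL)).2 ⟨x, h1⟩
  obtain ⟨z, hz⟩ := h2
  exact ⟨z, (congrArg Subtype.val hz).symm⟩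
lemma sL_not_const (z : ℂ) : sL ≠ cc z := by
  intro h
  have h1 := LD_cc z
  rw [← h] at h1
  have h2 := h1.uniq (sL_LD.low 0 (by norm_num))
  rw [h2, map_zero] at h
  exact sL_ne h
lemma evS_inj : Function.Injective evS := by
  rw [injective_iff_map_eq_zero]
  intro p hp
  by_contra h
  obtain ⟨z, hz⟩ := alg_const sL p hp h
  exact sL_not_const z hz
def evW : ℂ[X] →+* LL := eval₂RingHom cc wL
lemma evW_C (z : ℂ) : evW (C z) = cc z := by simp [evW]
lemma evW_X : evW X = wL := by simp [evW]
lemma evW_inj : Function.Injective evW := by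
  rw [injective_iff_map_eq_zero]
  intro p hp
  by_contra h
  obtain ⟨z, hz⟩ := alg_const wL p hp h
  have hz1 : z = -1 := by
    have h1 := LD_cc z
    rw [← hz] at h1
    exact h1.uniq wL_LD
  rw [hz1, map_neg, map_one] at hz
  have c := cubic
  rw [hz] at c
  have : sL*(1+7*sL) = 0 := by linear_combination c
  rcases mul_eq_zero.1 this with h | h
  · exact sL_ne h
  · apply sL_not_const (-1/7)
    rw [map_div₀, map_neg, map_one, map_ofNat]
    linear_combination h/7

def Phi : ℂ[X][X] := X^3 + C (1-7*X)*X^2 - C (9*X)*X - C (X*(1-7*X))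
lemma Phi_monic : Phi.Monic := by rw [Phi]; monicity!
lemma Phi_deg : Phi.natDegree = 3 := by rw [Phi]; compute_degree!
lemma ev_Phi : ev Phi = 0 := by
  simp only [Phi, map_sub, map_add, map_mul, map_pow, ev_C, ev_X, evS_X, map_one, map_ofNat evS 7, map_ofNat evS 9]
  exact cubic
lemma Phi_irr : Irreducible Phi := by
  rw [Phi_monic.irreducible_iff_roots_eq_zero_of_degree_le_three (by rw [Phi_deg]; norm_num) (by rw [Phi_deg])]
  rw [Multiset.eq_zero_iff_forall_notMem]
  intro r hr
  rw [mem_roots Phi_monic.ne_zero, IsRoot.def] at hr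
  have hr1 : r^3 + (1-7*X)*r^2 - 9*X*r - X*(1-7*X) = 0 := by
    rw [← hr]; simp [Phi]
  have hd : r.natDegree ≤ 1 := by
    by_contra hd
    have e : r^3 = C 7*X*r^2 - r^2 + C 9*X*r + (X - C 7*X^2) := by
      rw [map_ofNat, map_ofNat]; linear_combination hr1
    have h1 := congrArg natDegree e
    rw [natDegree_pow] at h1
    have h2 : (C 7*X*r^2 - r^2 + C 9*X*r + (X - C 7*X^2)).natDegree ≤ 2*r.natDegree+1 := by
      have k1 : (C 7*X*r^2).natDegree ≤ 2*r.natDegree+1 := by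
        refine (natDegree_mul_le).trans ?_
        have : (C (7:ℂ)*X).natDegree ≤ 1 := by compute_degree
        rw [natDegree_pow]; omega
      have k2 : (r^2).natDegree ≤ 2*r.natDegree+1 := by rw [natDegree_pow]; omega
      have k3 : (C 9*X*r).natDegree ≤ 2*r.natDegree+1 := by
        refine (natDegree_mul_le).trans ?_
        have : (C (9:ℂ)*X).natDegree ≤ 1 := by compute_degree
        omega
      have k4 : (X - C (7:ℂ)*X^2).natDegree ≤ 2*r.natDegree+1 := by
        have : (X - C (7:ℂ)*X^2).natDegree ≤ 2 := by compute_degree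
        omega
      exact natDegree_add_le_of_degree_le (natDegree_add_le_of_degree_le (natDegree_sub_le_of_le k1 k2 |>.trans (by simp)) k3) k4
    omega
  obtain ⟨a, b, rfl⟩ : ∃ a b : ℂ, r = C b * X + C a := ⟨_, _, eq_X_add_C_of_natDegree_le_one hd⟩
  have E : ∀ t : ℂ, (b*t+a)^3 + (1-7*t)*(b*t+a)^2-9*t*(b*t+a)-t*(1-7*t) = 0 := by
    intro t
    have := congrArg (eval t) hr1
    simpa using this
  have e0 := E 0
  have e1 := E 1
  have e2 := E (-1)
  have e3 := E 2
  have e4 := E (-2)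
  have : a^2*(a+1) = 0 := by linear_combination e0
  rcases mul_eq_zero.1 this with h | h
  · have ha : a = 0 := by simpa using h
    subst ha
    have : (6:ℂ) = 0 := by linear_combination (e3-e4)/2 - 4*(e1-e2)
    norm_num at this
  · have ha : a = -1 := by linear_combination h
    subst ha
    have hb : b = -1 := by linear_combination (4*(e1-e2) - (e3-e4)/2)/6
    subst hb
    norm_num at e1

def evF : FractionRing ℂ[X] →+* LL := IsFractionRing.lift (A := ℂ[X]) evS_inj
lemma evF_alg (p : ℂ[X]) : evF (algebraMap _ _ p) = evS p := IsFractionRing.lift_algebraMap evS_inj p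
lemma ev_map (G : ℂ[X][X]) : eval₂ evF wL (G.map (algebraMap ℂ[X] (FractionRing ℂ[X]))) = ev G := by
  rw [eval₂_map, ev, coe_eval₂RingHom]
  congr 1
  exact RingHom.ext fun p => evF_alg p
lemma cop_field {F : Type*} [Field F] (p r : F[X]) (hp : Irreducible p) (h : ¬ p ∣ r) : ∃ u v, u*p+v*r = 1 :=
  (hp.coprime_iff_not_dvd).2 h
lemma ev_small (G : ℂ[X][X]) (hd : G.natDegree < 3) (h : ev G = 0) : G = 0 := by
  by_contra hG
  have hi : Irreducible (Phi.map (algebraMap ℂ[X] (FractionRing ℂ[X]))) :=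
    (Phi_monic.irreducible_iff_irreducible_map_fraction_map).1 Phi_irr
  have hinj : Function.Injective (algebraMap ℂ[X] (FractionRing ℂ[X])) := IsFractionRing.injective _ _
  have hG' : G.map (algebraMap ℂ[X] (FractionRing ℂ[X])) ≠ 0 := by
    rwa [Ne, Polynomial.map_eq_zero_iff hinj]
  have hnd : ¬ Phi.map (algebraMap ℂ[X] (FractionRing ℂ[X])) ∣ G.map (algebraMap ℂ[X] (FractionRing ℂ[X])) := by
    intro hdv
    have := natDegree_le_of_dvd hdv hG'
    rw [natDegree_map_eq_of_injective hinj, natDegree_map_eq_of_injective hinj, Phi_deg] at this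
    omega
  obtain ⟨u, v, huv⟩ := cop_field _ _ hi hnd
  have := congrArg (eval₂ evF wL) huv
  rw [eval₂_add, eval₂_mul, eval₂_mul, ev_map, ev_map, ev_Phi, h] at this
  simp at this
lemma ev_dvd (G : ℂ[X][X]) (h : ev G = 0) : Phi ∣ G := by
  rw [← modByMonic_eq_zero_iff_dvd Phi_monic]
  apply ev_small
  · have := natDegree_modByMonic_lt G Phi_monic (by intro h1; have := Phi_deg; rw [h1] at this; simp at this)
    rwa [Phi_deg] at this
  · have h2 := modByMonic_add_div G Phi
    have := congrArg ev h2
    rw [map_add, map_mul, ev_Phi, h] at this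
    simpa using this
end

section
open Polynomial

lemma exA : ∃ B : ValuationSubring ℂ, B.valuation 7 < 1 := by
  have hI : (Ideal.span {(7 : (Int.castRingHom ℂ).range)}) ≠ ⊤ := by
    rw [Ne, Ideal.span_singleton_eq_top]
    intro h
    obtain ⟨⟨b, n, rfl⟩, hb⟩ := h.exists_right_inv
    have : (7:ℂ) * (n:ℂ) = 1 := congrArg Subtype.val hb
    have h2 : (7:ℤ)*n = 1 := by exact_mod_cast this
    omega
  obtain ⟨B, _, h⟩ := Ideal.image_subset_nonunits_valuationSubring _ hI
  refine ⟨B, ?_⟩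
  rw [← ValuationSubring.mem_nonunits_iff]
  exact h ⟨7, Ideal.mem_span_singleton_self _, rfl⟩
def AA : ValuationSubring ℂ := exA.choose
def nu := AA.valuation
lemma nu7 : nu 7 < 1 := exA.choose_spec
lemma memA (x : ℂ) : x ∈ AA ↔ nu x ≤ 1 := (AA.valuation_le_one_iff x).symm
lemma expp : ∃ z : ℂ, z^8 = 7 := IsAlgClosed.exists_pow_nat_eq 7 (by norm_num)
def pp : ℂ := expp.choose
lemma pp8 : pp^8 = 7 := expp.choose_spec
lemma pp_ne : pp ≠ 0 := by intro h; have := pp8; rw [h] at this; norm_num at this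
lemma nupp : nu pp < 1 := by
  by_contra h
  push Not at h
  have := nu7
  rw [← pp8, map_pow] at this
  exact absurd this (not_lt.2 (one_le_pow₀ h))
lemma ppA : pp ∈ AA := (memA _).2 nupp.le
def VA (n : ℤ) (c : ℂ) : Prop := c * pp^(-n) ∈ AA
lemma VA.add {n : ℤ} {c d : ℂ} (h : VA n c) (h' : VA n d) : VA n (c+d) := by
  unfold VA at *; rw [add_mul]; exact AA.add_mem _ _ h h'
lemma VA.neg {n : ℤ} {c : ℂ} (h : VA n c) : VA n (-c) := by
  unfold VA at *; rw [neg_mul]; exact AA.neg_mem _ h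
lemma VA_zero (n : ℤ) : VA n 0 := by unfold VA; rw [zero_mul]; exact AA.zero_mem
lemma VA.mul {n m : ℤ} {c d : ℂ} (h : VA n c) (h' : VA m d) : VA (n+m) (c*d) := by
  unfold VA at *
  rw [neg_add, zpow_add₀ pp_ne, show c*d*(pp^(-n)*pp^(-m)) = (c*pp^(-n))*(d*pp^(-m)) by ring]; exact AA.mul_mem _ _ h h'
lemma VA_pp (n : ℤ) : VA n (pp^n) := by
  unfold VA; rw [← zpow_add₀ pp_ne]; simp
lemma VA.mono {n m : ℤ} {c : ℂ} (h : VA n c) (hm : m ≤ n) : VA m c := by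
  unfold VA at *
  have : c*pp^(-m) = c*pp^(-n)*pp^(n-m).toNat := by
    rw [mul_assoc, ← zpow_natCast, ← zpow_add₀ pp_ne, Int.toNat_of_nonneg (by omega)]; congr 2; ring
  rw [this]; exact AA.mul_mem _ _ h (AA.toSubring.pow_mem ppA _)
lemma VA.cast {n m : ℤ} {c d : ℂ} (h : VA n c) (hm : n = m) (hc : c = d) : VA m d := hm ▸ hc ▸ h
lemma VA0 {c : ℂ} : VA 0 c ↔ c ∈ AA := by simp [VA]
lemma intA (n : ℤ) : (n:ℂ) ∈ AA := intCast_mem AA.toSubring n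
lemma int_unit (n : ℤ) (h : ¬ (7:ℤ) ∣ n) : ((n:ℂ))⁻¹ ∈ AA := by
  rw [memA, map_inv₀]
  apply inv_le_one_of_one_le₀
  by_contra hn
  push Not at hn
  have hc : IsCoprime (7:ℤ) n := (Int.prime_iff_natAbs_prime.2 (by norm_num)).coprime_iff_not_dvd.2 h
  obtain ⟨a, b, hab⟩ := hc
  have h1 : (a:ℂ)*7+b*n = 1 := by exact_mod_cast hab
  have h2 : nu ((a:ℂ)*7+b*n) < 1 := by
    refine nu.map_add_lt ?_ ?_
    · rw [map_mul]; exact mul_lt_one_of_nonneg_of_lt_one_right ((memA _).1 (intA a)) zero_le nu7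
    · rw [map_mul]; exact mul_lt_one_of_nonneg_of_lt_one_right ((memA _).1 (intA b)) zero_le hn
  rw [h1, map_one] at h2
  exact lt_irrefl _ h2
lemma ppinv (n : ℕ) (hn : n ≠ 0) : (pp^n)⁻¹ ∉ AA := by
  intro h
  rw [memA, map_inv₀, map_pow] at h
  have h1 : nu pp^n < 1 := pow_lt_one₀ zero_le nupp hn
  have h3 : nu pp^n ≠ 0 := pow_ne_zero _ ((map_ne_zero nu).2 pp_ne)
  exact absurd h1 (not_lt.2 ((inv_le_one₀ (zero_lt_iff.2 h3)).1 h))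
lemma rat_mem (r : ℚ) (h : (r:ℂ)*pp^7 ∈ AA) : (r:ℂ) ∈ AA := by
  have hr : (r:ℂ) = (r.num:ℂ) * ((r.den:ℤ):ℂ)⁻¹ := by
    conv_lhs => rw [← Rat.num_div_den r]
    push_cast; rfl
  have hd0 : (r.den:ℂ) ≠ 0 := by exact_mod_cast r.den_ne_zero
  by_cases hd : (7:ℤ) ∣ r.den
  · exfalso
    have hnum : ¬ (7:ℤ) ∣ r.num := by
      intro h7
      have := r.reduced
      have h8 : 7 ∣ r.num.natAbs := by omega
      have h9 : 7 ∣ r.den := by omega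
      have := Nat.dvd_gcd h8 h9
      rw [r.reduced] at this
      omega
    obtain ⟨z, hz⟩ := hd
    have hnum0 : (r.num:ℂ) ≠ 0 := by
      have : r.num ≠ 0 := fun h0 => hnum (h0 ▸ dvd_zero _)
      exact_mod_cast this
    apply ppinv 1 one_ne_zero
    have hzz : (r.den:ℂ) = 7*z := by exact_mod_cast hz
    have hz0 : (z:ℂ) ≠ 0 := by intro h0; rw [h0, mul_zero] at hzz; exact hd0 hzz
    have : (pp^1)⁻¹ = (z:ℂ)*((r.num:ℂ)⁻¹*((r:ℂ)*pp^7)) := by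
      rw [hr]; push_cast; rw [hzz, ← pp8]; have := pp_ne; field_simp
    rw [this]
    exact AA.mul_mem _ _ (intA z) (AA.mul_mem _ _ (int_unit _ hnum) h)
  · rw [hr]
    exact AA.mul_mem _ _ (intA _) (int_unit _ hd)
/-- rounding -/
lemma VA_round (r : ℚ) (n k : ℤ) (h : VA n r) (hk : 8*(k-1) < n) : VA (8*k) r := by
  have h1 : VA (8*k-7) r := h.mono (by omega)
  have e : (pp:ℂ)^(-(8*k)) = ((7:ℚ)^(-k) : ℚ) := by
    push_cast; rw [← pp8, ← zpow_natCast, ← zpow_mul]; congr 1; push_cast; ring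
  have e2 : ((r*(7:ℚ)^(-k) : ℚ):ℂ) = r*pp^(-(8*k)) := by rw [e]; push_cast; rfl
  unfold VA at *
  rw [← e2]
  apply rat_mem
  rw [e2, mul_assoc, ← zpow_natCast, ← zpow_add₀ pp_ne]
  convert h1 using 3
  push_cast; ring
lemma int_dvd (k : ℕ) (n : ℤ) (h : VA (8*k) n) : (7:ℤ)^k ∣ n := by
  induction k with
  | zero => simp
  | succ k ih =>
    obtain ⟨m, hm⟩ := ih (h.mono (by push_cast; omega))
    by_cases h7 : (7:ℤ) ∣ m
    · obtain ⟨l, rfl⟩ := h7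
      exact ⟨l, by rw [hm]; ring⟩
    · exfalso
      apply ppinv 8 (by norm_num)
      have hm0 : (m:ℂ) ≠ 0 := by
        have : m ≠ 0 := fun h0 => h7 (h0 ▸ dvd_zero _)
        exact_mod_cast this
      unfold VA at h
      have : (pp^8)⁻¹ = (m:ℂ)⁻¹*((n:ℂ)*pp^(-(8*((k+1:ℕ):ℤ)))) := by
        rw [hm]; push_cast; rw [← pp8]
        rw [zpow_neg, show (8*((k:ℤ)+1)) = ((8*k+8 : ℕ):ℤ) by push_cast; ring, zpow_natCast, pow_add, ← pow_mul]
        have := pp_ne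
        field_simp
      rw [this]
      exact AA.mul_mem _ _ (int_unit _ h7) h

/- integral closures -/
section IC
variable {R R' : Type*} [CommRing R] [CommRing R']
def IC (φ : R →+* LL) : Subring LL := letI := φ.toAlgebra; (integralClosure R LL).toSubring
lemma mem_IC {φ : R →+* LL} {x : LL} : x ∈ IC φ ↔ ∃ p : R[X], p.Monic ∧ eval₂ φ x p = 0 := Iff.rfl
lemma IC_base (φ : R →+* LL) (r : R) : φ r ∈ IC φ := by
  letI := φ.toAlgebra
  exact isIntegral_algebraMap (R := R) (A := LL) (x := r)
lemma IC_root {φ : R →+* LL} {x : LL} (p : LL[X]) (hp : p.Monic) (hc : ∀ i, p.coeff i ∈ IC φ) (h : eval x p = 0) :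
    x ∈ IC φ := by
  letI := φ.toAlgebra
  have h1 : IsIntegral (integralClosure R LL) x := by
    have hs : (↑p.coeffs : Set LL) ⊆ (IC φ : Subring LL) := by
      intro c hc'
      obtain ⟨i, _, rfl⟩ := mem_coeffs_iff.1 hc'
      exact hc i
    refine ⟨p.toSubring (IC φ) hs, (monic_toSubring _ _ _).2 hp, ?_⟩
    have : eval₂ (IC φ).subtype x (p.toSubring (IC φ) hs) = 0 := by
      rw [← eval_map]
      convert h
      exact map_toSubring _ _ _
    exact this
  exact isIntegral_trans (R := R) (A := integralClosure R LL) x h1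
lemma IC_eq {φ : R →+* LL} {x : LL} (n : ℕ) (c : ℕ → LL) (hc : ∀ i ∈ Finset.range n, c i ∈ IC φ)
    (h : x^n = ∑ i ∈ Finset.range n, c i * x^i) : x ∈ IC φ := by
  have hd : (∑ i ∈ Finset.range n, C (c i) * X^i : LL[X]).degree < n := by
    refine mem_degreeLT.1 (Submodule.sum_mem _ fun i hi => mem_degreeLT.2 ?_)
    refine (degree_C_mul_X_pow_le _ _).trans_lt ?_
    exact_mod_cast Finset.mem_range.1 hi
  refine IC_root (X^n - ∑ i ∈ Finset.range n, C (c i) * X^i) (monic_X_pow_sub ?_) ?_ ?_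
  · exact hd
  · intro i
    rw [coeff_sub, coeff_X_pow, finsetSum_coeff]
    refine Subring.sub_mem _ (by split_ifs; exacts [one_mem _, zero_mem _]) (Subring.sum_mem _ fun j hj => ?_)
    rw [coeff_C_mul_X_pow]; split_ifs; exacts [hc _ hj, zero_mem _]
  · rw [eval_sub, eval_finsetSum, eval_pow, eval_X, h]; simp
lemma IC_pow {φ : R →+* LL} {x : LL} (n : ℕ) (hn : 0 < n) (h : x^n ∈ IC φ) : x ∈ IC φ := by
  letI := φ.toAlgebra
  exact IsIntegral.of_pow hn h
lemma IC_trans {φ : R →+* LL} {ψ : R' →+* LL} (h : ∀ r, φ r ∈ IC ψ) : IC φ ≤ IC ψ := by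
  intro x hx
  obtain ⟨p, hp, hx⟩ := mem_IC.1 hx
  exact IC_root (p.map φ) (hp.map _) (fun i => by rw [coeff_map]; exact h _) (by rw [eval_map, hx])
lemma IC_map {φ : R →+* LL} {ψ : R →+* LL} {x : LL} (f : LL →+* LL) (hf : ∀ r, f (φ r) = ψ r) (hx : x ∈ IC φ) : f x ∈ IC ψ := by
  obtain ⟨p, hp, hx⟩ := mem_IC.1 hx
  refine mem_IC.2 ⟨p, hp, ?_⟩
  have := congrArg f hx
  rwa [hom_eval₂, map_zero, show f.comp φ = ψ from RingHom.ext hf] at this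
lemma IC_unmap {φ : R →+* LL} {x : LL} (f : LL →+* LL) (hx : f x ∈ IC (f.comp φ)) : x ∈ IC φ := by
  obtain ⟨p, hp, hx⟩ := mem_IC.1 hx
  refine mem_IC.2 ⟨p, hp, f.injective ?_⟩
  rw [hom_eval₂, hx, map_zero]
end IC
end

section
open Polynomial

def AR : Type := AA.toSubring
instance : CommRing AR := inferInstanceAs (CommRing AA.toSubring)
instance : IsDomain AR := inferInstanceAs (IsDomain AA.toSubring)
def iA : AR →+* ℂ := AA.toSubring.subtype
lemma iA_mem (a : AR) : iA a ∈ AA := Subtype.mem a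
lemma iA_ex (x : ℂ) (h : x ∈ AA) : ∃ a, iA a = x := ⟨⟨x, h⟩, rfl⟩
lemma iA_inj (a : AR) (h : iA a = 0) : a = 0 := Subtype.ext h
def phB : AR[X] →+* LL := eval₂RingHom (cc.comp iA) (cc (pp^14) * sL)
lemma phB_C (a : AR) : phB (C a) = cc (iA a) := by simp [phB]
lemma phB_X : phB X = cc (pp^14) * sL := by simp [phB]
def psB : AR[X] →+* ℂ[X] := eval₂RingHom (C.comp iA) (C (pp^14) * X)
lemma psB_coeff (g : AR[X]) (k : ℕ) : (psB g).coeff k = iA (g.coeff k) * pp^(14*k) := by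
  induction g using Polynomial.induction_on' with
  | add p r hp hr => rw [map_add, coeff_add, hp, hr, coeff_add, map_add]; ring
  | monomial n a =>
    simp only [psB, coe_eval₂RingHom, eval₂_monomial, RingHom.comp_apply, mul_pow, ← C_pow]
    rw [← mul_assoc, ← C_mul, coeff_C_mul_X_pow, coeff_monomial]
    by_cases h : k = n
    · subst h; simp [pow_mul]
    · rw [if_neg h, if_neg (Ne.symm h)]; simp
lemma evS_psB (g : AR[X]) : evS (psB g) = phB g := by
  have : evS.comp psB = phB := by
    apply Polynomial.ringHom_ext
    · intro a; simp [psB, phB, evS]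
    · change evS (psB X) = phB X
      rw [phB_X, psB, coe_eval₂RingHom, eval₂_X, map_mul, evS_C, evS_X]
  exact RingHom.congr_fun this g
lemma phB_inj (g : AR[X]) (h : phB g = 0) : g = 0 := by
  rw [← evS_psB] at h
  have h1 := evS_inj (h.trans (map_zero evS).symm)
  ext k
  have := congrArg (fun p => coeff p k) h1
  simp only [psB_coeff, coeff_zero] at this
  have h3 := (mul_eq_zero.1 this).resolve_right (pow_ne_zero _ pp_ne)
  rw [coeff_zero]; exact iA_inj _ h3
def evA : AR[X][X] →+* LL := eval₂RingHom phB (cc (pp^7) * wL)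
lemma evA_C (g : AR[X]) : evA (C g) = phB g := by simp [evA]
lemma evA_X : evA X = cc (pp^7) * wL := by simp [evA]
def pA : AR := (iA_ex pp ppA).choose
lemma iA_pA : iA pA = pp := (iA_ex pp ppA).choose_spec
def PhA : AR[X][X] := X^3 + C (C (pA^7) - C pA * X)*X^2 - C (9*X)*X - C (C (pA^7)*X-C pA * X^2)
lemma PhA_monic : PhA.Monic := by rw [PhA]; monicity!
lemma PhA_deg : PhA.natDegree = 3 := by rw [PhA]; compute_degree!
lemma ev_PhA : evA PhA = 0 := by
  have h7 : (7:LL) = cc pp^8 := by rw [← map_pow, pp8, map_ofNat]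
  simp only [PhA, map_sub, map_add, map_mul, map_pow, evA_C, evA_X, phB_X, phB_C, map_ofNat phB 9, iA_pA]
  have h := cubic
  rw [h7] at h
  change (cc pp^7*wL)^3 + (cc pp^7 - cc pp * (cc pp^14*sL)) * (cc pp^7 * wL)^2 - 9 * (cc pp^14*sL)*(cc pp^7*wL) - (cc pp^7*(cc pp^14*sL) - cc pp * (cc pp^14*sL)^2) = 0
  linear_combination cc pp^21*h
lemma quad_zero {R : Type*} [CommRing R] (a b c : R) (h : (C a + C b * X + C c * X^2 : R[X]) = 0) : a = 0 ∧ b = 0 ∧ c = 0 := by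
  have k0 := congrArg (fun p => coeff p 0) h
  have k1 := congrArg (fun p => coeff p 1) h
  have k2 := congrArg (fun p => coeff p 2) h
  simp only [coeff_add, coeff_C, coeff_C_mul, coeff_X, coeff_X_pow, coeff_zero] at k0 k1 k2
  norm_num at k0 k1 k2
  exact ⟨k0, k1, k2⟩
lemma evA_small (G : AR[X][X]) (hd : G.natDegree < 3) (h : evA G = 0) : G = 0 := by
  have hG : G = C (G.coeff 0) + C (G.coeff 1) * X + C (G.coeff 2) * X^2 := by
    conv_lhs => rw [as_sum_range_C_mul_X_pow' G hd]
    simp [Finset.sum_range_succ]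
  generalize G.coeff 0 = g0 at hG
  generalize G.coeff 1 = g1 at hG
  generalize G.coeff 2 = g2 at hG
  have h1 : ev (C (psB g0) + C (C (pp^7) * psB g1) * X + C (C (pp^7)^2*psB g2) * X^2) = 0 := by
    rw [hG] at h
    simp only [map_add, map_mul, map_pow, ev_C, evS_C, ev_X, evA_C, evA_X, evS_psB] at h ⊢
    linear_combination h
  have h2 := ev_small _ (by
    refine Nat.lt_succ_of_le ?_
    compute_degree) h1
  obtain ⟨k0, k1, k2⟩ := quad_zero _ _ _ h2
  have np : (C (pp^7) : ℂ[X]) ≠ 0 := by rw [Ne, C_eq_zero]; exact pow_ne_zero _ pp_ne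
  have k1 := (mul_eq_zero.1 k1).resolve_left np
  have k2 := (mul_eq_zero.1 k2).resolve_left (pow_ne_zero _ np)
  have z : ∀ g, psB g = 0 → g = 0 := fun g hg => phB_inj g (by rw [← evS_psB, hg, map_zero])
  rw [hG, z _ k0, z _ k1, z _ k2]; simp
lemma evA_dvd (G : AR[X][X]) (h : evA G = 0) : PhA ∣ G := by
  rw [← modByMonic_eq_zero_iff_dvd PhA_monic]
  apply evA_small
  · have := natDegree_modByMonic_lt G PhA_monic (by intro h1; have := PhA_deg; rw [h1] at this; simp at this)
    rwa [PhA_deg] at this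
  · have h2 := modByMonic_add_div G PhA
    have := congrArg evA h2
    rw [map_add, map_mul, ev_PhA, h] at this
    simpa using this
lemma exg (N : ℕ) (f : ℕ → ℂ) (hN : ∀ k, N ≤ k → f k = 0) (h : ∀ k, f k ∈ AA) : ∃ g : AR[X], ∀ k, iA (g.coeff k) = f k := by
  choose a ha using fun k => iA_ex _ (h k)
  refine ⟨∑ k ∈ Finset.range N, C (a k) * X^k, fun k => ?_⟩
  rw [finsetSum_coeff]
  simp only [coeff_C_mul_X_pow]
  rw [Finset.sum_ite_eq]
  split_ifs with hk
  · exact ha k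
  · rw [hN k (by simpa using hk), map_zero]

abbrev kk := IsLocalRing.ResidueField AA
def rsA : AR →+* kk := IsLocalRing.residue AA
lemma rsA_zero (a : AR) : rsA a = 0 ↔ nu (iA a) < 1 := by
  refine Iff.trans ?_ (AA.valuation_lt_one_iff a)
  exact IsLocalRing.residue_eq_zero_iff (R := AA) a
lemma rs_pA : rsA pA = 0 := (rsA_zero _).2 (by rw [iA_pA]; exact nupp)
lemma kk7 : (7:kk) = 0 := by
  have := (rsA_zero 7).2 (by rw [map_ofNat]; exact nu7)
  rwa [map_ofNat] at this
def thA (x y : kk[X]) : AR[X][X] →+* kk[X] := eval₂RingHom (eval₂RingHom (C.comp rsA) x) y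
lemma thA_C (x y g) : thA x y (C g) = eval₂ (C.comp rsA) x g := by simp [thA]
lemma thA_X (x y) : thA x y X = y := by simp [thA]
lemma thA_Phi (x y : kk[X]) (h : y^3 = 9*x*y) : thA x y PhA = 0 := by
  simp only [PhA, map_sub, map_add, map_mul, map_pow, thA_C, thA_X, eval₂_sub, eval₂_mul, eval₂_C, eval₂_X, RingHom.comp_apply, rs_pA, eval₂_pow, eval₂_ofNat, map_zero]
  linear_combination h
lemma thA_red (x y : kk[X]) (h : y^3 = 9*x*y) (p : AR[X][X]) (hp : p.Monic) (D : AR) (hD : rsA D = 0) (Z : AR[X][X])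
    (hz : evA (eval₂ C Z (scaleRoots p (C D))) = 0) : thA x y Z = 0 := by
  obtain ⟨H, hH⟩ := evA_dvd _ hz
  have h1 := congrArg (thA x y) hH
  rw [map_mul, thA_Phi x y h, zero_mul, hom_eval₂, ← eval_map, map_scaleRoots _ _ _ (by rw [hp.leadingCoeff, map_one]; exact one_ne_zero)] at h1
  have h2 : ((thA x y).comp C) (C D) = 0 := by
    rw [RingHom.comp_apply, thA_C, eval₂_C, RingHom.comp_apply, hD, map_zero]
  rw [h2, scaleRoots_zero, (hp.map _).leadingCoeff, one_smul, eval_pow, eval_X] at h1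
  exact eq_zero_of_pow_eq_zero h1

lemma exp_split (A B : kk[X]) (h : expand kk 2 A + expand kk 2 B * X = 0) : A = 0 ∧ B = 0 := by
  constructor
  · ext n
    have := congrArg (fun p => coeff p (n*2)) h
    simp only [coeff_add, coeff_expand_mul (by norm_num : 0 < 2), coeff_zero] at this
    rw [coeff_zero, ← this, left_eq_add]
    rcases n with _ | n
    · simp
    · rw [show (n+1)*2 = (2*n+1)+1 by ring, coeff_mul_X, coeff_expand (by norm_num), if_neg (by omega)]
  · ext n
    have := congrArg (fun p => coeff p (n*2+1)) h
    simp only [coeff_add, coeff_mul_X, coeff_expand_mul (by norm_num : 0 < 2), coeff_zero] at this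
    rw [coeff_zero, ← this, right_eq_add, coeff_expand (by norm_num), if_neg (by omega)]

lemma NB (c d e : ℂ[X]) (h : evS c + evS d * wL + evS e * uL ∈ IC phB) (k : ℕ) :
    VA (14*k) (c.coeff k) ∧ VA (14*k+7) (d.coeff k) ∧ VA (14*k+14) (e.coeff k) := by
  set y := evS c + evS d * wL + evS e * uL with hy
  let N := c.natDegree + d.natDegree + e.natDegree + 1
  let c' : ℕ → ℂ := fun k => c.coeff k * pp^(-(14*k:ℤ))
  let d' : ℕ → ℂ := fun k => d.coeff k * pp^(-(14*k+7:ℤ))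
  let e' : ℕ → ℂ := fun k => e.coeff k * pp^(-(14*k+14:ℤ))
  change c' k ∈ AA ∧ d' k ∈ AA ∧ e' k ∈ AA
  have c0 : ∀ k, N ≤ k → c' k = 0 := fun k hk => by
    simp only [c']; rw [coeff_eq_zero_of_natDegree_lt (by omega), zero_mul]
  have d0 : ∀ k, N ≤ k → d' k = 0 := fun k hk => by
    simp only [d']; rw [coeff_eq_zero_of_natDegree_lt (by omega), zero_mul]
  have e0 : ∀ k, N ≤ k → e' k = 0 := fun k hk => by
    simp only [e']; rw [coeff_eq_zero_of_natDegree_lt (by omega), zero_mul]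
  let S : Finset ℂ := (Finset.range (N+1)).image c' ∪ (Finset.range (N+1)).image d' ∪ (Finset.range (N+1)).image e'
  have hS : S.Nonempty := ⟨c' 0, by simp only [S, Finset.mem_union, Finset.mem_image]; exact Or.inl (Or.inl ⟨0, by simp, rfl⟩)⟩
  obtain ⟨m, hmS, hm⟩ := Finset.exists_max_image S nu hS
  have hc : ∀ k, nu (c' k) ≤ nu m := fun k => by
    by_cases hk : N ≤ k
    · rw [c0 k hk, map_zero]; exact zero_le
    · exact hm _ (by simp only [S, Finset.mem_union, Finset.mem_image]; exact Or.inl (Or.inl ⟨k, by simp; omega, rfl⟩))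
  have hd : ∀ k, nu (d' k) ≤ nu m := fun k => by
    by_cases hk : N ≤ k
    · rw [d0 k hk, map_zero]; exact zero_le
    · exact hm _ (by simp only [S, Finset.mem_union, Finset.mem_image]; exact Or.inl (Or.inr ⟨k, by simp; omega, rfl⟩))
  have he : ∀ k, nu (e' k) ≤ nu m := fun k => by
    by_cases hk : N ≤ k
    · rw [e0 k hk, map_zero]; exact zero_le
    · exact hm _ (by simp only [S, Finset.mem_union, Finset.mem_image]; exact Or.inr ⟨k, by simp; omega, rfl⟩)
  by_cases hm1 : nu m ≤ 1
  · exact ⟨(memA _).2 ((hc k).trans hm1), (memA _).2 ((hd k).trans hm1), (memA _).2 ((he k).trans hm1)⟩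
  exfalso
  push Not at hm1
  have hm0 : m ≠ 0 := by rintro rfl; rw [map_zero] at hm1; exact absurd hm1 (not_lt.2 zero_le)
  have hmp : 0 < nu m := zero_lt_iff.2 ((map_ne_zero nu).2 hm0)
  have hDlt : nu m⁻¹ < 1 := by rw [map_inv₀]; exact inv_lt_one_of_one_lt₀ hm1
  have key : ∀ x, nu x ≤ nu m → m⁻¹ * x ∈ AA := fun x hx => by
    rw [memA, map_mul, map_inv₀]; exact inv_mul_le_one_of_le₀ hx zero_le
  obtain ⟨D, hD⟩ := iA_ex m⁻¹ ((memA _).2 hDlt.le)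
  have hDr : rsA D = 0 := (rsA_zero _).2 (by rw [hD]; exact hDlt)
  obtain ⟨g1, hg1⟩ := exg N (fun k => m⁻¹ * c' k) (fun k hk => by simp only [c0 k hk, mul_zero]) (fun k => key _ (hc k))
  obtain ⟨g2, hg2⟩ := exg N (fun k => m⁻¹ * d' k) (fun k hk => by simp only [d0 k hk, mul_zero]) (fun k => key _ (hd k))
  obtain ⟨g3, hg3⟩ := exg N (fun k => m⁻¹ * e' k) (fun k hk => by simp only [e0 k hk, mul_zero]) (fun k => key _ (he k))
  have zp : ∀ n l : ℕ, pp^(-(14*n+l:ℤ)) * pp^(14*n) * pp^l = 1 := fun n l => by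
    rw [mul_assoc, ← pow_add, ← zpow_natCast, ← zpow_add₀ pp_ne]; push_cast; simp
  have f1 : psB g1 = C m⁻¹ * c := by
    ext n; rw [psB_coeff, hg1, coeff_C_mul]
    have := zp n 0
    simp only [c']; simp at this ⊢
    linear_combination m⁻¹ * c.coeff n * this
  have f2 : psB g2 * C (pp^7) = C m⁻¹ * d := by
    ext n; rw [coeff_mul_C, psB_coeff, hg2, coeff_C_mul]
    have := zp n 7
    simp only [d']; push_cast at this
    linear_combination m⁻¹ * d.coeff n * this
  have f3 : psB g3 * C (pp^14) = C m⁻¹ * e := by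
    ext n; rw [coeff_mul_C, psB_coeff, hg3, coeff_C_mul]
    have := zp n 14
    simp only [e']; push_cast at this
    linear_combination m⁻¹ * e.coeff n * this
  replace f1 := congrArg evS f1
  replace f2 := congrArg evS f2
  replace f3 := congrArg evS f3
  rw [map_mul, evS_C, evS_psB] at f1
  rw [map_mul, map_mul, evS_C, evS_C, evS_psB] at f2 f3
  let Z : AR[X][X] := C g1 + C g2 * X + C g3 * (X^2 + C (C (pA^7)) * X - C X)
  have hZ : evA Z = phB (C D) * y := by
    simp only [Z, map_sub, map_add, map_mul, map_pow, evA_C, evA_X, phB_X, phB_C, iA_pA, hD]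
    rw [map_pow] at f2 f3
    linear_combination f1 + wL * f2 + uL * f3 - phB g3 * cc pp^14 * u_eq
  obtain ⟨p, hp, hpy⟩ := mem_IC.1 h
  have hG : evA (eval₂ C Z (scaleRoots p (C D))) = 0 := by
    rw [hom_eval₂, hZ, show evA.comp C = phB from RingHom.ext evA_C]
    exact scaleRoots_eval₂_eq_zero _ hpy
  have t1 := thA_red X 0 (by ring) p hp D hDr Z hG
  have t2 := thA_red (X^2) (3*X) (by ring) p hp D hDr Z hG
  simp only [Z, map_sub, map_add, map_mul, map_pow, thA_C, thA_X, eval₂_C, eval₂_X, RingHom.comp_apply, rs_pA, map_zero] at t1 t2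
  have ex : ∀ g : AR[X], eval₂ (C.comp rsA) (X^2) g = expand kk 2 (eval₂ (C.comp rsA) X g) := fun g => by
    have := hom_eval₂ g (C.comp rsA) ((expand kk 2).toRingHom) X
    simp at this
    rw [this]
    congr 1
    ext a; simp
  rw [ex, ex, ex] at t2
  have cf : ∀ (g : AR[X]) n, (eval₂ (C.comp rsA) X g).coeff n = rsA (g.coeff n) := fun g n => by
    rw [← eval₂_map, eval₂_C_X, coeff_map]
  set G1 := eval₂ (C.comp rsA) X g1
  set G2 := eval₂ (C.comp rsA) X g2
  set G3 := eval₂ (C.comp rsA) X g3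
  have k7 : (7:kk[X]) = 0 := by rw [show (7:kk[X]) = C 7 from (map_ofNat C 7).symm, kk7, map_zero]
  have e1 : G1 = G3 * X := by linear_combination t1
  obtain ⟨hA, hB⟩ := exp_split (9*(G3*X)) (3*G2) (by
    simp only [map_mul, map_ofNat, expand_X]
    rw [e1] at t2
    simp only [map_mul, expand_X] at t2
    linear_combination t2)
  have z2 : G2 = 0 := by linear_combination 5*hB - 2*G2*k7
  have z1 : G1 = 0 := by rw [e1]; linear_combination 4*hA - 5*G3*X*k7
  have z3 : G3 = 0 := by
    rw [e1] at z1
    exact (mul_eq_zero.1 z1).resolve_right X_ne_zero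
  have fin : ∀ (a : AR), rsA a = 0 → iA a = m⁻¹*m → False := fun a ha h => by
    rw [rsA_zero, h, inv_mul_cancel₀ hm0, map_one] at ha
    exact lt_irrefl _ ha
  simp only [S, Finset.mem_union, Finset.mem_image] at hmS
  rcases hmS with (⟨n, _, hn⟩ | ⟨n, _, hn⟩) | ⟨n, _, hn⟩
  · exact fin (g1.coeff n) (by rw [← cf]; change G1.coeff n = 0; rw [z1, coeff_zero]) (by rw [hg1, hn])
  · exact fin (g2.coeff n) (by rw [← cf]; change G2.coeff n = 0; rw [z2, coeff_zero]) (by rw [hg2, hn])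
  · exact fin (g3.coeff n) (by rw [← cf]; change G3.coeff n = 0; rw [z3, coeff_zero]) (by rw [hg3, hn])
end

section
open Polynomial

abbrev FW := FractionRing ℂ[X]
def wF : FW →+* LL := IsFractionRing.lift (A := ℂ[X]) evW_inj
lemma wF_alg (p : ℂ[X]) : wF (algebraMap _ _ p) = evW p := IsFractionRing.lift_algebraMap evW_inj p
def ff : ℂ[X] := 49*(X^2+X)^2+18*(X^2+X)+1
lemma ff_eL : eL^2 = evW ff := by
  rw [e_sq, ff]
  simp only [map_add, map_mul, map_pow, evW_X, map_one, map_ofNat evW 49, map_ofNat evW 18]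
lemma ff_sqf : Squarefree ff := by
  apply Separable.squarefree
  refine ⟨C (1/448) * (250+5096*X+5096*X^2), C (1/448) * (11-615*X-1911*X^2-1274*X^3), ?_⟩
  have h : (C (1/448) : ℂ[X]) * 448 = 1 := by
    rw [← map_ofNat C 448, ← C_mul]; norm_num
  simp only [ff, derivative_add, derivative_mul, derivative_pow, derivative_X, derivative_one, derivative_ofNat]
  simp only [Nat.cast_ofNat, map_ofNat]
  linear_combination h
lemma ff_deg : ff.natDegree = 4 := by rw [ff]; compute_degree!
lemma F_int (r : FW) (h : wF r ∈ IC evW) : ∃ p : ℂ[X], r = algebraMap _ _ p := by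
  obtain ⟨p, hp, h0⟩ := mem_IC.1 h
  have h1 : IsIntegral ℂ[X] r := by
    refine ⟨p, hp, wF.injective ?_⟩
    rw [hom_eval₂, map_zero, ← h0]
    congr 1
    exact RingHom.ext wF_alg
  obtain ⟨s, hs⟩ := IsIntegrallyClosed.isIntegral_iff.1 h1
  exact ⟨s, hs.symm⟩
lemma wF_poly (p : ℂ[X]) : wF (algebraMap _ _ p) ∈ IC evW := by rw [wF_alg]; exact IC_base _ _
lemma eL_notin (r : FW) : wF r ≠ eL := by
  intro h
  have h1 : wF r ∈ IC evW := by
    apply IC_pow 2 (by norm_num)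
    rw [h, ff_eL]; exact IC_base _ _
  obtain ⟨p, rfl⟩ := F_int r h1
  rw [wF_alg] at h
  have h2 : p^2 = ff := evW_inj (by rw [map_pow, h, ff_eL])
  have h3 := ff_sqf p ⟨1, by rw [mul_one, ← h2, sq]⟩
  have h4 := ff_deg
  rw [← h2, natDegree_pow, natDegree_eq_zero_of_isUnit h3] at h4
  omega
lemma K_uniq (P Q : FW) (h : wF P + wF Q * eL = 0) : P = 0 ∧ Q = 0 := by
  have hQ : Q = 0 := by
    by_contra hQ
    have hQ' : wF Q ≠ 0 := (map_ne_zero wF).2 hQ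
    apply eL_notin (-P/Q)
    rw [map_div₀, map_neg]
    field_simp
    linear_combination -h
  rw [hQ, map_zero, zero_mul, add_zero] at h
  exact ⟨(map_eq_zero wF).1 h, hQ⟩
def KK : Subfield LL where
  carrier := {x | ∃ P Q : FW, x = wF P + wF Q * eL}
  mul_mem' := by
    rintro _ _ ⟨P, Q, rfl⟩ ⟨P', Q', rfl⟩
    refine ⟨P*P'+Q*Q'*algebraMap _ _ ff, P*Q'+Q*P', ?_⟩
    simp only [map_add, map_mul, wF_alg, ← ff_eL]; ring
  one_mem' := ⟨1, 0, by simp⟩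
  add_mem' := by
    rintro _ _ ⟨P, Q, rfl⟩ ⟨P', Q', rfl⟩
    exact ⟨P+P', Q+Q', by simp only [map_add]; ring⟩
  zero_mem' := ⟨0, 0, by simp⟩
  neg_mem' := by
    rintro _ ⟨P, Q, rfl⟩
    exact ⟨-P, -Q, by simp only [map_neg]; ring⟩
  inv_mem' := by
    rintro _ ⟨P, Q, rfl⟩
    by_cases h : wF P + wF Q * eL = 0
    · exact ⟨0, 0, by rw [h]; simp⟩
    have h' : wF P - wF Q * eL ≠ 0 := by
      intro h0
      obtain ⟨h1, h2⟩ := K_uniq P (-Q) (by rw [map_neg]; linear_combination h0)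
      apply h
      rw [h1, neg_eq_zero.1 h2]; simp
    refine ⟨P/(P^2-Q^2*algebraMap _ _ ff), -Q/(P^2-Q^2*algebraMap _ _ ff), ?_⟩
    have h2 : wF P^2-wF Q^2*eL^2 ≠ 0 := by
      rw [show wF P^2-wF Q^2*eL^2 = (wF P + wF Q * eL)*(wF P - wF Q * eL) by ring]
      exact mul_ne_zero h h'
    simp only [map_div₀, map_sub, map_pow, map_mul, wF_alg, ← ff_eL, map_neg]
    field_simp
    ring
lemma mem_KK {x : LL} : x ∈ KK ↔ ∃ P Q : FW, x = wF P + wF Q * eL := Iff.rfl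
lemma K_wF (P : FW) : wF P ∈ KK := ⟨P, 0, by simp⟩
lemma K_evW (P : ℂ[X]) : evW P ∈ KK := by rw [← wF_alg]; exact K_wF _
lemma K_cc (z : ℂ) : cc z ∈ KK := by rw [← evW_C]; exact K_evW _
lemma K_w : wL ∈ KK := by rw [← evW_X]; exact K_evW _
lemma K_e : eL ∈ KK := ⟨0, 1, by simp⟩
lemma s_of : sL = ((wL^2+wL)+(eL+2*wL+1)/7)/2 := by rw [eL, u_eq]; ring
lemma K_ofNat (n : ℕ) : (n : LL) ∈ KK := natCast_mem KK n
lemma K_s : sL ∈ KK := by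
  rw [s_of]
  exact div_mem (add_mem (add_mem (pow_mem K_w _) K_w) (div_mem (add_mem (add_mem K_e (mul_mem (K_ofNat 2) K_w)) (one_mem _)) (K_ofNat 7))) (K_ofNat 2)
lemma K_u : uL ∈ KK := by rw [u_eq]; exact sub_mem (add_mem (pow_mem K_w _) K_w) K_s
lemma IC_SW : IC evS ≤ IC evW := by
  apply IC_trans
  have hs : sL ∈ IC evW := by
    refine IC_eq 2 (fun i => if i = 0 then -(wL^2+wL^3)/7 else (1+9*wL+7*wL^2)/7) ?_ ?_
    · have h7 : (1/7:LL) ∈ IC evW := by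
        have := IC_base evW (C (1/7)); rwa [evW_C, map_div₀, map_one, map_ofNat] at this
      have hw : wL ∈ IC evW := by have := IC_base evW X; rwa [evW_X] at this
      intro i _
      split_ifs
      · rw [div_eq_mul_one_div]; exact mul_mem (neg_mem (add_mem (pow_mem hw _) (pow_mem hw _))) h7
      · rw [div_eq_mul_one_div]; exact mul_mem (add_mem (add_mem (one_mem _) (mul_mem (ofNat_mem _ 9) hw)) (mul_mem (ofNat_mem _ 7) (pow_mem hw _))) h7
    · simp only [Finset.sum_range_succ, Finset.sum_range_zero]
      norm_num
      linear_combination cubic/7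
  intro r
  change eval₂ cc sL r ∈ _
  rw [eval₂_eq_sum_range]
  refine Subring.sum_mem _ fun i _ => mul_mem ?_ (pow_mem hs _)
  have := IC_base evW (C (r.coeff i)); rwa [evW_C] at this
lemma NA (y : LL) (hy : y ∈ KK) (h : y ∈ IC evS) : ∃ P Q : ℂ[X], y = evW P + evW Q * eL := by
  replace h := IC_SW h
  obtain ⟨P, Q, rfl⟩ := hy
  by_cases hQ : Q = 0
  · subst hQ
    rw [map_zero, zero_mul, add_zero] at h
    obtain ⟨p, rfl⟩ := F_int _ h
    exact ⟨p, 0, by rw [wF_alg]; simp⟩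
  have h' : wF P - wF Q * eL ∈ IC evW := by
    obtain ⟨p, hp, h0⟩ := mem_IC.1 h
    refine mem_IC.2 ⟨p, hp, ?_⟩
    have tr : ∀ y, eval₂ evW y p = eval₂ wF y (p.map (algebraMap _ _)) := fun y => by
      rw [eval₂_map]; congr 1; exact RingHom.ext fun r => (wF_alg r).symm
    rw [tr] at h0 ⊢
    let m : FW[X] := X^2 + C (-(2*P)) * X + C (P^2-Q^2*algebraMap _ _ ff)
    have hm : m.Monic := by simp only [m]; monicity!
    have hmd : m.natDegree = 2 := by simp only [m]; compute_degree!
    have em : ∀ z, eval₂ wF z m = z^2-2*wF P*z+(wF P^2-wF Q^2*eL^2) := fun z => by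
      simp only [m, eval₂_add, eval₂_mul, eval₂_C, eval₂_X, eval₂_pow]
      rw [map_neg, map_mul, map_sub, map_pow, map_mul, map_pow, wF_alg, ff_eL, map_ofNat wF 2]; ring
    have dv := modByMonic_add_div (p.map (algebraMap ℂ[X] FW)) m
    have hr := natDegree_modByMonic_lt (p.map (algebraMap ℂ[X] FW)) hm (by intro h1; rw [h1] at hmd; simp at hmd)
    rw [hmd] at hr
    obtain ⟨a, b, hab⟩ : ∃ a b, (p.map (algebraMap ℂ[X] FW)) %ₘ m = C a * X + C b := ⟨_, _, eq_X_add_C_of_natDegree_le_one (by omega)⟩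
    rw [hab] at dv
    have e1 := congrArg (eval₂ wF (wF P + wF Q * eL)) dv
    rw [h0, eval₂_add, eval₂_mul wF, em] at e1
    simp only [eval₂_add, eval₂_mul, eval₂_C, eval₂_X] at e1
    obtain ⟨k1, k2⟩ := K_uniq (a*P+b) (a*Q) (by rw [map_add, map_mul, map_mul]; linear_combination e1)
    have ha : a = 0 := (mul_eq_zero.1 k2).resolve_right hQ
    subst ha
    have hb : b = 0 := by simpa using k1
    subst hb
    rw [← dv, eval₂_add, eval₂_mul, em]
    rw [eval₂_add, eval₂_mul, eval₂_C, map_zero]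
    ring
  have inv2 : wF (1/2) ∈ IC evW := by
    have := wF_poly (C (1/2))
    rwa [map_div₀, map_one, map_ofNat wF 2, ← show evW (C (1/2)) = 1/2 by rw [evW_C, map_div₀, map_one, map_ofNat], ← wF_alg]
  obtain ⟨p, hp⟩ := F_int P (by
    have := mul_mem inv2 (add_mem h h')
    convert this using 1
    rw [map_div₀, map_one, map_ofNat wF 2]; ring)
  subst hp
  obtain ⟨g, hg⟩ := F_int (Q^2*algebraMap _ _ ff) (by
    have := sub_mem (pow_mem (wF_poly p) 2) (mul_mem h h')
    convert this using 1
    rw [map_mul, map_pow, wF_alg, wF_alg, ← ff_eL]; ring)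
  obtain ⟨t, ht⟩ := F_int (Q*algebraMap _ _ ff) (by
    apply IC_pow 2 (by norm_num)
    rw [← map_pow, mul_pow, sq (algebraMap _ _ ff), ← mul_assoc, hg, ← map_mul]
    exact wF_poly _)
  have hinj : Function.Injective (algebraMap ℂ[X] FW) := IsFractionRing.injective _ _
  have h3 : t^2 = g*ff := hinj (by rw [map_pow, ← ht, map_mul, ← hg]; ring)
  have hf0 : ff ≠ 0 := by intro h0; have := ff_deg; rw [h0] at this; simp at this
  obtain ⟨z, rfl⟩ := (ff_sqf.dvd_pow_iff_dvd two_ne_zero).1 ⟨g, by rw [h3]; ring⟩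
  have hQz : Q = algebraMap _ _ z := by
    apply mul_right_cancel₀ (b := algebraMap ℂ[X] FW ff) ((map_ne_zero_iff _ hinj).2 hf0)
    rw [ht, map_mul]; ring
  exact ⟨p, z, by rw [hQz, wF_alg, wF_alg]⟩
lemma R_w : wL ∈ ev.range := ⟨X, ev_X⟩
lemma R_evS (p) : evS p ∈ ev.range := ⟨C p, ev_C p⟩
lemma R_s : sL ∈ ev.range := by rw [← evS_X]; exact R_evS _
lemma R_cc (z) : cc z ∈ ev.range := by rw [← evS_C]; exact R_evS _
lemma R_u : uL ∈ ev.range := by rw [u_eq]; exact sub_mem (add_mem (pow_mem R_w _) R_w) R_s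
lemma R_e : eL ∈ ev.range := sub_mem (mul_mem (ofNat_mem _ 7) (sub_mem R_s R_u)) (add_mem (mul_mem (ofNat_mem _ 2) R_w) (one_mem _))
lemma R_evW (p) : evW p ∈ ev.range := by
  change eval₂ cc wL p ∈ _
  rw [eval₂_eq_sum_range]
  exact Subring.sum_mem _ fun i _ => mul_mem (R_cc _) (pow_mem R_w _)
lemma NA' (y : LL) (hy : y ∈ KK) (h : y ∈ IC evS) : y ∈ ev.range := by
  obtain ⟨P, Q, rfl⟩ := NA y hy h
  exact add_mem (R_evW _) (mul_mem (R_evW _) R_e)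
lemma R_form (y : LL) (hy : y ∈ ev.range) : ∃ c d e : ℂ[X], y = evS c + evS d * wL + evS e * uL := by
  obtain ⟨G, rfl⟩ := hy
  have dv := modByMonic_add_div G Phi
  have hr := natDegree_modByMonic_lt G Phi_monic (by intro h1; have := Phi_deg; rw [h1] at this; simp at this)
  rw [Phi_deg] at hr
  have hG := as_sum_range_C_mul_X_pow' _ hr
  simp only [Finset.sum_range_succ, Finset.sum_range_zero] at hG
  have h1 := congrArg ev dv
  rw [map_add, map_mul, ev_Phi, hG] at h1
  simp only [map_add, map_mul, map_pow, ev_C, ev_X, map_zero] at h1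
  generalize (G %ₘ Phi).coeff 0 = c at h1
  generalize (G %ₘ Phi).coeff 1 = d at h1
  generalize (G %ₘ Phi).coeff 2 = e at h1
  refine ⟨c + e*X, d - e, e, ?_⟩
  rw [← h1, u_eq]
  simp only [map_add, map_sub, map_mul, evS_X]
  ring
lemma R_formW (y : LL) (hy : y ∈ ev.range) : ∃ P Q : ℂ[X], y = evW P + evW Q * eL := by
  apply NA
  · obtain ⟨G, rfl⟩ := hy
    change eval₂ evS wL G ∈ _
    rw [eval₂_eq_sum_range]
    refine sum_mem fun i _ => mul_mem ?_ (pow_mem K_w _)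
    change eval₂ cc sL _ ∈ _
    rw [eval₂_eq_sum_range]
    exact sum_mem fun i _ => mul_mem (K_cc _) (pow_mem K_s _)
  · have hw : wL ∈ IC evS := mem_IC.2 ⟨Phi, Phi_monic, ev_Phi⟩
    obtain ⟨G, rfl⟩ := hy
    change eval₂ evS wL G ∈ _
    rw [eval₂_eq_sum_range]
    exact sum_mem fun i _ => mul_mem (IC_base _ _) (pow_mem hw _)
lemma NA2 (y : LL) (h1 : wL*(wL+1)*y ∈ ev.range) (h2 : wL*(wL+1)*y^2 ∈ ev.range) : y ∈ ev.range := by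
  obtain ⟨P, Q, hPQ⟩ := R_formW _ h1
  obtain ⟨P', Q', hPQ'⟩ := R_formW _ h2
  have e1 : wF (algebraMap _ _ (X*(X+1)*P' - P^2-Q^2*ff)) + wF (algebraMap _ _ (X*(X+1)*Q' - 2*P*Q)) * eL = 0 := by
    rw [wF_alg, wF_alg]
    simp only [map_sub, map_mul, map_add, map_pow, evW_X, map_one, ← ff_eL, map_ofNat evW 2]
    linear_combination (-(wL*(wL+1)))*hPQ' + (wL*(wL+1)*y+evW P + evW Q*eL)*hPQ
  obtain ⟨k1, k2⟩ := K_uniq _ _ e1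
  have hinj : Function.Injective (algebraMap ℂ[X] FW) := IsFractionRing.injective _ _
  replace k1 := hinj (k1.trans (map_zero _).symm)
  replace k2 := hinj (k2.trans (map_zero _).symm)
  have van : ∀ a : ℂ, a*(a+1) = 0 → eval a P = 0 ∧ eval a Q = 0 := by
    intro a ha
    have e1 := congrArg (eval a) k1
    have e2 := congrArg (eval a) k2
    simp [ff] at e1 e2
    have hf : a^2+a = 0 := by linear_combination ha
    rw [hf] at e1
    have e1' : eval a P^2 + eval a Q^2 = 0 := by linear_combination -e1 + eval a P'*ha
    have e2' : eval a P * eval a Q = 0 := by linear_combination (-e2 + eval a Q'*ha)/2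
    rcases mul_eq_zero.1 e2' with h | h
    · rw [h] at e1'; exact ⟨h, by simpa using e1'⟩
    · rw [h] at e1'; exact ⟨by simpa using e1', h⟩
  have dvd : ∀ p : ℂ[X], eval 0 p = 0 → eval (-1) p = 0 → ∃ r, p = X*(X+1)*r := by
    intro p h0 h1
    obtain ⟨r, rfl⟩ := (dvd_iff_isRoot (p := p) (a := 0)).2 h0
    have : eval (-1) r = 0 := by simpa using h1
    obtain ⟨t, rfl⟩ := (dvd_iff_isRoot (a := -1)).2 this
    exact ⟨t, by simp; ring⟩
  obtain ⟨p, hp⟩ := dvd P (van 0 (by ring)).1 (van (-1) (by ring)).1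
  obtain ⟨r, hr⟩ := dvd Q (van 0 (by ring)).2 (van (-1) (by ring)).2
  have hw1 : wL+1 ≠ 0 := by
    intro h
    have := evW_inj (a₁ := X+1) (a₂ := 0) (by rw [map_add, evW_X, map_one, h, map_zero])
    have := congrArg (eval 0) this
    simp at this
  have : y = evW p + evW r * eL := by
    apply mul_left_cancel₀ (mul_ne_zero wL_ne hw1)
    rw [hPQ, hp, hr]
    simp only [map_mul, map_add, evW_X, map_one]; ring
  rw [this]
  exact add_mem (R_evW _) (mul_mem (R_evW _) R_e)
end

section
open Polynomial

lemma psum_mem (S : Subring LL) (x : Fin 7 → LL) (h : ∀ i, (∏ k, (X - C (x k))).coeff i ∈ S) (n : ℕ) : ∑ k, x k^n ∈ S := by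
  obtain ⟨G, hG⟩ := MvPolynomial.esymmAlgHom_surjective (σ := Fin 7) (R := ℤ) (n := 7) (by simp) ⟨MvPolynomial.psum (Fin 7) ℤ n, MvPolynomial.psum_isSymmetric _ _ _⟩
  have h1 := congrArg Subtype.val hG
  rw [MvPolynomial.esymmAlgHom_apply] at h1
  have h2 := congrArg (MvPolynomial.aeval x) h1
  simp only [MvPolynomial.psum, map_sum, map_pow, MvPolynomial.aeval_X] at h2
  rw [← h2, MvPolynomial.comp_aeval_apply]
  have hc : ∀ i : Fin 7, MvPolynomial.aeval x (MvPolynomial.esymm (Fin 7) ℤ (i+1)) ∈ S := by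
    intro i
    rw [MvPolynomial.aeval_esymm_eq_multiset_esymm]
    have := h (7-(i+1))
    rw [Finset.prod_eq_multiset_prod, ← Function.comp_def (fun y => X - C y) x, ← Multiset.map_map, Multiset.prod_X_sub_C_coeff _ (by simp; omega)] at this
    have e : Multiset.card (Multiset.map x Finset.univ.val) - (7-((i:ℕ)+1)) = i+1 := by simp; omega
    rw [e] at this
    have h3 := S.mul_mem (S.pow_mem (S.neg_mem S.one_mem) (i+1)) this
    rwa [← mul_assoc, ← mul_pow, neg_mul_neg, one_mul, one_pow, one_mul] at h3
  rw [MvPolynomial.aeval_def]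
  exact MvPolynomial.eval₂_mem (s := S) (fun m => by simp) hc

def KV : Subfield LL := KK.map VV
lemma KV_VV {x : LL} (h : x ∈ KK) : VV x ∈ KV := ⟨x, h, rfl⟩
lemma KV_sgm (k : ℕ) {x : LL} (h : x ∈ KV) : sgm k x = x := by
  obtain ⟨y, _, rfl⟩ := h
  exact sgm_VV k y
lemma K_aa : aa ∈ KK := by
  have : aa = uL / sL := by rw [uL]; have := sL_ne; field_simp
  rw [this]; exact div_mem K_u K_s
lemma K_bb : bb ∈ KK := by
  have : bb = (uL-wL) / sL := by rw [← sb]; have := sL_ne; field_simp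
  rw [this]; exact div_mem (sub_mem K_u K_w) K_s
lemma K_tt : tt ∈ KK := by
  have : tt = sL⁻¹ := by rw [sL, inv_inv]
  rw [this]; exact inv_mem K_s
lemma watP_coeff (i : ℕ) : (watP (VV tt)).coeff i ∈ KV := by
  rw [watP]
  have hT := KV_VV K_tt
  simp only [coeff_add, coeff_C_mul, coeff_X_pow, coeff_X, coeff_C]
  have h0 : ∀ (P : Prop) [Decidable P] (a b : LL), a ∈ KV → b ∈ KV → (if P then a else b) ∈ KV := by
    intro P _ a b ha hb; split_ifs; exacts [ha, hb]
  have z := zero_mem KV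
  have o := one_mem KV
  have n : ∀ n : ℕ, (n : LL) ∈ KV := fun n => natCast_mem KV n
  change _ ∈ KV
  refine add_mem (add_mem (add_mem (add_mem (add_mem (add_mem (add_mem ?_ ?_) ?_) ?_) ?_) ?_) ?_) ?_
  · exact h0 _ _ _ o z
  · exact mul_mem (n 7) (h0 _ _ _ o z)
  · exact mul_mem (n 21) (h0 _ _ _ o z)
  · exact mul_mem (n 49) (h0 _ _ _ o z)
  · exact mul_mem (add_mem (n 147) (mul_mem (n 7) hT)) (h0 _ _ _ o z)
  · exact mul_mem (add_mem (n 343) (mul_mem (n 35) hT)) (h0 _ _ _ o z)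
  · exact mul_mem (add_mem (n 343) (mul_mem (n 49) hT)) (h0 _ _ _ o z)
  · exact h0 _ _ _ (neg_mem (pow_mem hT 2)) z
lemma sum_range_mem (n : ℕ) : ∑ k ∈ Finset.range 7, (sgm k xi)^n ∈ KV := by
  rw [← Fin.sum_univ_eq_sum_range (fun k => (sgm k xi)^n)]
  refine psum_mem KV.toSubring (fun k => sgm k xi) (fun i => ?_) n
  rw [Fin.prod_univ_eq_prod_range (fun k => X - C (sgm k xi)), ← watson]
  exact watP_coeff i
def EE : IntermediateField KV LL := IntermediateField.adjoin KV {xi}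
lemma EE_xi : xi ∈ EE := IntermediateField.mem_adjoin_simple_self _ _
lemma EE_KV {x : LL} (h : x ∈ KV) : x ∈ EE := EE.algebraMap_mem ⟨x, h⟩
lemma xi_int : IsIntegral KV xi := by
  have hs : (↑(watP (VV tt)).coeffs : Set LL) ⊆ KV.toSubring := by
    intro c hc'
    obtain ⟨i, _, rfl⟩ := mem_coeffs_iff.1 hc'
    exact watP_coeff i
  refine ⟨(watP (VV tt)).toSubring KV.toSubring hs, (monic_toSubring _ _ _).2 (watP_monic _), ?_⟩
  have : eval₂ KV.toSubring.subtype xi ((watP (VV tt)).toSubring KV.toSubring hs) = 0 := by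
    rw [← eval_map]
    have e : map KV.toSubring.subtype ((watP (VV tt)).toSubring KV.toSubring hs) = watP (VV tt) := map_toSubring _ _ _
    rw [e, watson, eval_prod]
    apply Finset.prod_eq_zero (i := 0) (by simp)
    rw [sgm_zero]; simp
  exact this
lemma tr_mem (u : LL) (h : u ∈ EE) : ∑ k ∈ Finset.range 7, sgm k u ∈ KV := by
  have h1 : u ∈ (EE.toSubalgebra) := h
  rw [EE, IntermediateField.adjoin_simple_toSubalgebra_of_isAlgebraic xi_int.isAlgebraic, Algebra.adjoin_singleton_eq_range_aeval] at h1
  obtain ⟨Q, rfl⟩ := h1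
  have e : ∀ k, sgm k ((aeval xi) Q) = ∑ i ∈ Finset.range (Q.natDegree+1), (Q.coeff i : LL) * (sgm k xi)^i := by
    intro k
    rw [aeval_eq_sum_range, map_sum]
    refine Finset.sum_congr rfl fun i _ => ?_
    rw [Algebra.smul_def, map_mul, map_pow]
    congr 1
    exact KV_sgm k (Q.coeff i).2
  change ∑ k ∈ Finset.range 7, sgm k ((aeval xi) Q) ∈ KV
  simp only [e]
  rw [Finset.sum_comm]
  simp only [← Finset.mul_sum]
  exact sum_mem fun i _ => mul_mem (Q.coeff i).2 (sum_range_mem i)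
lemma UU_K (f : PowerSeries ℂ) (h : ii f ∈ EE) : ii (UU f) ∈ KK := by
  have h1 := tr_mem _ h
  rw [sum_sgm] at h1
  obtain ⟨y, hy, e⟩ := h1
  have e2 : y = 7 * ii (UU f) := VV.injective (by rw [map_mul, map_ofNat VV 7]; exact e)
  have : ii (UU f) = y / (7:ℕ) := by rw [e2]; push_cast; field_simp
  rw [this]; exact div_mem hy (K_ofNat 7)
end

section
open Polynomial

def pL : LL := q^2*(j 1 * j 98/(j 2 * j 49))
lemma pL_LD : LD pL 2 1 := 
  ((LD_q.pow 2).mul (((LD_j 1 (by norm_num)).mul (LD_j 98 (by norm_num))).div ((LD_j 2 (by norm_num)).mul (LD_j 49 (by norm_num))) (by norm_num))).cast (by norm_num) (by norm_num)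
lemma pL_ne : pL ≠ 0 := pL_LD.ne one_ne_zero
lemma j49 : j 49 ≠ 0 := j_ne _ (by norm_num)
lemma j98 : j 98 ≠ 0 := j_ne _ (by norm_num)
lemma Va : VV aa = q^7*(j 7 * j 98/(j 14 * j 49))^4 := by
  rw [aa]; simp only [map_mul, map_pow, map_div₀, VV_q, VV_j 1 (by norm_num), VV_j 2 (by norm_num), VV_j 7 (by norm_num), VV_j 14 (by norm_num)]
lemma Vb : VV bb = (j 7 * j 49/(j 14 * j 98))^3/q^7 := by
  rw [bb]; simp only [map_mul, map_pow, map_div₀, VV_q, VV_j 1 (by norm_num), VV_j 2 (by norm_num), VV_j 7 (by norm_num), VV_j 14 (by norm_num)]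
lemma Va_ne : VV aa ≠ 0 := (map_ne_zero VV).2 aa_ne
lemma Vb_ne : VV bb ≠ 0 := (map_ne_zero VV).2 bb_ne
lemma VT_ne : VV tt ≠ 0 := (map_ne_zero VV).2 tt_ne
lemma a_p : aa = pL^4/VV aa := by
  rw [Va, aa, pL]
  have := j1; have := j2; have := j7; have := j14; have := j49; have := j98; have := q_ne
  field_simp
lemma b_p : bb = pL^3*VV bb := by
  rw [Vb, bb, pL]
  have := j1; have := j2; have := j7; have := j14; have := j49; have := j98; have := q_ne
  field_simp
lemma xi4 : xi^4 = tt * VV tt := by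
  rw [VV_tt, tt, xi]
  have := j1; have := j7; have := j49; have := q_ne
  field_simp
lemma xi4_p : xi^4 = VV tt*(pL^3*VV bb - pL^4/VV aa - 1 + 8*pL/(VV aa*VV bb)) := by
  have h := L_eq
  rw [a_p, b_p] at h
  rw [xi4, h]
  have := Va_ne; have := Vb_ne; have := pL_ne
  field_simp
lemma pL_ne1 : pL ≠ 1 := by
  intro h
  have h1 := pL_LD.low 0 (by norm_num)
  rw [h] at h1
  exact zero_ne_one (h1.uniq LD_one)
def pP : LL[X] := X^7 + C (-(VV aa*VV bb-1))*X^6 + C (-(VV aa*VV bb-1))*X^5 + C (-(VV aa*VV bb-1))*X^4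
  + C (-(VV aa*VV bb-1+7*VV aa))*X^3+ C (-(VV aa*VV bb-1+7*VV aa))*X^2+ C (-(VV aa*VV bb-1+7*VV aa))*X + C (-(VV aa)^2)
lemma pP_eval (x : LL) : eval x pP = x^7-(VV aa*VV bb-1)*(x^6+x^5+x^4)-(VV aa*VV bb-1+7*VV aa)*(x^3+x^2+x)-(VV aa)^2 := by
  simp only [pP, eval_add, eval_mul, eval_pow, eval_X, eval_C]; ring
lemma pP_deg : pP.natDegree = 7 := by rw [pP]; compute_degree!
lemma pP_monic : pP.Monic := by rw [pP]; monicity!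
lemma pL_root : eval pL pP = 0 := by
  rw [pP_eval]
  have h := S'
  have hv := congrArg VV h
  simp only [map_add, map_mul, map_pow, map_ofNat VV 7, map_ofNat VV 8] at hv
  rw [a_p, b_p] at h
  have ha := Va_ne; have hb := Vb_ne; have hp := pL_ne
  have h1 : pL-1 ≠ 0 := sub_ne_zero.2 pL_ne1
  generalize VV aa = a at *
  generalize VV bb = b at *
  generalize pL = p at *
  have h2 : p^11*b+p^3*b*a^2-a*p^10*b^2-8*a*p^4-7*a*p^7*b = 0 := by
    have h3 : (p^4/a)^2*(p^3*b)+p^3*b-(p^4/a*(p^3*b)^2+8*(p^4/a)+7*(p^4/a)*(p^3*b)) = 0 := sub_eq_zero.2 h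
    have : p^11*b+p^3*b*a^2-a*p^10*b^2-8*a*p^4-7*a*p^7*b = a^2*((p^4/a)^2*(p^3*b)+p^3*b-(p^4/a*(p^3*b)^2+8*(p^4/a)+7*(p^4/a)*(p^3*b))) := by
      field_simp
      try ring
    rw [this, h3, mul_zero]
  have h4 : b*p^3*(p-1) ≠ 0 := mul_ne_zero (mul_ne_zero hb (pow_ne_zero _ hp)) h1
  apply mul_left_cancel₀ h4
  linear_combination h2 - p^4*hv
lemma pL_root_k (k : ℕ) : eval (sgm k pL) pP = 0 := by
  have := congrArg (sgm k) pL_root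
  rw [pP_eval] at this ⊢
  simpa only [map_sub, map_add, map_mul, map_pow, map_one, map_ofNat (sgm k) 7, sgm_VV, map_zero] using this
lemma pP_prod : pP = ∏ k ∈ Finset.range 7, (X - C (sgm k pL)) :=
  prod_roots _ (fun k => sgm k pL) pP_monic pP_deg (sgm_injOn pL_LD one_ne_zero (by norm_num)) (fun k _ => pL_root_k k)
lemma xi4_p_k (k : ℕ) : (sgm k xi)^4 = VV tt*((sgm k pL)^3*VV bb - (sgm k pL)^4/VV aa - 1 + 8*(sgm k pL)/(VV aa*VV bb)) := by
  have := congrArg (sgm k) xi4_p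
  simpa only [map_sub, map_add, map_mul, map_pow, map_one, map_div₀, map_ofNat (sgm k) 8, sgm_VV, map_zero] using this
lemma lift_E (p : LL[X]) (h : ∀ i, p.coeff i ∈ EE) : ∃ p' : EE[X], p'.map (algebraMap EE LL) = p := by
  have := (lifts_iff_coeff_lifts (f := algebraMap EE LL) p).2 (fun i => ⟨⟨_, h i⟩, rfl⟩)
  exact (mem_lifts p).1 this
lemma EE_p : pL ∈ EE := by
  have ka := EE_KV (KV_VV K_aa)
  have kb := EE_KV (KV_VV K_bb)
  have kt := EE_KV (KV_VV K_tt)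
  have kx := EE_xi
  have o := one_mem EE
  have z := zero_mem EE
  have n : ∀ n : ℕ, (n : LL) ∈ EE := fun n => natCast_mem EE n
  have h0 : ∀ (P : Prop) [Decidable P] (a b : LL), a ∈ EE → b ∈ EE → (if P then a else b) ∈ EE := by
    intro P _ a b ha hb; split_ifs; exacts [ha, hb]
  obtain ⟨g, hg⟩ := lift_E pP (by
    intro i
    rw [pP]
    simp only [coeff_add, coeff_C_mul, coeff_X_pow, coeff_X, coeff_C]
    have k1 := neg_mem (sub_mem (mul_mem ka kb) o)
    have k2 := neg_mem (add_mem (sub_mem (mul_mem ka kb) o) (mul_mem (n 7) ka))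
    refine add_mem (add_mem (add_mem (add_mem (add_mem (add_mem (add_mem ?_ ?_) ?_) ?_) ?_) ?_) ?_) ?_
    · exact h0 _ _ _ o z
    · exact mul_mem k1 (h0 _ _ _ o z)
    · exact mul_mem k1 (h0 _ _ _ o z)
    · exact mul_mem k1 (h0 _ _ _ o z)
    · exact mul_mem k2 (h0 _ _ _ o z)
    · exact mul_mem k2 (h0 _ _ _ o z)
    · exact mul_mem k2 (h0 _ _ _ o z)
    · exact h0 _ _ _ (neg_mem (pow_mem ka 2)) z)
  let H : LL[X] := C (VV tt) * (C (VV bb) * X^3 - C (VV aa)⁻¹ * X^4 - 1 + C (8/(VV aa*VV bb)) * X) - C (xi^4)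
  obtain ⟨h, hh⟩ := lift_E H (by
    intro i
    simp only [H, coeff_add, coeff_sub, coeff_C_mul, coeff_X_pow, coeff_X, coeff_C, coeff_one]
    refine sub_mem (mul_mem kt (add_mem (sub_mem (sub_mem (mul_mem kb ?_) (mul_mem (inv_mem ka) ?_)) ?_) (mul_mem (div_mem (n 8) (mul_mem ka kb)) ?_))) (h0 _ _ _ (pow_mem kx 4) z)
    all_goals exact h0 _ _ _ o z)
  have hH : ∀ x, eval x H = VV tt*(x^3*VV bb - x^4/VV aa - 1 + 8*x/(VV aa*VV bb)) - xi^4 := fun x => by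
    simp only [H, eval_sub, eval_add, eval_mul, eval_pow, eval_X, eval_C, eval_one]; ring
  have gm : g.Monic := monic_of_injective (algebraMap EE LL).injective (by rw [hg]; exact pP_monic)
  have g0 : aeval pL g = 0 := by rw [aeval_def, ← eval_map, hg, pL_root]
  have h0' : aeval pL h = 0 := by rw [aeval_def, ← eval_map, hh, hH, xi4_p, sub_self]
  have hint : IsIntegral EE pL := ⟨g, gm, g0⟩
  have d1 := map_dvd (mapRingHom (algebraMap EE LL)) (minpoly.dvd EE pL g0)
  have d2 := map_dvd (mapRingHom (algebraMap EE LL)) (minpoly.dvd EE pL h0')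
  rw [coe_mapRingHom, hg, pP_prod] at d1
  rw [coe_mapRingHom, hh] at d2
  set m := (minpoly EE pL).map (algebraMap EE LL) with hm
  have hmm : m.Monic := (minpoly.monic hint).map _
  have hP0 : (∏ k ∈ Finset.range 7, (X - C (sgm k pL))) ≠ 0 := by rw [← pP_prod]; exact pP_monic.ne_zero
  have hspl : m.Splits := Splits.of_dvd (Splits.prod fun k _ => Splits.X_sub_C _) hP0 d1
  have hsep : m.Separable := Separable.of_dvd (separable_prod_X_sub_C_iff'.2 (sgm_injOn pL_LD one_ne_zero (by norm_num))) d1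
  have hroot : ∀ x ∈ m.roots, x = pL := by
    intro x hx
    rw [mem_roots hmm.ne_zero] at hx
    have r1 := hx.dvd d1
    rw [IsRoot.def, eval_prod, Finset.prod_eq_zero_iff] at r1
    obtain ⟨k, hk, hxk⟩ := r1
    rw [eval_sub, eval_X, eval_C, sub_eq_zero] at hxk
    have r2 := hx.dvd d2
    rw [IsRoot.def, hH, hxk, ← xi4_p_k, sub_eq_zero] at r2
    have hx4 : LD (xi^4) (-8) 1 := (xi_LD.pow 4).cast (by norm_num) (by norm_num)
    have := sgm_injOn hx4 one_ne_zero ⟨-1, -1, by norm_num⟩ (Finset.mem_coe.2 hk) (Finset.mem_coe.2 (Finset.mem_range.2 (show 0 < 7 by norm_num))) (by simp only [sgm_zero, map_pow]; exact r2)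
    rw [hxk, this, sgm_zero]
  have hcard : m.natDegree ≤ 1 := by
    rw [hspl.natDegree_eq_card_roots]
    classical
    have nd := nodup_roots hsep
    rw [← Multiset.toFinset_card_of_nodup nd]
    apply Finset.card_le_one.2
    intro a ha b hb
    rw [hroot a (by simpa using ha), hroot b (by simpa using hb)]
  have hdeg : (minpoly EE pL).degree = 1 := by
    rw [hm, natDegree_map] at hcard
    have := minpoly.natDegree_pos hint
    rw [degree_eq_natDegree (minpoly.ne_zero hint)]
    have e : (minpoly EE pL).natDegree = 1 := by omega
    rw [e]; rfl
  obtain ⟨y, hy⟩ := minpoly.mem_range_of_degree_eq_one EE pL hdeg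
  rw [← hy]; exact y.2
lemma EE_a : aa ∈ EE := by rw [a_p]; exact div_mem (pow_mem EE_p _) (EE_KV (KV_VV K_aa))
lemma EE_b : bb ∈ EE := by rw [b_p]; exact mul_mem (pow_mem EE_p _) (EE_KV (KV_VV K_bb))
lemma EE_t : tt ∈ EE := by
  have : tt = xi^4/VV tt := by rw [xi4]; have := VT_ne; field_simp
  rw [this]; exact div_mem (pow_mem EE_xi _) (EE_KV (KV_VV K_tt))
lemma EE_s : sL ∈ EE := inv_mem EE_t
lemma EE_u : uL ∈ EE := mul_mem EE_s EE_a
lemma EE_w : wL ∈ EE := sub_mem EE_u (mul_mem EE_s EE_b)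
lemma EE_cc (z : ℂ) : cc z ∈ EE := by
  have := EE_KV (KV_VV (K_cc z)); rwa [VV_cc] at this
lemma EE_evS (p : ℂ[X]) : evS p ∈ EE := by
  change eval₂ cc sL p ∈ _
  rw [eval₂_eq_sum_range]
  exact sum_mem fun i _ => mul_mem (EE_cc _) (pow_mem EE_s _)
end

section
open Polynomial

def pE : LL := cc pp
lemma pE8 : (7:LL) = pE^8 := by rw [pE, ← map_pow, pp8, map_ofNat]
lemma pE_ne : pE ≠ 0 := (map_ne_zero cc).2 pp_ne
def OO : Subring LL := IC (VV.comp phB)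
lemma O_A {a : ℂ} (h : a ∈ AA) : cc a ∈ OO := by
  obtain ⟨b, rfl⟩ := iA_ex a h
  have := IC_base (VV.comp phB) (C b)
  rwa [RingHom.comp_apply, phB_C, VV_cc] at this
lemma O_P : pE ∈ OO := O_A ppA
def sV : LL := pE^14*VV sL
lemma O_sV : sV ∈ OO := by
  have := IC_base (VV.comp phB) X
  rwa [RingHom.comp_apply, phB_X, map_mul, VV_cc, map_pow] at this
lemma O_n (n : ℕ) : (n : LL) ∈ OO := natCast_mem _ n
def xx : LL := xi⁻¹
lemma xi_xx : xi * xx = 1 := mul_inv_cancel₀ xi_ne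
lemma VT_s : VV tt * VV sL = 1 := by rw [← map_mul, t_s, map_one]
lemma wat_xi : xi^7+7*xi^6+21*xi^5+49*xi^4+(147+7*VV tt)*xi^3+(343+35*VV tt)*xi^2+(343+49*VV tt)*xi-(VV tt)^2 = 0 := by
  have h : eval xi (watP (VV tt)) = 0 := by
    rw [watson, eval_prod, Finset.prod_eq_zero_iff]
    exact ⟨0, by simp, by simp [sgm_zero]⟩
  rw [watP_eval] at h
  linear_combination h
lemma x7 : xx^7 = (VV sL)^2*(1+7*xx+21*xx^2+49*xx^3+147*xx^4+343*xx^5+343*xx^6) + 7*VV sL*(xx^4+5*xx^5+7*xx^6) := by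
  have h1 := wat_xi; have h3 := VT_s; have := xi_ne
  have hT : VV tt ≠ 0 := VT_ne
  have h4 : VV sL = 1/VV tt := by field_simp; linear_combination h3
  rw [h4, xx]
  field_simp
  linear_combination -h1
lemma s_x : sL = VV tt * xx^4 := by
  have h := xi4; have h2 := t_s; have := xi_ne; have := tt_ne
  rw [sL, xx]; field_simp; linear_combination h
lemma s2 : sL^2 = xx+7*xx^2+21*xx^3+49*xx^4+147*xx^5+343*xx^6+343*xx^7 + 7*sL*(xx+5*xx^2+7*xx^3) := by
  have h1 := wat_xi; have := xi_ne
  rw [s_x, xx]; field_simp; linear_combination -h1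
lemma O_x : pE^4*xx ∈ OO := by
  have P := O_P; have G := O_sV
  have n3 := O_n 3; have n5 := O_n 5
  refine IC_eq 7 (fun i => if i = 0 then sV^2 else if i = 1 then sV^2*pE^4 else if i = 2 then sV^2*(3:ℕ) else if i = 3 then sV^2*pE^4
    else if i = 4 then sV^2*(3:ℕ)+sV*pE^6 else if i = 5 then sV^2*pE^4+sV*((5:ℕ)*pE^2) else sV^2+sV*pE^6) ?_ ?_
  · intro i _
    have g2 := pow_mem G 2
    have p4 := pow_mem P 4
    have p6 := pow_mem P 6
    have p2 := pow_mem P 2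
    change _ ∈ OO
    split_ifs
    · exact g2
    · exact mul_mem g2 p4
    · exact mul_mem g2 n3
    · exact mul_mem g2 p4
    · exact add_mem (mul_mem g2 n3) (mul_mem G p6)
    · exact add_mem (mul_mem g2 p4) (mul_mem G (mul_mem n5 p2))
    · exact add_mem g2 (mul_mem G p6)
  · simp only [Finset.sum_range_succ, Finset.sum_range_zero]
    norm_num [sV]
    have h := x7
    rw [show (343:LL) = 7^3 by norm_num, show (147:LL) = 3*7^2 by norm_num, show (49:LL) = 7^2 by norm_num, show (21:LL) = 3*7 by norm_num, pE8] at h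
    linear_combination pE^28*h
lemma O_s : pE^2*sL ∈ OO := by
  have P := O_P; have X := O_x
  have n3 := O_n 3; have n5 := O_n 5
  set x := pE^4*xx with hx
  refine IC_eq 2 (fun i => if i = 0 then x+pE^4*x^2+(3:ℕ)*x^3+pE^4*x^4+(3:ℕ)*x^5+pE^4*x^6+x^7 else pE^6*x+(5:ℕ)*pE^2*x^2+pE^6*x^3) ?_ ?_
  · intro i _
    have p4 := pow_mem P 4
    change _ ∈ OO
    split_ifs
    · exact add_mem (add_mem (add_mem (add_mem (add_mem (add_mem X (mul_mem p4 (pow_mem X 2))) (mul_mem n3 (pow_mem X 3))) (mul_mem p4 (pow_mem X 4))) (mul_mem n3 (pow_mem X 5))) (mul_mem p4 (pow_mem X 6))) (pow_mem X 7)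
    · exact add_mem (add_mem (mul_mem (pow_mem P 6) X) (mul_mem (mul_mem n5 (pow_mem P 2)) (pow_mem X 2))) (mul_mem (pow_mem P 6) (pow_mem X 3))
  · simp only [Finset.sum_range_succ, Finset.sum_range_zero]
    norm_num [hx]
    have h := s2
    rw [show (343:LL) = 7^3 by norm_num, show (147:LL) = 3*7^2 by norm_num, show (49:LL) = 7^2 by norm_num, show (21:LL) = 3*7 by norm_num, pE8] at h
    linear_combination pE^4*h
def Xi : LL := xi*sL^2
lemma O_Xi : Xi ∈ OO := by
  have P := O_P; have X := O_x; have S := O_s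
  have n3 := O_n 3; have n5 := O_n 5
  have p4 := pow_mem P 4
  have e : Xi = (1+pE^4*(pE^4*xx)+(3:ℕ)*(pE^4*xx)^2+pE^4*(pE^4*xx)^3+(3:ℕ)*(pE^4*xx)^4+pE^4*(pE^4*xx)^5+(pE^4*xx)^6)
      + pE^2*sL*(pE^6+(5:ℕ)*pE^2*(pE^4*xx)+pE^6*(pE^4*xx)^2) := by
    have h := s2
    rw [show (343:LL) = 7^3 by norm_num, show (147:LL) = 3*7^2 by norm_num, show (49:LL) = 7^2 by norm_num, show (21:LL) = 3*7 by norm_num, pE8] at h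
    rw [Xi, h]
    push_cast
    linear_combination (1+pE^8*xx+3*pE^8*xx^2+pE^16*xx^3+3*pE^16*xx^4+pE^24*xx^5+pE^24*xx^6+pE^8*sL*(1+5*xx+pE^8*xx^2))*xi_xx
  rw [e]
  refine add_mem (add_mem (add_mem (add_mem (add_mem (add_mem (add_mem (one_mem _) (mul_mem p4 X)) (mul_mem n3 (pow_mem X 2))) (mul_mem p4 (pow_mem X 3))) (mul_mem n3 (pow_mem X 4))) (mul_mem p4 (pow_mem X 5))) (pow_mem X 6)) (mul_mem S (add_mem (add_mem (pow_mem P 6) (mul_mem (mul_mem n5 (pow_mem P 2)) X)) (mul_mem (pow_mem P 6) (pow_mem X 2))))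
lemma O_w : pE*wL ∈ OO := by
  have P := O_P; have S := O_s; have n9 := O_n 9
  refine IC_eq 3 (fun i => if i = 0 then pE*(pE^2*sL)-pE^7*(pE^2*sL)^2 else if i = 1 then (9:ℕ)*(pE^2*sL) else pE^7*(pE^2*sL)-pE) ?_ ?_
  · intro i _
    change _ ∈ OO
    split_ifs
    · exact sub_mem (mul_mem P S) (mul_mem (pow_mem P _) (pow_mem S _))
    · exact mul_mem n9 S
    · exact sub_mem (mul_mem (pow_mem P _) S) P
  · simp only [Finset.sum_range_succ, Finset.sum_range_zero]
    norm_num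
    have h := cubic
    rw [pE8] at h
    linear_combination pE^3*h
lemma O_u : pE^2*uL ∈ OO := by
  have e : pE^2*uL = (pE*wL)^2+pE*(pE*wL)-pE^2*sL := by rw [u_eq]; ring
  rw [e]; exact sub_mem (add_mem (pow_mem O_w _) (mul_mem O_P O_w)) O_s
lemma O_Vw : pE^7*VV wL ∈ OO := by
  have P := O_P; have S := O_sV; have n9 := O_n 9
  refine IC_eq 3 (fun i => if i = 0 then pE^7*sV-pE*sV^2 else if i = 1 then (9:ℕ)*sV else pE*sV-pE^7) ?_ ?_
  · intro i _
    change _ ∈ OO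
    split_ifs
    · exact sub_mem (mul_mem (pow_mem P _) S) (mul_mem P (pow_mem S _))
    · exact mul_mem n9 S
    · exact sub_mem (mul_mem P S) (pow_mem P _)
  · simp only [Finset.sum_range_succ, Finset.sum_range_zero]
    norm_num [sV]
    have h := congrArg VV cubic
    simp only [map_sub, map_add, map_mul, map_pow, map_one, map_ofNat VV 7, map_ofNat VV 9, map_zero] at h
    rw [pE8] at h
    linear_combination pE^21*h
lemma Vu_eq : VV uL = (VV wL)^2+VV wL-VV sL := by rw [u_eq]; simp only [map_sub, map_add, map_pow]
lemma O_Vu : pE^14*VV uL ∈ OO := by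
  have e : pE^14*VV uL = (pE^7*VV wL)^2+pE^7*(pE^7*VV wL)-sV := by rw [Vu_eq, sV]; ring
  rw [e]; exact sub_mem (add_mem (pow_mem O_Vw _) (mul_mem (pow_mem O_P _) O_Vw)) O_sV
lemma O_sgm (k : ℕ) {x : LL} (h : x ∈ OO) : sgm k x ∈ OO := IC_map (φ := VV.comp phB) (ψ := VV.comp phB) (sgm k) (fun r => sgm_VV k (phB r)) h
lemma O_un {x : LL} (h : VV x ∈ OO) : x ∈ IC phB := IC_unmap VV h
lemma phB_evS : IC phB ≤ IC evS := IC_trans fun r => by rw [← evS_psB]; exact IC_base _ _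
/-- integrality over the polynomial ring -/
def OC : Subring LL := IC (VV.comp evS)
lemma O_OC : OO ≤ OC := IC_trans fun r => by
  rw [RingHom.comp_apply, ← evS_psB]; exact IC_base (VV.comp evS) (psB r)
lemma OC_cc (z : ℂ) : cc z ∈ OC := by
  have := IC_base (VV.comp evS) (C z)
  rwa [RingHom.comp_apply, evS_C, VV_cc] at this
lemma OC_div {x : LL} (n : ℕ) (h : pE^n*x ∈ OC) : x ∈ OC := by
  have e : x = cc ((pp^n)⁻¹) * (pE^n*x) := by
    rw [map_inv₀, map_pow, ← pE, inv_mul_cancel_left₀ (pow_ne_zero _ pE_ne)]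
  rw [e]; exact mul_mem (OC_cc _) h
lemma OC_s : sL ∈ OC := OC_div 2 (O_OC O_s)
lemma OC_u : uL ∈ OC := OC_div 2 (O_OC O_u)
lemma OC_w : wL ∈ OC := OC_div 1 (by rw [pow_one]; exact (O_OC O_w))
lemma OC_sgm (k : ℕ) {x : LL} (h : x ∈ OC) : sgm k x ∈ OC := IC_map (φ := VV.comp evS) (ψ := VV.comp evS) (sgm k) (fun r => sgm_VV k (evS r)) h
lemma OC_un {x : LL} (h : VV x ∈ OC) : x ∈ IC evS := IC_unmap VV h
end

section
open Polynomial

abbrev mq : PowerSeries ℚ →+* PowerSeries ℂ := PowerSeries.map (algebraMap ℚ ℂ)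
lemma mq_inj : Function.Injective mq := PowerSeries.map_injective _ (algebraMap ℚ ℂ).injective
def iq : PowerSeries ℚ →+* LL := ii.comp mq
lemma iq_inj : Function.Injective iq := ii_inj.comp mq_inj
def iqF : FractionRing (PowerSeries ℚ) →+* LL := IsFractionRing.lift (A := PowerSeries ℚ) iq_inj
lemma iqF_alg (p) : iqF (algebraMap _ _ p) = iq p := IsFractionRing.lift_algebraMap iq_inj p
def QL : Subfield LL := iqF.fieldRange
lemma QL_iq (g : PowerSeries ℚ) : iq g ∈ QL := ⟨algebraMap _ _ g, iqF_alg g⟩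
lemma exlam : ∃ l : ℂ →ₗ[ℚ] ℚ, ∀ r : ℚ, l (algebraMap ℚ ℂ r) = r := by
  obtain ⟨l, hl⟩ := LinearMap.exists_leftInverse_of_injective (Algebra.linearMap ℚ ℂ) (LinearMap.ker_eq_bot.2 (algebraMap ℚ ℂ).injective)
  exact ⟨l, fun r => LinearMap.congr_fun hl r⟩
def lam : ℂ →ₗ[ℚ] ℚ := exlam.choose
lemma lam_q (r : ℚ) : lam (algebraMap ℚ ℂ r) = r := exlam.choose_spec r
lemma lam_mul (z : ℂ) (r : ℚ) : lam (z * algebraMap ℚ ℂ r) = lam z * r := by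
  rw [mul_comm, ← Algebra.smul_def, map_smul, smul_eq_mul, mul_comm]
def Lam (f : PowerSeries ℂ) : PowerSeries ℚ := PowerSeries.mk fun n => lam (PowerSeries.coeff n f)
lemma Lam_mul (f : PowerSeries ℂ) (b : PowerSeries ℚ) : Lam (f * mq b) = Lam f * b := by
  ext n
  rw [Lam, PowerSeries.coeff_mk, PowerSeries.coeff_mul, PowerSeries.coeff_mul, map_sum]
  refine Finset.sum_congr rfl fun p _ => ?_
  rw [PowerSeries.coeff_map, lam_mul, Lam, PowerSeries.coeff_mk]
lemma Lam_add (f g : PowerSeries ℂ) : Lam (f + g) = Lam f + Lam g := by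
  ext n; simp [Lam]
lemma Lam_mq (b : PowerSeries ℚ) : Lam (mq b) = b := by
  ext n; rw [Lam, PowerSeries.coeff_mk, PowerSeries.coeff_map, lam_q]
lemma Lam_C (z : ℂ) : Lam (PowerSeries.C z) = PowerSeries.C (lam z) := by
  ext n; rw [Lam, PowerSeries.coeff_mk, PowerSeries.coeff_C, PowerSeries.coeff_C]; split_ifs <;> simp
lemma QL_ex (f : PowerSeries ℂ) (h : ii f ∈ QL) : f = mq (Lam f) := by
  obtain ⟨z, hz⟩ := h
  obtain ⟨a, b, hb, rfl⟩ := IsFractionRing.div_surjective (A := PowerSeries ℚ) z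
  have hb0 : b ≠ 0 := nonZeroDivisors.ne_zero hb
  rw [map_div₀, iqF_alg, iqF_alg] at hz
  have hb1 : iq b ≠ 0 := (map_ne_zero_iff iq iq_inj).2 hb0
  rw [div_eq_iff hb1, iq, RingHom.comp_apply, RingHom.comp_apply, ← map_mul] at hz
  have h1 := ii_inj hz
  have h2 := congrArg Lam h1
  rw [Lam_mul, Lam_mq] at h2
  have h3 : mq b ≠ 0 := (map_ne_zero_iff mq mq_inj).2 hb0
  apply mul_right_cancel₀ h3
  rw [← h1, h2, map_mul]
def eQ : ℚ[X] →+* LL := evS.comp (mapRingHom (algebraMap ℚ ℂ))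
lemma ratl (b : PowerSeries ℚ) (hs : ∃ sq, sL = iq sq) (c : ℂ[X]) : ∃ (F : PowerSeries ℂ) (c' : ℚ[X]), ii F = evS c * iq b ∧ iq (Lam F) = eQ c' * iq b := by
  obtain ⟨sq, hs⟩ := hs
  induction c using Polynomial.induction_on' with
  | add p r hp hr =>
    obtain ⟨F, c, h1, h2⟩ := hp
    obtain ⟨G, d, h3, h4⟩ := hr
    refine ⟨F+G, c+d, ?_, ?_⟩
    · rw [map_add, map_add, h1, h3, add_mul]
    · rw [Lam_add, map_add, map_add, h2, h4, add_mul]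
  | monomial n z =>
    refine ⟨PowerSeries.C z * mq (sq^n*b), C (lam z) * X^n, ?_, ?_⟩
    · have e : evS (C z * X^n) = cc z * sL^n := by rw [map_mul, map_pow, evS_C, evS_X]
      rw [← C_mul_X_pow_eq_monomial, e, hs, iq, RingHom.comp_apply, RingHom.comp_apply, ← map_pow, cc, RingHom.comp_apply, map_mul, map_mul mq, map_mul ii, map_pow mq, mul_assoc]
    · rw [Lam_mul, Lam_C, map_mul, map_mul, map_pow, ← hs, eQ, RingHom.comp_apply, map_mul, map_pow, coe_mapRingHom, map_X, map_C, map_mul, map_pow, evS_C, evS_X, mul_assoc, iq, RingHom.comp_apply, PowerSeries.map_C]; rfl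
lemma QL_q : q ∈ QL := by
  have := QL_iq PowerSeries.X
  rwa [iq, RingHom.comp_apply, PowerSeries.map_X] at this

lemma QL_j (b : ℕ) : j b ∈ QL := by
  have := QL_iq (PowerSeries.map (Int.castRingHom ℚ) (J b))
  have e : mq (PowerSeries.map (Int.castRingHom ℚ) (J b)) = JC b := by
    ext n; simp [JC]
  rwa [iq, RingHom.comp_apply, e] at this
lemma QL_tt : tt ∈ QL := div_mem (pow_mem (QL_j _) _) (mul_mem QL_q (pow_mem (QL_j _) _))
lemma QL_xi : xi ∈ QL := div_mem (QL_j _) (mul_mem (pow_mem QL_q _) (QL_j _))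
lemma QL_aa : aa ∈ QL := mul_mem QL_q (pow_mem (div_mem (mul_mem (QL_j _) (QL_j _)) (mul_mem (QL_j _) (QL_j _))) _)
lemma QL_bb : bb ∈ QL := div_mem (pow_mem (div_mem (mul_mem (QL_j _) (QL_j _)) (mul_mem (QL_j _) (QL_j _))) _) QL_q
lemma QL_s : sL ∈ QL := inv_mem QL_tt
lemma QL_u : uL ∈ QL := mul_mem QL_s QL_aa
lemma QL_w : wL ∈ QL := sub_mem QL_u (mul_mem QL_s QL_bb)
lemma QL_C (r : ℚ) : cc (algebraMap ℚ ℂ r) ∈ QL := by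
  have := QL_iq (PowerSeries.C r)
  rwa [iq, RingHom.comp_apply, PowerSeries.map_C] at this
lemma LD_iq {x : LL} {n : ℕ} {c : ℂ} (h : LD x n c) (hx : x ∈ QL) : ∃ g, x = iq g := by
  obtain ⟨f, hf, rfl⟩ := h
  have e : q^(n:ℤ) * ii f = ii (PowerSeries.X^n*f) := by rw [zpow_natCast, map_mul, map_pow, q]
  rw [e] at hx ⊢
  exact ⟨_, congrArg ii (QL_ex _ hx)⟩
lemma iq_s : ∃ g, sL = iq g := LD_iq (n := 1) sL_LD QL_s
lemma iq_w : ∃ g, wL = iq g := LD_iq (n := 0) wL_LD QL_w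
lemma iq_u : ∃ g, uL = iq g := LD_iq (n := 2) uL_LD QL_u
lemma QR (g : PowerSeries ℂ) (hR : ii g ∈ ev.range) (hQ : ii g ∈ QL) : ∃ c d e : ℚ[X], ii g = eQ c + eQ d * wL + eQ e * uL := by
  obtain ⟨c, d, e, h⟩ := R_form _ hR
  obtain ⟨wq, hw⟩ := iq_w
  obtain ⟨uq, hu⟩ := iq_u
  obtain ⟨F1, c', h1, h1'⟩ := ratl 1 iq_s c
  obtain ⟨F2, d', h2, h2'⟩ := ratl wq iq_s d
  obtain ⟨F3, e', h3, h3'⟩ := ratl uq iq_s e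
  refine ⟨c', d', e', ?_⟩
  rw [map_one, mul_one] at h1 h1'
  rw [← hw] at h2 h2'
  rw [← hu] at h3 h3'
  rw [← h1, ← h2, ← h3, ← map_add, ← map_add] at h
  have h4 := ii_inj h
  have h5 : ii g = iq (Lam g) := congrArg ii (QL_ex g hQ)
  rw [h5, h4, Lam_add, Lam_add, map_add, map_add, h1', h2', h3']
lemma QL_UU (f : PowerSeries ℂ) (h : ii f ∈ QL) : ii (UU f) ∈ QL := by
  have := QL_iq (PowerSeries.mk fun n => PowerSeries.coeff (7*n) (Lam f))
  have e : mq (PowerSeries.mk fun n => PowerSeries.coeff (7*n) (Lam f)) = UU f := by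
    ext n
    rw [PowerSeries.coeff_map, PowerSeries.coeff_mk, UU, PowerSeries.coeff_mk]
    conv_rhs => rw [QL_ex f h]
    rw [PowerSeries.coeff_map]
  rwa [iq, RingHom.comp_apply, e] at this
lemma eQ_QL (c : ℚ[X]) : eQ c ∈ QL := by
  induction c using Polynomial.induction_on' with
  | add p r hp hr => rw [map_add]; exact add_mem hp hr
  | monomial n z =>
    rw [← C_mul_X_pow_eq_monomial, eQ, RingHom.comp_apply, map_mul, map_pow, coe_mapRingHom, map_X, map_C, map_mul, map_pow, evS_C, evS_X]
    exact mul_mem (QL_C _) (pow_mem QL_s _)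
lemma LD_evS (p : ℂ[X]) : LD (evS p) 0 (p.coeff 0) := by
  induction p using Polynomial.induction_on' with
  | add p r hp hr => rw [map_add, coeff_add]; exact hp.add hr
  | monomial n z =>
    have e : evS (monomial n z) = cc z * sL^n := by rw [← C_mul_X_pow_eq_monomial, map_mul, map_pow, evS_C, evS_X]
    rw [e, coeff_monomial]
    rcases Nat.eq_zero_or_pos n with rfl | hn
    · simpa using LD_cc z
    · rw [if_neg hn.ne']
      exact (((LD_cc z).mul (sL_LD.pow n)).low 0 (by simpa using hn))
lemma LD_form (c d e : ℂ[X]) : LD (evS c + evS d * wL + evS e * uL) 0 (c.coeff 0 - d.coeff 0) :=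
  (((LD_evS c).add (((LD_evS d).mul wL_LD).cast (add_zero 0) rfl)).add (((LD_evS e).mul uL_LD).low 0 (by norm_num))).cast rfl (by ring)

lemma eQ_coeff (c : ℚ[X]) (k : ℕ) : ((c.map (algebraMap ℚ ℂ)).coeff k) = ((c.coeff k : ℚ) : ℂ) := by
  rw [coeff_map, eq_ratCast]
lemma NBD (D : ℤ) (c d e : ℂ[X]) (h : cc (pp^D) * (evS c + evS d * wL + evS e * uL) ∈ IC phB) (k : ℕ) :
    VA (14*k-D) (c.coeff k) ∧ VA (14*k+7-D) (d.coeff k) ∧ VA (14*k+14-D) (e.coeff k) := by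
  have e1 : cc (pp^D) * (evS c + evS d * wL + evS e * uL) = evS (C (pp^D)*c) + evS (C (pp^D)*d) * wL + evS (C (pp^D)*e) * uL := by
    rw [map_mul, map_mul, map_mul, evS_C]; ring
  rw [e1] at h
  obtain ⟨h1, h2, h3⟩ := NB _ _ _ h k
  rw [coeff_C_mul] at h1 h2 h3
  have P := VA_pp (-D)
  have n0 : pp^D ≠ 0 := zpow_ne_zero _ pp_ne
  refine ⟨(h1.mul P).cast (by ring) ?_, (h2.mul P).cast (by ring) ?_, (h3.mul P).cast (by ring) ?_⟩ <;>
  · rw [zpow_neg]; field_simp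
lemma MAIN (f : PowerSeries ℂ) (hQ : ii f ∈ QL) (hE : ii f ∈ EE) (D : ℤ) (hO : cc (pp^D) * ii f ∈ OO) :
    ∃ c d e : ℚ[X], ii (UU f) = eQ c + eQ d * wL + eQ e * uL ∧ ∀ k : ℕ, VA (14*k-(D+8)) (c.coeff k : ℚ) ∧
      VA (14*k+7-(D+8)) (d.coeff k : ℚ) ∧ VA (14*k+14-(D+8)) (e.coeff k : ℚ) := by
  have hz : cc (pp^(D+8)) * ii (UU f) ∈ IC phB := by
    apply O_un
    have e : VV (cc (pp^(D+8)) * ii (UU f)) = ∑ k ∈ Finset.range 7, sgm k (cc (pp^D) * ii f) := by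
      simp only [map_mul (sgm _), sgm_cc]
      rw [← Finset.mul_sum, sum_sgm, map_mul, VV_cc, ← mul_assoc]
      congr 1
      rw [zpow_add₀ pp_ne, map_mul]; congr 1
      rw [show pp^(8:ℤ) = pp^8 from by norm_cast, pp8, map_ofNat]
    rw [e]; exact sum_mem fun k _ => O_sgm k hO
  have hi : ii (UU f) ∈ IC evS := by
    have e : ii (UU f) = evS (C (pp^(-(D+8)))) * (cc (pp^(D+8)) * ii (UU f)) := by
      rw [evS_C, ← mul_assoc, ← map_mul, ← zpow_add₀ pp_ne, neg_add_cancel, zpow_zero, map_one, one_mul]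
    rw [e]; exact mul_mem (IC_base _ _) (phB_evS hz)
  obtain ⟨c, d, e, h⟩ := QR _ (NA' _ (UU_K f hE) hi) (QL_UU f hQ)
  refine ⟨c, d, e, h, fun k => ?_⟩
  rw [h] at hz
  have := NBD (D+8) _ _ _ hz k
  simpa only [coe_mapRingHom, eQ_coeff] using this
end

section
open Polynomial

def LatM (m : ℤ) (y : LL) : Prop := ∃ c d e : ℚ[X], y = eQ c + eQ d * wL + eQ e * uL ∧
  (∀ k : ℕ, VA (8*(k+m)) (c.coeff k : ℚ)) ∧ (∀ k : ℕ, VA (8*(k+m)) (d.coeff k : ℚ)) ∧ (∀ k : ℕ, VA (8*(k+(m+1))) (e.coeff k : ℚ)) ∧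
  c.coeff 0 = d.coeff 0
def LatN (m : ℤ) (y : LL) : Prop := ∃ c d e : ℚ[X], y = eQ c + eQ d * wL + eQ e * uL ∧
  (∀ k : ℕ, VA (8*(k+m)) (c.coeff k : ℚ)) ∧ (∀ k : ℕ, VA (8*(k+m)) (d.coeff k : ℚ)) ∧ (∀ k : ℕ, VA (8*(k+(m+1))) (e.coeff k : ℚ)) ∧
  c.coeff 0 = 0 ∧ d.coeff 0 = 0
lemma eQ_C (r : ℚ) : eQ (C r) = cc r := by
  rw [eQ, RingHom.comp_apply, coe_mapRingHom, map_C, evS_C, eq_ratCast]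
lemma eQ_X : eQ X = sL := by
  rw [eQ, RingHom.comp_apply, coe_mapRingHom, map_X, evS_X]
lemma eQ_sum (c : ℚ[X]) : eQ c = ∑ k ∈ Finset.range (c.natDegree+1), cc (c.coeff k : ℚ) * sL^k := by
  conv_lhs => rw [as_sum_range_C_mul_X_pow c, map_sum]
  simp only [map_mul, map_pow, eQ_C, eQ_X]
lemma O_eQ (c : ℚ[X]) (m : ℤ) (h : ∀ k : ℕ, VA (8*(k+m)) (c.coeff k : ℚ)) : cc (pp^(-(8*m))) * eQ c ∈ OO := by
  rw [eQ_sum, Finset.mul_sum]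
  refine sum_mem fun k _ => ?_
  have e : cc (pp^(-(8*m))) * (cc (c.coeff k : ℚ) * sL^k) = cc ((c.coeff k : ℚ) * pp^(-(8*(k+m)))) * (pE^6*(pE^2*sL))^k := by
    have : pp^(-(8*m)) = pp^(-(8*((k:ℤ)+m))) * (pp^8)^k := by
      rw [← pow_mul, ← zpow_natCast, ← zpow_add₀ pp_ne]; congr 1; push_cast; ring
    rw [this, map_mul, map_mul, map_pow, map_pow, pE]; ring
  rw [e]
  exact mul_mem (O_A (h k)) (pow_mem (mul_mem (pow_mem O_P _) O_s) _)
lemma EE_eQ (c : ℚ[X]) : eQ c ∈ EE := EE_evS _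
lemma K_evS (p : ℂ[X]) : evS p ∈ KK := by
  change eval₂ cc sL p ∈ _
  rw [eval₂_eq_sum_range]
  exact sum_mem fun i _ => mul_mem (K_cc _) (pow_mem K_s _)
lemma OC_evS (p : ℂ[X]) : evS p ∈ OC := by
  change eval₂ cc sL p ∈ _
  rw [eval₂_eq_sum_range]
  exact sum_mem fun i _ => mul_mem (OC_cc _) (pow_mem OC_s _)
lemma LD_formQ (c d e : ℚ[X]) : LD (eQ c + eQ d * wL + eQ e * uL) 0 ((c.coeff 0 : ℚ) - (d.coeff 0 : ℚ) : ℂ) := by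
  have := LD_form (c.map (algebraMap ℚ ℂ)) (d.map (algebraMap ℚ ℂ)) (e.map (algebraMap ℚ ℂ))
  rwa [eQ_coeff, eQ_coeff] at this
lemma cst (f : PowerSeries ℂ) (h : LD (ii f) 0 0) (c d e : ℚ[X]) (hf : ii (UU f) = eQ c + eQ d * wL + eQ e * uL) : c.coeff 0 = d.coeff 0 := by
  have h1 := LD_ii (UU f)
  have h2 : PowerSeries.constantCoeff (UU f) = 0 := by
    rw [← (LD_ii f).uniq h, ← PowerSeries.coeff_zero_eq_constantCoeff_apply, UU, PowerSeries.coeff_mk, ← PowerSeries.coeff_zero_eq_constantCoeff_apply]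
  rw [h2, hf] at h1
  have h3 := (LD_formQ c d e).uniq h1
  rw [sub_eq_zero] at h3
  exact_mod_cast h3
lemma c0_zero (f : PowerSeries ℂ) (y : LL) (hy : y ∈ OC) (hf : ii f = sL*(uL-wL)*y) (hE : ii f ∈ EE) (c d e : ℚ[X])
    (h : ii (UU f) = eQ c + eQ d * wL + eQ e * uL) : c.coeff 0 = 0 := by
  set r := ii (UU f) with hr
  have h1 : (ii f)^7*VV tt ∈ OC := by
    have e1 : (ii f)^7*VV tt = Xi^4*(uL-wL)^7*y^7 := by
      rw [hf, Xi, mul_pow, mul_pow, mul_pow, xi4]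
      linear_combination (-(sL^7*VV tt*(uL-wL)^7*y^7))*t_s
    rw [e1]
    exact mul_mem (mul_mem (pow_mem (O_OC O_Xi) _) (pow_mem (sub_mem OC_u OC_w) _)) (pow_mem hy _)
  have h2 : ∀ k, (sgm k (ii f))^7*VV tt ∈ OC := by
    intro k
    have := OC_sgm k h1
    rwa [map_mul, map_pow, sgm_VV] at this
  have h3 : ∀ p : Fin 7 → Fin 7, (∏ i, sgm (p i) (ii f)) * VV tt ∈ OC := by
    intro p
    refine IC_pow (φ := VV.comp evS) 7 (by norm_num) ?_
    have e1 : ((∏ i, sgm (p i) (ii f)) * VV tt)^7 = ∏ i, ((sgm (p i) (ii f))^7*VV tt) := by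
      rw [mul_pow, Finset.prod_mul_distrib, Finset.prod_pow]; simp
    rw [e1]
    exact prod_mem (S := OC) fun i _ => h2 _
  have h4 : VV ((7*r)^7*tt) ∈ OC := by
    have e1 : VV ((7*r)^7*tt) = ∑ p : Fin 7 → Fin 7, (∏ i, sgm (p i) (ii f)) * VV tt := by
      rw [map_mul, map_pow, map_mul, map_ofNat VV 7, hr, ← sum_sgm, ← Finset.sum_mul, ← Fin.sum_univ_eq_sum_range (fun k => sgm k (ii f)), Fintype.sum_pow]
    rw [e1]; exact sum_mem fun p _ => h3 p
  have h5 : r^7*tt ∈ IC evS := by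
    have e1 : r^7*tt = evS (C (1/7^7)) * ((7*r)^7*tt) := by
      rw [evS_C, map_div₀, map_one, map_pow, map_ofNat cc 7]; field_simp
    rw [e1]; exact mul_mem (IC_base _ _) (OC_un h4)
  obtain ⟨G, hG⟩ := NA' _ (mul_mem (pow_mem (UU_K f hE) 7) K_tt) h5
  set c1 := c.map (algebraMap ℚ ℂ) with hc1
  set d1 := d.map (algebraMap ℚ ℂ) with hd1
  set e1 := e.map (algebraMap ℚ ℂ) with he1
  have h' : r = evS c1 + evS d1 * wL + evS e1 * uL := h
  let R : ℂ[X][X] := C c1 + C d1 * X + C e1 * (X^2+X-C X)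
  have hR : ev R = r := by
    simp only [R, map_add, map_mul, map_sub, map_pow, ev_C, ev_X, evS_X]
    rw [h', u_eq]
  have h6 : ev (R^7 - C X * G) = 0 := by
    rw [map_sub, map_pow, map_mul, hR, hG, ev_C, evS_X]
    linear_combination (-r^7)*t_s
  obtain ⟨H, hH⟩ := ev_dvd _ h6
  have h7 := congrArg (fun p => eval 0 (eval 0 p)) hH
  simp only [R, Phi, eval_sub, eval_pow, eval_add, eval_mul, eval_C, eval_X] at h7
  norm_num at h7
  have h8 : c1.coeff 0 = 0 := by rw [coeff_zero_eq_eval_zero]; exact h7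
  rw [hc1, eQ_coeff] at h8
  exact_mod_cast h8
lemma T0 (m : ℤ) (y : LL) (hy : LatM m y) (f : PowerSeries ℂ) (hf : ii f = sL*(uL-wL)*y) : LatN m (ii (UU f)) := by
  obtain ⟨c, d, e, rfl, h1, h2, h3, h4⟩ := hy
  have hE : ii f ∈ EE := by
    rw [hf]; exact mul_mem (mul_mem EE_s (sub_mem EE_u EE_w)) (add_mem (add_mem (EE_eQ _) (mul_mem (EE_eQ _) EE_w)) (mul_mem (EE_eQ _) EE_u))
  have hQ : ii f ∈ QL := by
    rw [hf]; exact mul_mem (mul_mem QL_s (sub_mem QL_u QL_w)) (add_mem (add_mem (eQ_QL _) (mul_mem (eQ_QL _) QL_w)) (mul_mem (eQ_QL _) QL_u))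
  have hC : eQ c + eQ d * wL + eQ e * uL ∈ OC :=
    add_mem (add_mem (OC_evS _) (mul_mem (OC_evS _) OC_w)) (mul_mem (OC_evS _) OC_u)
  have hO : cc (pp^(5-8*m)) * ii f ∈ OO := by
    have e1 : cc (pp^(5-8*m)) * ii f = ((pE^2*sL)*(pE^2*uL-pE*(pE*wL))) * (pE*(cc (pp^(-(8*m))) * eQ c) + (cc (pp^(-(8*m))) * eQ d)*(pE*wL)
       + pE*(cc (pp^(-(8*(m+1)))) * eQ e) * (pE^6*(pE^2*uL))) := by
      have a1 : pp^(5-8*m) = pp^(-(8*m)) * pp^5 := by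
        rw [← zpow_natCast, ← zpow_add₀ pp_ne]; congr 1; push_cast; ring
      have a2 : pp^(-(8*m)) = pp^(-(8*(m+1))) * pp^8 := by
        rw [← zpow_natCast, ← zpow_add₀ pp_ne]; congr 1; push_cast; ring
      rw [hf, a1, a2, map_mul, map_mul, map_pow, map_pow, ← pE]; ring
    rw [e1]
    refine mul_mem (mul_mem O_s (sub_mem O_u (mul_mem O_P O_w))) (add_mem (add_mem (mul_mem O_P (O_eQ c m h1)) (mul_mem (O_eQ d m h2) O_w)) (mul_mem (mul_mem O_P (O_eQ e (m+1) h3)) (mul_mem (pow_mem O_P _) O_u)))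
  have hL : LD (ii f) 0 0 := by
    rw [hf]
    exact ((sL_LD.mul ((uL_LD.low 0 (by norm_num)).sub wL_LD)).mul (LD_formQ c d e)).low 0 (by norm_num)
  obtain ⟨c', d', e', k0, k⟩ := MAIN f hQ hE _ hO
  have z1 := cst f hL _ _ _ k0
  have z2 := c0_zero f _ hC hf hE _ _ _ k0
  have z3 : d'.coeff 0 = 0 := by rw [← z1, z2]
  refine ⟨c', d', e', k0, ?_, ?_, ?_, z2, z3⟩
  · intro i
    rcases i with _ | i
    · rw [z2, Rat.cast_zero]; exact VA_zero _
    · exact VA_round _ _ _ (k (i+1)).1 (by push_cast; linarith)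
  · intro i
    exact VA_round _ _ _ (k i).2.1 (by linarith)
  · intro i
    exact VA_round _ _ _ (k i).2.2 (by linarith)
lemma O_8 : cc (((8:ℤ):ℂ)⁻¹) ∈ OO := O_A (int_unit 8 (by decide))
lemma O_sb : pE^2*(sL/bb) ∈ OO := by
  have e : pE^2*(sL/bb) = cc (((8:ℤ):ℂ)⁻¹) * (pE^2*uL - pE^8*(pE^2*sL)-pE^7*(pE^2*sL)*(pE*wL)) := by
    have h := s_b
    rw [pE8] at h
    rw [map_inv₀, show cc ((8:ℤ):ℂ) = 8 by push_cast; rw [map_ofNat]]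
    linear_combination pE^2/8*h
  rw [e]
  exact mul_mem O_8 (sub_mem (sub_mem O_u (mul_mem (pow_mem O_P _) O_s)) (mul_mem (mul_mem (pow_mem O_P _) O_s) O_w))
lemma O_ub : pE^2*(uL/bb) ∈ OO := by
  have e : pE^2*(uL/bb) = cc (((8:ℤ):ℂ)⁻¹) * ((pE*wL+pE)^2 - pE^2*uL) := by
    have h := u_b
    rw [map_inv₀, show cc ((8:ℤ):ℂ) = 8 by push_cast; rw [map_ofNat]]
    linear_combination pE^2/8*h
  rw [e]
  exact mul_mem O_8 (sub_mem (pow_mem (add_mem O_w O_P) _) O_u)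
def hL : LL := xi*sL^2/bb
lemma hL_LD : LD hL 1 1 := ((xi_LD.mul (sL_LD.pow 2)).div bb_LD one_ne_zero).cast (by norm_num) (by norm_num)
lemma EE_h : hL ∈ EE := div_mem (mul_mem EE_xi (pow_mem EE_s _)) EE_b
lemma QL_h : hL ∈ QL := div_mem (mul_mem QL_xi (pow_mem QL_s _)) QL_bb
lemma divX_eQ (c : ℚ[X]) (h : c.coeff 0 = 0) : eQ c = sL * eQ (divX c) := by
  conv_lhs => rw [← X_mul_divX_add c, h, C_0, add_zero, map_mul, eQ_X]
lemma T1 (m : ℤ) (y : LL) (hy : LatN m y) (f : PowerSeries ℂ) (hf : ii f = hL*y) : LatM (m+1) (ii (UU f)) := by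
  obtain ⟨c, d, e, rfl, h1, h2, h3, h4, h5⟩ := hy
  have hE : ii f ∈ EE := by
    rw [hf]; exact mul_mem EE_h (add_mem (add_mem (EE_eQ _) (mul_mem (EE_eQ _) EE_w)) (mul_mem (EE_eQ _) EE_u))
  have hQ : ii f ∈ QL := by
    rw [hf]; exact mul_mem QL_h (add_mem (add_mem (eQ_QL _) (mul_mem (eQ_QL _) QL_w)) (mul_mem (eQ_QL _) QL_u))
  have hLD : LD (ii f) 0 0 := by
    rw [hf]
    exact (hL_LD.mul (LD_formQ c d e)).low 0 (by norm_num)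
  have g1 := O_eQ (divX c) (m+1) (fun k => by rw [coeff_divX]; exact (h1 (k+1)).cast (by push_cast; ring) rfl)
  have g2 := O_eQ (divX d) (m+1) (fun k => by rw [coeff_divX]; exact (h2 (k+1)).cast (by push_cast; ring) rfl)
  have g3 := O_eQ e (m+1) h3
  have hO : cc (pp^(-5-8*m)) * ii f ∈ OO := by
    have e1 : cc (pp^(-5-8*m)) * ii f = Xi*(pE*(pE^2*(sL/bb))*(cc (pp^(-(8*(m+1)))) * eQ (divX c)) + (pE^2*(sL/bb))*(pE*wL)*(cc (pp^(-(8*(m+1)))) * eQ (divX d))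
        + pE*(pE^2*(uL/bb))*(cc (pp^(-(8*(m+1)))) * eQ e)) := by
      have a1 : pp^(-5-8*m) = pp^(-(8*(m+1))) * pp^3 := by
        rw [← zpow_natCast, ← zpow_add₀ pp_ne]; congr 1; push_cast; ring
      rw [hf, a1, map_mul, map_pow, ← pE, divX_eQ c h4, divX_eQ d h5, hL, Xi]; ring
    rw [e1]
    exact mul_mem O_Xi (add_mem (add_mem (mul_mem (mul_mem O_P O_sb) g1) (mul_mem (mul_mem O_sb O_w) g2)) (mul_mem (mul_mem O_P O_ub) g3))
  obtain ⟨c', d', e', k0, k⟩ := MAIN f hQ hE _ hO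
  have z1 := cst f hLD _ _ _ k0
  have kd : ∀ i : ℕ, VA (8*(i+(m+1))) (d'.coeff i : ℚ) := fun i =>
    VA_round _ _ _ (k i).2.1 (by linarith)
  refine ⟨c', d', e', k0, ?_, kd, ?_, z1⟩
  · intro i
    rcases i with _ | i
    · rw [z1]; exact kd 0
    · exact VA_round _ _ _ (k (i+1)).1 (by push_cast; linarith)
  · intro i
    exact VA_round _ _ _ (k i).2.2 (by linarith)
end

section
open Polynomial

lemma h4 : (VV sL*hL^2)^2 = VV sL*(sL^3*(sL/bb)^4) := by
  have e : (VV sL*hL^2)^2 = (VV sL)^2*xi^4*sL^8/bb^4 := by rw [hL]; ring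
  rw [e, xi4]
  linear_combination (VV sL*sL^7/bb^4)*(VT_s * (tt*sL) + t_s)
lemma O_h1 : pE^14*(VV sL*hL^2) ∈ OO := by
  refine IC_pow (φ := VV.comp phB) 2 (by norm_num) ?_
  have e : (pE^14*(VV sL*hL^2))^2 = sV*((pE^2*sL)^3*(pE^2*(sL/bb))^4) := by
    rw [mul_pow, h4, sV]; ring
  rw [e]; change _ ∈ OO; exact mul_mem O_sV (mul_mem (pow_mem O_s _) (pow_mem O_sb _))
lemma Vu2 : (VV uL)^2 = VV sL*((VV wL+1)^2+7*VV uL*(VV wL+1)-VV uL) := by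
  have h := congrArg VV u_sq
  simpa only [map_sub, map_add, map_mul, map_pow, map_one, map_ofNat VV 7] using h
lemma O_h2 : pE^14*((VV sL+VV uL)*hL^2) ∈ OO := by
  refine IC_pow (φ := VV.comp phB) 2 (by norm_num) ?_
  have hs : VV sL ≠ 0 := (map_ne_zero VV).2 sL_ne
  have e0 : ((VV sL+VV uL)*hL^2)^2 = (VV sL+2*VV uL+((VV wL+1)^2+7*VV uL*(VV wL+1)-VV uL))*(sL^3*(sL/bb)^4) := by
    apply mul_left_cancel₀ (pow_ne_zero 2 hs)
    have := h4
    linear_combination (VV sL+VV uL)^2*h4 + VV sL*(sL^3*(sL/bb)^4)*Vu2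
  have e : (pE^14*((VV sL+VV uL)*hL^2))^2 = (sV+2*(pE^14*VV uL)+((pE^7*VV wL+pE^7)^2+(pE*(pE^14*VV uL)*(pE^7*VV wL+pE^7))-pE^14*VV uL))*((pE^2*sL)^3*(pE^2*(sL/bb))^4) := by
    rw [mul_pow, e0, sV, pE8]; ring
  rw [e]
  have U := O_Vu; have W := add_mem O_Vw (pow_mem O_P 7)
  change _ ∈ OO; exact mul_mem (add_mem (add_mem O_sV (mul_mem (O_n 2) U)) (sub_mem (add_mem (pow_mem W 2) (mul_mem (mul_mem O_P U) W)) U)) (mul_mem (pow_mem O_s _) (pow_mem O_sb _))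
lemma sqsum (z : LL) (f : PowerSeries ℂ) (h : pE^14*(VV z*(ii f)^2) ∈ OO) : pE^14*(z*(7*ii (UU f))^2) ∈ IC phB := by
  apply O_un
  have h1 : ∀ k, pE^14*(VV z*(sgm k (ii f))^2) ∈ OO := by
    intro k
    have := O_sgm k h
    rwa [pE, map_mul, map_pow, sgm_cc, map_mul, map_pow, sgm_VV] at this
  have e : VV (pE^14*(z*(7*ii (UU f))^2)) = ∑ k ∈ Finset.range 7, ∑ l ∈ Finset.range 7, pE^14*(VV z*(sgm k (ii f) * sgm l (ii f))) := by
    rw [pE, map_mul, map_mul, map_pow, map_pow, VV_cc, map_mul, map_ofNat VV 7, ← sum_sgm, pow_two (∑ k ∈ _, _), Finset.sum_mul_sum]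
    simp only [Finset.mul_sum]
  rw [e]
  refine sum_mem fun k _ => sum_mem fun l _ => ?_
  refine IC_pow (φ := VV.comp phB) 2 (by norm_num) ?_
  have e : (pE^14*(VV z*(sgm k (ii f) * sgm l (ii f))))^2 = (pE^14*(VV z*(sgm k (ii f))^2))*(pE^14*(VV z*(sgm l (ii f))^2)) := by ring
  rw [e]; change _ ∈ OO; exact mul_mem (h1 k) (h1 l)
lemma sqint (z y : LL) (h : pE^14*(z*y^2) ∈ IC phB) (hz : pE^14*z ∈ IC phB) : pE^14*(z*y) ∈ IC phB := by
  refine IC_pow 2 (by norm_num) ?_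
  have e : (pE^14*(z*y))^2 = (pE^14*z)*(pE^14*(z*y^2)) := by ring
  rw [e]; exact mul_mem hz h
lemma toR (y : LL) (hy : y ∈ KK) (h : pE^14*y ∈ IC phB) : y ∈ ev.range := by
  refine NA' y hy ?_
  have e : y = evS (C ((pp^14)⁻¹)) * (pE^14*y) := by
    rw [evS_C, map_inv₀, map_pow, ← pE, inv_mul_cancel_left₀ (pow_ne_zero _ pE_ne)]
  rw [e]; exact mul_mem (IC_base _ _) (phB_evS h)
lemma T2 (f : PowerSeries ℂ) (hf : ii f = hL) : LatM 0 (ii (UU f)) := by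
  have hE : ii f ∈ EE := by rw [hf]; exact EE_h
  have hQ : ii f ∈ QL := by rw [hf]; exact QL_h
  have hLD : LD (ii f) 0 0 := by
    rw [hf]; exact hL_LD.low 0 (by norm_num)
  have kU := UU_K f hE
  set y := 7*ii (UU f) with hy
  have ky : y ∈ KK := mul_mem (K_ofNat 7) kU
  have hs2 := sqsum sL f (by rw [hf]; exact O_h1)
  have hv2 := sqsum (sL+uL) f (by rw [hf, map_add]; exact O_h2)
  rw [← hy] at hs2 hv2
  have hs1 := sqint _ _ hs2 (O_un (by rw [pE, map_mul, map_pow, VV_cc]; exact O_sV))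
  have hv1 := sqint _ _ hv2 (O_un (by
    rw [pE, map_mul, map_pow, VV_cc, map_add, mul_add]; exact add_mem O_sV O_Vu))
  have kv : sL+uL ∈ KK := add_mem K_s K_u
  have r1 := toR _ (mul_mem kv ky) hv1
  have r2 := toR _ (mul_mem kv (pow_mem ky 2)) hv2
  have e : sL+uL = wL*(wL+1) := by rw [u_eq]; ring
  rw [e] at r1 r2
  have r := NA2 y r1 r2
  have r' : ii (UU f) ∈ ev.range := by
    have e : ii (UU f) = cc (1/7) * y := by rw [hy, map_div₀, map_one, map_ofNat]; field_simp
    rw [e]; exact mul_mem (R_cc _) r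
  obtain ⟨c, d, e, h⟩ := QR _ r' (QL_UU f hQ)
  have hN : cc (pp^(22:ℤ)) * (evS (X*c.map (algebraMap ℚ ℂ)) + evS (X*d.map (algebraMap ℚ ℂ)) * wL + evS (X*e.map (algebraMap ℚ ℂ)) * uL) ∈ IC phB := by
    have e1 : cc (pp^(22:ℤ)) * (evS (X*c.map (algebraMap ℚ ℂ)) + evS (X*d.map (algebraMap ℚ ℂ)) * wL + evS (X*e.map (algebraMap ℚ ℂ)) * uL) = pE^14*(sL*y) := by
      have h' : ii (UU f) = evS (c.map (algebraMap ℚ ℂ)) + evS (d.map (algebraMap ℚ ℂ)) * wL + evS (e.map (algebraMap ℚ ℂ)) * uL := h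
      rw [hy, h', pE8, map_mul, map_mul, map_mul, evS_X, show pp^(22:ℤ) = pp^22 by norm_cast, map_pow, pE]; ring
    rw [e1]; exact hs1
  have k : ∀ k : ℕ, VA (14*k-8) (c.coeff k : ℚ) ∧ VA (14*k-1) (d.coeff k : ℚ) ∧ VA (14*k+6) (e.coeff k : ℚ) := by
    intro k
    have := NBD 22 _ _ _ hN (k+1)
    rw [coeff_X_mul, coeff_X_mul, coeff_X_mul, eQ_coeff, eQ_coeff, eQ_coeff] at this
    exact ⟨this.1.cast (by push_cast; ring) rfl, this.2.1.cast (by push_cast; ring) rfl, this.2.2.cast (by push_cast; ring) rfl⟩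
  have z1 := cst f hLD _ _ _ h
  have kd : ∀ i : ℕ, VA (8*(i+0)) (d.coeff i : ℚ) := fun i =>
    VA_round _ _ _ (k i).2.1 (by linarith)
  refine ⟨c, d, e, h, ?_, kd, ?_, z1⟩
  · intro i
    rcases i with _ | i
    · rw [z1]; exact kd 0
    · exact VA_round _ _ _ (k (i+1)).1 (by push_cast; linarith)
  · intro i
    exact VA_round _ _ _ (k i).2.2 (by linarith)
end

open PowerSeries

def iZ : PowerSeries ℤ →+* LL := ii.comp (PowerSeries.map (Int.castRingHom ℂ))
lemma Z_j (b : ℕ) : j b ∈ iZ.range := ⟨J b, rfl⟩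
lemma Z_q : q ∈ iZ.range := ⟨X, by rw [iZ, RingHom.comp_apply, map_X]; rfl⟩
lemma Z_inv (b : ℕ) (hb : 1 ≤ b) : (j b)⁻¹ ∈ iZ.range := by
  have h1 : constantCoeff (J b) = 1 := by
    have := constCoeff_JC b hb
    rw [JC, ← coeff_zero_eq_constantCoeff_apply, coeff_map, coeff_zero_eq_constantCoeff_apply] at this
    simpa using this
  obtain ⟨v, hv⟩ := (isUnit_iff_constantCoeff.2 (by rw [h1]; exact isUnit_one) : IsUnit (J b)).exists_right_inv
  refine ⟨v, ?_⟩
  have h2 : j b * iZ v = 1 := by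
    have := congrArg iZ hv
    rwa [map_mul, map_one] at this
  exact eq_inv_of_mul_eq_one_right h2
lemma s_eq : sL = q * j 7^4*((j 1)⁻¹)^4 := by
  rw [sL, tt]; have := j1; have := j7; have := q_ne; field_simp
lemma Z_s : sL ∈ iZ.range := by
  rw [s_eq]; exact mul_mem (mul_mem Z_q (pow_mem (Z_j 7) _)) (pow_mem (Z_inv 1 (by norm_num)) _)
lemma Z_u : uL ∈ iZ.range := by
  have e : uL = sL * (q*(j 1 * j 14 * ((j 2)⁻¹ * (j 7)⁻¹))^4) := by
    rw [uL, aa]; have := j2; have := j7; field_simp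
  rw [e]
  exact mul_mem Z_s (mul_mem Z_q (pow_mem (mul_mem (mul_mem (Z_j _) (Z_j _)) (mul_mem (Z_inv 2 (by norm_num)) (Z_inv 7 (by norm_num)))) _))
lemma Z_w : wL ∈ iZ.range := by
  have e : wL = uL - j 7^4*((j 1)⁻¹)^4*(j 1 * j 7 * ((j 2)⁻¹ * (j 14)⁻¹))^3 := by
    rw [wL, s_eq, bb]; have := j1; have := j2; have := j14; have := q_ne; field_simp
  rw [e]
  exact sub_mem Z_u (mul_mem (mul_mem (pow_mem (Z_j 7) _) (pow_mem (Z_inv 1 (by norm_num)) _))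
    (pow_mem (mul_mem (mul_mem (Z_j _) (Z_j _)) (mul_mem (Z_inv 2 (by norm_num)) (Z_inv 14 (by norm_num)))) _))
lemma h_eq : hL = q * j 7^5 * j 2^3 * j 14^3 / (j 1^10 * j 49) := by
  rw [hL, xi, s_eq, bb]; have := j1; have := j2; have := j7; have := j14; have := j49; have := q_ne
  field_simp
lemma Z_h : hL ∈ iZ.range := by
  have e : hL = q * j 7^5 * j 2^3 * j 14^3 * (((j 1)⁻¹)^10 * (j 49)⁻¹) := by
    rw [h_eq]; have := j1; have := j49; field_simp
  rw [e]
  exact mul_mem (mul_mem (mul_mem (mul_mem Z_q (pow_mem (Z_j _) _)) (pow_mem (Z_j _) _)) (pow_mem (Z_j _) _)) (mul_mem (pow_mem (Z_inv 1 (by norm_num)) _) (Z_inv 49 (by norm_num)))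

def PV (n : ℤ) (y : LL) : Prop := ∃ f, y = ii f ∧ ∀ k, VA n (coeff k f)
lemma VA_sum {ι : Type*} (s : Finset ι) (n : ℤ) (f : ι → ℂ) (h : ∀ i ∈ s, VA n (f i)) : VA n (∑ i ∈ s, f i) :=
  Finset.sum_induction f (VA n) (fun _ _ => VA.add) (VA_zero n) h
lemma PV.add {n : ℤ} {x y : LL} (hx : PV n x) (hy : PV n y) : PV n (x+y) := by
  obtain ⟨f, rfl, hf⟩ := hx
  obtain ⟨g, rfl, hg⟩ := hy
  exact ⟨f+g, (map_add _ _ _).symm, fun k => by rw [map_add]; exact (hf k).add (hg k)⟩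
lemma PV_zero (n : ℤ) : PV n 0 := ⟨0, (map_zero _).symm, fun k => by rw [map_zero]; exact VA_zero n⟩
lemma PV.mulZ {n : ℤ} {x z : LL} (hx : PV n x) (hz : z ∈ iZ.range) : PV n (x*z) := by
  obtain ⟨f, rfl, hf⟩ := hx
  obtain ⟨g, rfl⟩ := hz
  refine ⟨f * PowerSeries.map (Int.castRingHom ℂ) g, by rw [map_mul]; rfl, fun k => ?_⟩
  rw [coeff_mul]
  refine VA_sum _ _ _ fun p _ => ?_
  rw [coeff_map]
  exact ((hf p.1).mul (VA0.2 (intA _))).cast (add_zero n) rfl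
lemma PV_cc {n : ℤ} {c : ℂ} (h : VA n c) : PV n (cc c) := by
  refine ⟨C c, rfl, fun k => ?_⟩
  rw [coeff_C]; split_ifs
  · exact h
  · exact VA_zero n
lemma PV_eQ (n : ℤ) (c : Polynomial ℚ) (h : ∀ k : ℕ, VA n (c.coeff k : ℚ)) : PV n (eQ c) := by
  rw [eQ_sum]
  exact Finset.sum_induction _ (PV n) (fun _ _ => PV.add) (PV_zero n) fun k _ => (PV_cc (h k)).mulZ (pow_mem Z_s k)
lemma PV_form (n : ℤ) (c d e : Polynomial ℚ) (hc : ∀ k : ℕ, VA n (c.coeff k : ℚ)) (hd : ∀ k : ℕ, VA n (d.coeff k : ℚ)) (he : ∀ k : ℕ, VA n (e.coeff k : ℚ)) :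
    PV n (eQ c + eQ d * wL + eQ e * uL) :=
  ((PV_eQ n c hc).add ((PV_eQ n d hd).mulZ Z_w)).add ((PV_eQ n e he).mulZ Z_u)
lemma PV_M {m : ℤ} {y : LL} (h : LatM m y) : PV (8*m) y := by
  obtain ⟨c, d, e, rfl, hc, hd, he, -⟩ := h
  exact PV_form _ _ _ _ (fun k => (hc k).mono (by linarith)) (fun k => (hd k).mono (by linarith)) (fun k => (he k).mono (by linarith))
lemma PV_N {m : ℤ} {y : LL} (h : LatN m y) : PV (8*(m+1)) y := by
  obtain ⟨c, d, e, rfl, hc, hd, he, zc, zd⟩ := h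
  refine PV_form _ _ _ _ (fun k => ?_) (fun k => ?_) (fun k => (he k).mono (by linarith))
  · rcases k with _ | k
    · rw [zc, Rat.cast_zero]; exact VA_zero _
    · exact (hc (k+1)).mono (by push_cast; linarith)
  · rcases k with _ | k
    · rw [zd, Rat.cast_zero]; exact VA_zero _
    · exact (hd (k+1)).mono (by push_cast; linarith)

def FF (d3 : ℕ → ℤ) : ℕ → PowerSeries ℂ
  | 0 => PowerSeries.map (Int.castRingHom ℂ) (PowerSeries.mk d3)
  | a+1 => UU (X * FF d3 a)
lemma UU_V (G : LL) (F f : PowerSeries ℂ) (h : ii F = VV G * ii f) : ii (UU F) = G * ii (UU f) := by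
  apply VV.injective
  have h7 : (7:LL) ≠ 0 := by
    rw [pE8]; exact pow_ne_zero _ pE_ne
  apply mul_left_cancel₀ h7
  rw [← sum_sgm, map_mul, h]
  simp only [map_mul, sgm_VV]
  rw [← Finset.mul_sum, sum_sgm]; ring
lemma lamS (a : ℕ) : (5*7^(a+1)+1)/6 = 5*7^a + (5*7^a+1)/6 := by
  have h : ∃ t, 5*7^a+1 = 6*t := by
    induction a with
    | zero => exact ⟨1, rfl⟩
    | succ a ih => obtain ⟨t, ht⟩ := ih; exact ⟨5*7^a+t, by rw [pow_succ]; omega⟩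
  obtain ⟨t, ht⟩ := h
  rw [pow_succ]; omega
lemma FF_coeff (d3 : ℕ → ℤ) (a n : ℕ) : coeff (n+1) (FF d3 (a+1)) = (d3 (7^(a+1)*n + (5*7^(a+1)+1)/6) : ℂ) := by
  induction a generalizing n with
  | zero =>
    rw [FF, UU, coeff_mk, show 7*(n+1) = (7*n+6)+1 by ring, coeff_succ_X_mul, FF, coeff_map, coeff_mk]
    norm_num
  | succ a ih =>
    rw [FF, UU, coeff_mk, show 7*(n+1) = ((7*n+5)+1)+1 by ring, coeff_succ_X_mul, ih, lamS (a+1)]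
    congr 2; ring
def gO : LL := j 7 / (j 1^5 * j 2^3)
def gE : LL := j 2^3 / j 1^10
lemma Z_gO : gO ∈ iZ.range := by
  have e : gO = j 7 * (((j 1)⁻¹)^5 * ((j 2)⁻¹)^3) := by
    rw [gO]; have := j1; have := j2; field_simp
  rw [e]; exact mul_mem (Z_j _) (mul_mem (pow_mem (Z_inv 1 (by norm_num)) _) (pow_mem (Z_inv 2 (by norm_num)) _))
lemma Z_gE : gE ∈ iZ.range := by
  have e : gE = j 2^3 * ((j 1)⁻¹)^10 := by
    rw [gE]; have := j1; field_simp
  rw [e]; exact mul_mem (pow_mem (Z_j _) _) (pow_mem (Z_inv 1 (by norm_num)) _)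
lemma VgO : q * gE = VV gO * hL := by
  rw [gE, gO, h_eq]
  simp only [map_mul, map_pow, map_div₀, VV_j 1 (by norm_num), VV_j 2 (by norm_num), VV_j 7 (by norm_num)]
  have := j1; have := j2; have := j7; have := j14; have := j49
  norm_num; field_simp
lemma VgE : q * gO = VV gE * (sL*(uL-wL)) := by
  rw [← sb, s_eq, bb, gO, gE]
  simp only [map_mul, map_pow, map_div₀, VV_j 1 (by norm_num), VV_j 2 (by norm_num)]
  have := j1; have := j2; have := j7; have := j14; have := q_ne
  norm_num; field_simp
lemma FF0 (d3 : ℕ → ℤ) (hd : PowerSeries.mk d3 * (J 1) ^ 10 = (J 2) ^ 3) : ii (FF d3 0) = gE := by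
  have h := congrArg iZ hd
  rw [map_mul, map_pow, map_pow] at h
  rw [gE, eq_div_iff (pow_ne_zero _ j1)]; exact h
lemma stepO (d3 : ℕ → ℤ) (a : ℕ) (y : LL) (m : ℤ) (hy : LatM m y) (h : ii (FF d3 a) = gO * y) :
    ∃ y', LatN m y' ∧ ii (FF d3 (a+1)) = gE * y' := by
  obtain ⟨f, hf, -⟩ := ((PV_M hy).mulZ (mul_mem Z_s (sub_mem Z_u Z_w)))
  refine ⟨ii (UU f), T0 m y hy f (by rw [← hf]; ring), ?_⟩
  rw [FF]; apply UU_V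
  rw [← hf, map_mul, h, ← mul_assoc, show ii X = q from rfl, VgE]; ring
lemma stepE (d3 : ℕ → ℤ) (a : ℕ) (y : LL) (m : ℤ) (hy : LatN m y) (h : ii (FF d3 a) = gE * y) :
    ∃ y', LatM (m+1) y' ∧ ii (FF d3 (a+1)) = gO * y' := by
  obtain ⟨f, hf, -⟩ := ((PV_N hy).mulZ Z_h)
  refine ⟨ii (UU f), T1 m y hy f (by rw [← hf]; ring), ?_⟩
  rw [FF]; apply UU_V
  rw [← hf, map_mul, h, ← mul_assoc, show ii X = q from rfl, VgO]; ring
lemma odd_F (d3 : ℕ → ℤ) (hd : PowerSeries.mk d3 * (J 1) ^ 10 = (J 2) ^ 3) (i : ℕ) :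
    ∃ y, LatM i y ∧ ii (FF d3 (2*i+1)) = gO * y := by
  induction i with
  | zero =>
    obtain ⟨f, hf⟩ := Z_h
    refine ⟨ii (UU (PowerSeries.map (Int.castRingHom ℂ) f)), by simpa using T2 _ hf, ?_⟩
    rw [FF]; apply UU_V
    rw [show ii (PowerSeries.map (Int.castRingHom ℂ) f) = hL from hf, map_mul, FF0 d3 hd, show ii X = q from rfl, VgO]
  | succ i ih =>
    obtain ⟨y, hy, h⟩ := ih
    obtain ⟨y1, hy1, h1⟩ := stepO d3 _ y _ hy h
    obtain ⟨y2, hy2, h2⟩ := stepE d3 _ y1 _ hy1 h1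
    exact ⟨y2, by push_cast; exact hy2, h2⟩
lemma PV_VA {n : ℤ} {f : PowerSeries ℂ} (h : PV n (ii f)) (k : ℕ) : VA n (coeff k f) := by
  obtain ⟨g, e, hg⟩ := h
  rw [ii_inj e]; exact hg k

/-- for all α ≥ 1 and n ≥ 0, `d_3(7^α·n + λ_α) ≡ 0 (mod 7^⌊α/2⌋)`,
where `λ_α = (5·7^α + 1)/6` and `d_3` is defined by `∑ d_3(n) qⁿ = J_2^3 / J_1^{10}`. -/
theorem stmt0 (d3 : ℕ → ℤ)
    (hd : PowerSeries.mk d3 * (J 1) ^ 10 = (J 2) ^ 3)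
    (α : ℕ) (hα : 1 ≤ α) (n : ℕ) :
    (7 : ℤ) ^ (α / 2) ∣ d3 (7 ^ α * n + (5 * 7 ^ α + 1) / 6) := by
  apply int_dvd
  obtain ⟨a, rfl⟩ : ∃ a, α = a+1 := ⟨α-1, by omega⟩
  rw [← FF_coeff]
  apply PV_VA
  rcases Nat.even_or_odd' a with ⟨i, rfl | rfl⟩
  · obtain ⟨y, hy, h⟩ := odd_F d3 hd i
    rw [h, mul_comm gO, show (2*i+1)/2 = i by omega]
    exact (PV_M hy).mulZ Z_gO
  · obtain ⟨y, hy, h⟩ := odd_F d3 hd i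
    obtain ⟨y1, hy1, h1⟩ := stepO d3 _ y _ hy h
    rw [h1, mul_comm gE, show (2*i+1+1)/2 = i+1 by omega]
    push_cast
    exact (PV_N hy1).mulZ Z_gE
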